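/- Let p ≥ 1 and suppose u₀ ∈ C⁰(ℝⁿ) is positive, radially symmetric and nonincreasing with respect to |x|, satisfies u₀(x) → 0 as |x| → ∞, and ∫_{{x : u₀(x) < 1/2}} (ln(1/u₀(x)))^{−κ} dx < ∞ for some κ > 0. Then there exist t₀ > 1 and C > 0 such that the minimal solution u of the Cauchy problem (0) satisfies ‖u(·,t)‖_{L^∞(ℝⁿ)} ≤ C · t^{−1/p} · (ln t)^{2κ/(np)} for all t ≥ t₀. -/

import Mathlib

open Real Set MeasureTheory Metric Filter

/-- The Laplacian of a function on `ℝⁿ`, written via iterated Fréchet derivatives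
in the coordinate directions. -/
noncomputable def lap {n : ℕ} (f : EuclideanSpace ℝ (Fin n) → ℝ)
    (x : EuclideanSpace ℝ (Fin n)) : ℝ :=
  ∑ i : Fin n, fderiv ℝ (fun y => fderiv ℝ f y (EuclideanSpace.single i 1)) x
    (EuclideanSpace.single i 1)

/-- `u` is a positive classical solution of the Cauchy problem `u_t = u^p Δu`,
`u(·,0) = u₀`, on `ℝⁿ × (0,T)`: it is continuous on `ℝⁿ × [0,T)`, attains the initial
data, is positive and spatially `C²` for `0 < t < T`, and satisfies the PDE pointwise. -/
def IsSolOn (n : ℕ) (p : ℝ) (u₀ : EuclideanSpace ℝ (Fin n) → ℝ)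
    (u : EuclideanSpace ℝ (Fin n) → ℝ → ℝ) (T : ℝ) : Prop :=
  ContinuousOn (fun z : (EuclideanSpace ℝ (Fin n)) × ℝ => u z.1 z.2) {z | 0 ≤ z.2 ∧ z.2 < T} ∧
  (∀ x, u x 0 = u₀ x) ∧
  (∀ x, ∀ t, 0 < t → t < T → 0 < u x t) ∧
  (∀ t, 0 < t → t < T → ContDiff ℝ 2 (fun y => u y t)) ∧
  (∀ x, ∀ t, 0 < t → t < T →
    HasDerivAt (fun s => u x s) (u x t ^ p * lap (fun y => u y t) x) t)

/-- `u` is a global positive classical solution of the Cauchy problem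
`u_t = u^p Δu` on `ℝⁿ × (0,∞)`, `u(·,0) = u₀`. -/
def IsSol (n : ℕ) (p : ℝ) (u₀ : EuclideanSpace ℝ (Fin n) → ℝ)
    (u : EuclideanSpace ℝ (Fin n) → ℝ → ℝ) : Prop :=
  ContinuousOn (fun z : (EuclideanSpace ℝ (Fin n)) × ℝ => u z.1 z.2) {z | 0 ≤ z.2} ∧
  (∀ x, u x 0 = u₀ x) ∧
  (∀ x, ∀ t, 0 < t → 0 < u x t) ∧
  (∀ t, 0 < t → ContDiff ℝ 2 (fun y => u y t)) ∧
  (∀ x, ∀ t, 0 < t →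
    HasDerivAt (fun s => u x s) (u x t ^ p * lap (fun y => u y t) x) t)

/-- `u` is the minimal global positive classical solution of the Cauchy problem:
whenever `T ∈ (0,∞]` and `v` is a positive classical solution on `ℝⁿ × (0,T)`, then
`u ≤ v` there.  (Quantifying over all finite `T > 0` covers `T = ∞`, since the
restriction of a global solution solves the problem on every `(0,T)`.) -/
def IsMinimalSol (n : ℕ) (p : ℝ) (u₀ : EuclideanSpace ℝ (Fin n) → ℝ)
    (u : EuclideanSpace ℝ (Fin n) → ℝ → ℝ) : Prop :=
  IsSol n p u₀ u ∧
  ∀ T > (0:ℝ), ∀ v, IsSolOn n p u₀ v T → ∀ x, ∀ t, 0 ≤ t → t < T → u x t ≤ v x t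


/-- Finite-index maximum principle. -/
theorem finMP {ι : Type*} (s : Finset ι) (Z Z' : ι → ℝ → ℝ) (a b C : ℝ)
    (hc : ∀ i ∈ s, ContinuousOn (Z i) (Icc a b))
    (hd : ∀ i ∈ s, ∀ t ∈ Ioo a b, HasDerivAt (Z i) (Z' i t) t)
    (h0 : ∀ i ∈ s, Z i a ≤ 0)
    (hmax : ∀ i ∈ s, ∀ t ∈ Ioo a b, 0 < Z i t → (∀ j ∈ s, Z j t ≤ Z i t) →
      Z' i t ≤ C * Z i t) :
    ∀ i ∈ s, ∀ t ∈ Icc a b, Z i t ≤ 0 := by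
  have main : ∀ i ∈ s, ∀ t ∈ Ioo a b, Z i t ≤ 0 := by
    intro i hi t₁ ht₁
    by_contra hpos
    push Not at hpos
    set D : ℝ := max C 0 + 1 with hD
    have hCD : C < D := by have := le_max_left C 0; linarith
    set ε : ℝ := Z i t₁ * exp (-(D * (t₁ - a))) with hε
    have hεpos : 0 < ε := by positivity
    let g : ℝ → ℝ := fun t => ε * exp (D * (t - a))
    have hgpos : ∀ t, 0 < g t := fun t => by positivity
    have hgd : ∀ t, HasDerivAt g (D * g t) t := by
      intro t
      have h1 : HasDerivAt (fun t : ℝ => D * (t - a)) D t := by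
        simpa using ((hasDerivAt_id t).sub_const a).const_mul D
      have := (h1.exp).const_mul ε
      refine this.congr_deriv ?_
      change ε * (exp (D * (t - a)) * D) = D * (ε * exp (D * (t - a)))
      ring
    have hgc : Continuous g := by fun_prop
    have hg1 : g t₁ = Z i t₁ := by
      simp only [g, hε]; rw [mul_assoc, ← exp_add]; simp
    have hs : s.Nonempty := ⟨i, hi⟩
    let A : Set ℝ := {t | t ∈ Icc a t₁ ∧ ∃ j ∈ s, g t ≤ Z j t}
    have hAcl : IsClosed A := by
      have : A = ⋃ j ∈ s, {t | t ∈ Icc a t₁ ∧ g t ≤ Z j t} := by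
        ext t; simp [A]
      rw [this]
      refine isClosed_biUnion_finset ?_
      intro j hj
      have hcj : ContinuousOn (Z j) (Icc a t₁) :=
        (hc j hj).mono (Icc_subset_Icc le_rfl ht₁.2.le)
      exact isClosed_Icc.isClosed_le (hgc.continuousOn (s := Icc a t₁)) hcj
    have hAne : A.Nonempty := ⟨t₁, ⟨ht₁.1.le, le_rfl⟩, i, hi, hg1.le⟩
    have hAbd : BddBelow A := ⟨a, fun t ht => ht.1.1⟩
    have hmem : sInf A ∈ A := hAcl.csInf_mem hAne hAbd
    set τ := sInf A with hτ
    have hlt : ∀ t ∈ Icc a t₁, t < τ → ∀ j ∈ s, Z j t < g t := by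
      intro t ht htτ j hj
      by_contra hcon
      push Not at hcon
      have : τ ≤ t := csInf_le hAbd ⟨ht, j, hj, hcon⟩
      linarith
    obtain ⟨hτm, j, hj, hjτ⟩ := hmem
    have hτa : a < τ := by
      rcases hτm.1.lt_or_eq with h | h
      · exact h
      · exfalso
        have := h0 j hj
        rw [← h] at hjτ
        have := hgpos a
        linarith
    have hτb : τ ∈ Ioo a b := ⟨hτa, lt_of_le_of_lt hτm.2 ht₁.2⟩
    have hle : ∀ l ∈ s, Z l τ ≤ g τ := by
      intro l hl
      have h1 : Tendsto (Z l) (nhdsWithin τ (Iio τ)) (nhds (Z l τ)) :=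
        ((hd l hl τ hτb).continuousAt.tendsto).mono_left nhdsWithin_le_nhds
      have h2 : Tendsto g (nhdsWithin τ (Iio τ)) (nhds (g τ)) :=
        (hgc.tendsto τ).mono_left nhdsWithin_le_nhds
      refine le_of_tendsto_of_tendsto h1 h2 ?_
      have : Ioo a τ ∈ nhdsWithin τ (Iio τ) := Ioo_mem_nhdsLT hτa
      filter_upwards [this] with t ht
      exact (hlt t ⟨ht.1.le, ht.2.le.trans hτm.2⟩ ht.2 l hl).le
    have heq : Z j τ = g τ := le_antisymm (hle j hj) hjτ
    have hder := hmax j hj τ hτb (by rw [heq]; exact hgpos τ)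
      (fun l hl => by rw [heq]; exact hle l hl)
    have hV : HasDerivAt (fun t => Z j t - g t) (Z' j τ - D * g τ) τ :=
      (hd j hj τ hτb).sub (hgd τ)
    have hneg : Z' j τ - D * g τ < 0 := by
      rw [heq] at hder
      have := mul_lt_mul_of_pos_right hCD (hgpos τ)
      linarith
    have hsl := (hasDerivAt_iff_tendsto_slope.1 hV).eventually (gt_mem_nhds hneg)
    have h3 : ∀ᶠ t in nhdsWithin τ (Iio τ), slope (fun t => Z j t - g t) τ t < 0 :=
      hsl.filter_mono (nhdsWithin_mono _ (fun x hx => ne_of_lt hx))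
    have h4 : ∀ᶠ t in nhdsWithin τ (Iio τ), t ∈ Ioo a τ := Ioo_mem_nhdsLT hτa
    obtain ⟨t, ht3, ht4⟩ := (h3.and h4).exists
    have h5 := hlt t ⟨ht4.1.le, ht4.2.le.trans hτm.2⟩ ht4.2 j hj
    rw [slope_def_field] at ht3
    have : 0 < (Z j t - g t - (Z j τ - g τ)) / (t - τ) := by
      apply div_pos_of_neg_of_neg
      · rw [heq]; linarith
      · linarith [ht4.2]
    linarith
  intro i hi t ht
  rcases ht.1.eq_or_lt with h | h
  · rw [← h]; exact h0 i hi
  rcases ht.2.lt_or_eq with h' | h'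
  · exact main i hi t ⟨h, h'⟩
  · subst h'
    have h1 : Tendsto (Z i) (nhdsWithin t (Ioo a t)) (nhds (Z i t)) :=
      ((hc i hi) t ⟨h.le, le_rfl⟩).tendsto.mono_left (nhdsWithin_mono _ Ioo_subset_Icc_self)
    have : (nhdsWithin t (Ioo a t)).NeBot := right_nhdsWithin_Ioo_neBot h
    refine le_of_tendsto h1 ?_
    filter_upwards [self_mem_nhdsWithin] with r hr
    exact main i hi r hr

/-- Discrete radial Laplacian in the variable `s = r²/2` with mesh `h`. -/
noncomputable def Lop (m : ℝ) (h : ℝ) (f : ℕ → ℝ) (i : ℕ) : ℝ :=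
  ((2 * i + m) * (f (i + 1) - f i) - 2 * i * (f i - f (i - 1))) / h

/-- Difference quotient. -/
noncomputable def Dq (h : ℝ) (f : ℕ → ℝ) (i : ℕ) : ℝ := (f (i + 1) - f i) / h

theorem Dq_Lop (m h : ℝ) (f : ℕ → ℝ) (i : ℕ) :
    Dq h (Lop m h f) i = Lop (m + 2) h (Dq h f) i := by
  cases i with
  | zero => simp [Dq, Lop]; ring
  | succ i => simp [Dq, Lop]; ring

theorem Lop_eq (m h : ℝ) (f : ℕ → ℝ) (i : ℕ) :
    Lop m h f i = (2 * i + m) * Dq h f i - 2 * i * Dq h f (i - 1) := by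
  cases i with
  | zero => simp [Dq, Lop]; ring
  | succ i => simp [Dq, Lop]; ring

theorem Lop_nonpos_of_max (m h : ℝ) (hm : 0 ≤ m) (hh : 0 < h) (f : ℕ → ℝ) (i : ℕ)
    (h1 : f (i + 1) ≤ f i) (h2 : f (i - 1) ≤ f i) : Lop m h f i ≤ 0 := by
  unfold Lop
  apply div_nonpos_of_nonpos_of_nonneg _ hh.le
  have a1 : (2 * (i:ℝ) + m) * (f (i + 1) - f i) ≤ 0 :=
    mul_nonpos_of_nonneg_of_nonpos (by positivity) (by linarith)
  have a2 : 0 ≤ 2 * (i:ℝ) * (f i - f (i - 1)) := mul_nonneg (by positivity) (by linarith)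
  linarith

theorem Lop_add (m h : ℝ) (f g : ℕ → ℝ) (i : ℕ) :
    Lop m h (fun j => f j + g j) i = Lop m h f i + Lop m h g i := by
  simp only [Lop]; ring

theorem Lop_sub (m h : ℝ) (f g : ℕ → ℝ) (i : ℕ) :
    Lop m h (fun j => f j - g j) i = Lop m h f i - Lop m h g i := by
  simp only [Lop]; ring

theorem Lop_smul (m h c : ℝ) (f : ℕ → ℝ) (i : ℕ) :
    Lop m h (fun j => c * f j) i = c * Lop m h f i := by
  simp only [Lop]; ring

theorem Lop_const (m h c : ℝ) (i : ℕ) : Lop m h (fun _ => c) i = 0 := by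
  simp [Lop]

theorem Lop_hasDerivAt (m h : ℝ) (f : ℕ → ℝ → ℝ) (f' : ℕ → ℝ) (t : ℝ)
    (hf : ∀ i, HasDerivAt (f i) (f' i) t) (i : ℕ) :
    HasDerivAt (fun t => Lop m h (fun j => f j t) i) (Lop m h f' i) t := by
  simp only [Lop]
  have h1 := ((hf (i+1)).sub (hf i)).const_mul (2 * (i:ℝ) + m)
  have h2 := ((hf i).sub (hf (i-1))).const_mul (2 * (i:ℝ))
  exact (h1.sub h2).div_const h


/-- A solution of the semidiscrete radial problem. -/
structure DSol (n N : ℕ) (p h M T : ℝ) (u : ℕ → ℝ → ℝ) : Prop where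
  hn : 1 ≤ n
  hp : 1 ≤ p
  hh : 0 < h
  hM : 0 < M
  hT : 0 < T
  cont : ∀ i, ContinuousOn (u i) (Icc 0 T)
  der : ∀ i, ∀ t ∈ Ioo 0 T, HasDerivAt (u i) (u i t ^ p * Lop n h (fun j => u j t) i) t
  zero : ∀ i, N < i → ∀ t, u i t = 0
  pos : ∀ i ≤ N, ∀ t ∈ Icc 0 T, 0 < u i t
  le : ∀ i, ∀ t ∈ Icc 0 T, u i t ≤ M
  anti0 : ∀ i, u (i + 1) 0 ≤ u i 0

/-- Extension by zero. -/
noncomputable def extz (N : ℕ) (v : Fin (N + 1) → ℝ) (j : ℕ) : ℝ :=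
  if hj : j < N + 1 then v ⟨j, hj⟩ else 0

/-- Clip to `[0, M]`. -/
noncomputable def clipM (M x : ℝ) : ℝ := max 0 (min x M)

theorem clipM_nonneg (M x : ℝ) : 0 ≤ clipM M x := le_max_left _ _
theorem clipM_le (M x : ℝ) (hM : 0 ≤ M) : clipM M x ≤ M := max_le hM (min_le_right _ _)
theorem clipM_of (M x : ℝ) (h0 : 0 ≤ x) (h1 : x ≤ M) : clipM M x = x := by
  simp [clipM, h0, h1]
theorem clipM_lip (M x y : ℝ) : |clipM M x - clipM M y| ≤ |x - y| := by
  unfold clipM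
  rw [max_comm 0, max_comm 0]
  refine (abs_max_sub_max_le_abs _ _ _).trans ?_
  refine (abs_min_sub_min_le_max _ _ _ _).trans ?_
  simp

theorem lattice_ode (n N : ℕ) (p h M T : ℝ) (hp : 1 ≤ p) (hM : 0 < M)
    (hT : 0 < T) (g : Fin (N + 1) → ℝ) :
    ∃ α : ℝ → Fin (N + 1) → ℝ, α 0 = g ∧ ∀ t ∈ Icc 0 T, HasDerivWithinAt α
      (fun i => clipM M (α t i) ^ p * Lop n h (extz N fun k => clipM M (α t k)) i) (Icc 0 T) t := by
  let G : (Fin (N + 1) → ℝ) → (Fin (N + 1) → ℝ) := fun v i => v i ^ p * Lop n h (extz N v) i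
  have hGd : ContDiff ℝ 1 G := by
    rw [contDiff_pi]
    intro i
    have he : ∀ j, ContDiff ℝ 1 (fun v : Fin (N+1) → ℝ => extz N v j) := by
      intro j
      unfold extz
      by_cases hj : j < N + 1
      · simp only [hj, dite_true]; fun_prop
      · simp only [hj, dite_false]; fun_prop
    have h1 : ContDiff ℝ 1 (fun v : Fin (N+1) → ℝ => v i ^ p) := by
      have := contDiff_rpow_const_of_le (p := p) (n := 1) (by simpa using hp)
      have h2 : ContDiff ℝ 1 (fun v : Fin (N+1) → ℝ => v i) := by fun_prop
      exact this.comp h2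
    refine h1.mul ?_
    unfold Lop
    exact ((contDiff_const.mul ((he _).sub (he _))).sub
      (contDiff_const.mul ((he _).sub (he _)))).div_const _
  let B : Set (Fin (N + 1) → ℝ) := Icc (fun _ => 0) (fun _ => M)
  have hBc : IsCompact B := isCompact_Icc
  obtain ⟨K, hK⟩ := (hGd.locallyLipschitz.locallyLipschitzOn
    (s := B)).exists_lipschitzOnWith_of_compact hBc
  obtain ⟨L, hL⟩ := hBc.exists_bound_of_continuousOn hGd.continuous.continuousOn
  let cl : (Fin (N + 1) → ℝ) → (Fin (N + 1) → ℝ) := fun v i => clipM M (v i)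
  have hclB : ∀ v, cl v ∈ B := fun v =>
    ⟨fun i => clipM_nonneg _ _, fun i => clipM_le _ _ hM.le⟩
  have hcl : LipschitzWith 1 cl := by
    refine LipschitzWith.of_dist_le_mul ?_
    intro v w
    simp only [NNReal.coe_one, one_mul]
    rw [dist_pi_le_iff dist_nonneg]
    intro i
    refine le_trans ?_ (dist_le_pi_dist v w i)
    exact clipM_lip _ _ _
  have hFl : LipschitzWith (K * 1) (G ∘ cl) := by
    have := hK.comp (hcl.lipschitzOnWith (s := univ)) (fun v _ => hclB v)
    exact lipschitzOnWith_univ.1 this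
  let L' : NNReal := ⟨max L 0, le_max_right _ _⟩
  let a : NNReal := L' * ⟨T, hT.le⟩
  have hPL : IsPicardLindelof (fun _ => G ∘ cl) (⟨0, le_rfl, hT.le⟩ : Icc (0:ℝ) T) g a 0 L'
      (K * 1) := by
    refine IsPicardLindelof.of_time_independent ?_ hFl.lipschitzOnWith ?_
    · intro x _
      exact (hL _ (hclB x)).trans (le_max_left _ _)
    · simp only [sub_zero, sub_self, NNReal.coe_zero]
      rw [max_eq_left hT.le]
      exact (NNReal.coe_mul L' ⟨T, hT.le⟩).ge
  exact hPL.exists_eq_forall_mem_Icc_hasDerivWithinAt₀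

theorem extz_nonneg {N : ℕ} {v : Fin (N + 1) → ℝ} (hv : ∀ k, 0 ≤ v k) (j : ℕ) :
    0 ≤ extz N v j := by
  unfold extz; split_ifs
  · exact hv _
  · exact le_rfl

theorem extz_le {N : ℕ} {v : Fin (N + 1) → ℝ} {M : ℝ} (hM : 0 ≤ M) (hv : ∀ k, v k ≤ M) (j : ℕ) :
    extz N v j ≤ M := by
  unfold extz; split_ifs
  · exact hv _
  · exact hM

theorem extz_fin {N : ℕ} (v : Fin (N + 1) → ℝ) (i : Fin (N + 1)) : extz N v i = v i := by
  simp only [extz, i.2, dite_true]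

theorem Lop_lower (m h : ℝ) (hm : 0 ≤ m) (hh : 0 < h) (f : ℕ → ℝ) (hf : ∀ j, 0 ≤ f j) (i : ℕ) :
    -((4 * i + m) / h) * f i ≤ Lop m h f i := by
  unfold Lop
  rw [← neg_div, div_mul_eq_mul_div]
  gcongr
  have h1 : 0 ≤ (2 * (i:ℝ) + m) * f (i + 1) := mul_nonneg (by positivity) (hf _)
  have h2 : 0 ≤ 2 * (i:ℝ) * f (i - 1) := mul_nonneg (by positivity) (hf _)
  nlinarith

theorem exists_DSol (n N : ℕ) (p h M T : ℝ) (hn : 1 ≤ n) (hp : 1 ≤ p) (hh : 0 < h) (hM : 0 < M)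
    (hT : 0 < T) (g : ℕ → ℝ) (hg0 : ∀ i, 0 < g i) (hgM : ∀ i, g i ≤ M)
    (hga : ∀ i, g (i + 1) ≤ g i) :
    ∃ u, DSol n N p h M T u ∧ ∀ i ≤ N, u i 0 = g i := by
  obtain ⟨α, hα0, hα⟩ := lattice_ode n N p h M T hp hM hT (fun i => g i)
  have hαi := fun t ht => hasDerivWithinAt_pi.1 (hα t ht)
  have hc : ∀ i, ContinuousOn (fun t => α t i) (Icc 0 T) := fun i t ht =>
    (hαi t ht i).continuousWithinAt
  have hd : ∀ i, ∀ t ∈ Ioo 0 T, HasDerivAt (fun t => α t i)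
      (clipM M (α t i) ^ p * Lop n h (extz N fun k => clipM M (α t k)) i) t := fun i t ht =>
    (hαi t (Ioo_subset_Icc_self ht) i).hasDerivAt (Icc_mem_nhds ht.1 ht.2)
  have hp0 : p ≠ 0 := by positivity
  -- upper bound
  have hup : ∀ i, ∀ t ∈ Icc 0 T, α t i ≤ M := by
    intro i t ht
    have := finMP Finset.univ (fun i t => α t i - M) (fun i t => clipM M (α t i) ^ p *
      Lop n h (extz N fun k => clipM M (α t k)) i) 0 T 0
      (fun i _ => (hc i).sub continuousOn_const) (fun i _ t ht => (hd i t ht).sub_const M)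
      (fun i _ => by simp only [hα0]; linarith [hgM i]) ?_ i (Finset.mem_univ _) t ht
    · linarith
    intro i _ t ht hpos _
    simp only [zero_mul]
    apply mul_nonpos_of_nonneg_of_nonpos (rpow_nonneg (clipM_nonneg _ _) _)
    have hci : clipM M (α t i) = M := by
      simp only [clipM]
      rw [min_eq_right (by linarith), max_eq_right hM.le]
    have hle : ∀ j, extz N (fun k => clipM M (α t k)) j ≤
        extz N (fun k => clipM M (α t k)) i := by
      intro j
      rw [extz_fin, hci]
      exact extz_le hM.le (fun k => clipM_le _ _ hM.le) j
    exact Lop_nonpos_of_max _ _ (by positivity) hh _ _ (hle _) (hle _)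
  have hnn : ∀ i, ∀ t ∈ Icc 0 T, 0 ≤ α t i := by
    intro i t ht
    have := finMP Finset.univ (fun i t => - α t i) (fun i t => -(clipM M (α t i) ^ p *
      Lop n h (extz N fun k => clipM M (α t k)) i)) 0 T 0
      (fun i _ => (hc i).neg) (fun i _ t ht => (hd i t ht).neg)
      (fun i _ => by simp only [hα0]; linarith [hg0 i]) ?_ i (Finset.mem_univ _) t ht
    · linarith
    intro i _ t ht hpos _
    have hci : clipM M (α t i) = 0 := by
      simp only [clipM]
      exact max_eq_left ((min_le_left _ _).trans (by linarith))
    rw [hci, zero_rpow hp0]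
    simp
  have hcl : ∀ t ∈ Icc 0 T, (fun k => clipM M (α t k)) = α t := by
    intro t ht; ext k; exact clipM_of _ _ (hnn k t ht) (hup k t ht)
  have hd2 : ∀ i, ∀ t ∈ Ioo 0 T, HasDerivAt (fun t => α t i)
      (α t i ^ p * Lop n h (extz N (α t)) i) t := by
    intro i t ht
    have := hd i t ht
    rw [hcl t (Ioo_subset_Icc_self ht)] at this
    have e : clipM M (α t i) = α t i :=
      clipM_of _ _ (hnn i t (Ioo_subset_Icc_self ht)) (hup i t (Ioo_subset_Icc_self ht))
    rwa [e] at this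
  have hpos : ∀ i, ∀ t ∈ Icc 0 T, 0 < α t i := by
    intro i t ht
    set C : ℝ := M ^ p * ((4 * i + n) / h) with hC
    have := finMP {i} (fun i t => g i * exp (-C * t) - α t i) (fun i t => g i * (-C * exp (-C * t))
      - α t i ^ p * Lop n h (extz N (α t)) i) 0 T (-C)
      (fun i _ => ContinuousOn.sub (by fun_prop) (hc i)) ?_
      (fun i _ => by simp [hα0]) ?_ i (Finset.mem_singleton_self _) t ht
    · have : 0 < g i * exp (-C * t) := mul_pos (hg0 _) (exp_pos _)
      linarith
    · intro i _ t ht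
      refine HasDerivAt.sub ?_ (hd2 i t ht)
      have h1 : HasDerivAt (fun t : ℝ => -C * t) (-C) t := by
        simpa using (hasDerivAt_id t).const_mul (-C)
      exact (h1.exp.const_mul (g i)).congr_deriv (by ring)
    · intro j hj t ht hz _
      have hji : j = i := by simpa using hj
      subst hji
      have ht' := Ioo_subset_Icc_self ht
      have h1 : -((4 * (j:ℕ) + n) / h) * α t j ≤ Lop n h (extz N (α t)) j := by
        have := Lop_lower n h (by positivity) hh (extz N (α t))
          (extz_nonneg (fun k => hnn k t ht')) j
        rwa [extz_fin] at this
      have h2 : α t j ^ p * (-((4 * (j:ℕ) + n) / h) * α t j) ≤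
          α t j ^ p * Lop n h (extz N (α t)) j :=
        mul_le_mul_of_nonneg_left h1 (rpow_nonneg (hnn j t ht') _)
      have h3 : α t j ^ p ≤ M ^ p := rpow_le_rpow (hnn j t ht') (hup j t ht') (by linarith)
      have h4 : α t j ^ p * (((4 * (j:ℕ) + n) / h) * α t j) ≤
          M ^ p * (((4 * (j:ℕ) + n) / h) * α t j) :=
        mul_le_mul_of_nonneg_right h3 (mul_nonneg (by positivity) (hnn j t ht'))
      have : C * α t j = M ^ p * (((4 * (j:ℕ) + n) / h) * α t j) := by rw [hC]; ring
      nlinarith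
  refine ⟨fun i t => extz N (α t) i, ⟨hn, hp, hh, hM, hT, ?_, ?_, ?_, ?_, ?_, ?_⟩, ?_⟩
  · intro i
    by_cases hi : i < N + 1
    · simpa [extz, hi] using hc ⟨i, hi⟩
    · simpa [extz, hi] using continuousOn_const
  · intro i t ht
    by_cases hi : i < N + 1
    · have := hd2 ⟨i, hi⟩ t ht
      have e : ∀ t, extz N (α t) i = α t ⟨i, hi⟩ := fun t => extz_fin (α t) ⟨i, hi⟩
      simp only [e]
      exact this
    · have e : ∀ t, extz N (α t) i = 0 := fun t => by simp [extz, hi]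
      simp only [e, zero_rpow hp0, zero_mul]
      exact hasDerivAt_const _ _
  · intro i hi t
    simp [extz, show ¬ i < N + 1 by omega]
  · intro i hi t ht
    simpa [extz, show i < N + 1 by omega] using hpos ⟨i, by omega⟩ t ht
  · intro i t ht
    exact extz_le hM.le (fun k => hup k t ht) i
  · intro i
    simp only [hα0, extz]
    split_ifs with h1 h2 h2
    · exact hga i
    · omega
    · exact (hg0 _).le
    · exact le_rfl
  · intro i hi
    simp [hα0, extz, show i < N + 1 by omega]


theorem rpow_sub_le {p a b M : ℝ} (hp : 1 ≤ p) (ha : 0 ≤ a) (hab : a ≤ b) (hbM : b ≤ M) :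
    b ^ p - a ^ p ≤ p * M ^ (p - 1) * (b - a) := by
  rcases (ha.trans hab).eq_or_lt with hb | hb
  · have : a = 0 := by linarith
    subst this; subst hb; simp
  have h1 := one_add_mul_self_le_rpow_one_add (s := a / b - 1) (by
    have : 0 ≤ a / b := by positivity
    linarith) hp
  have h2 : 1 + (a / b - 1) = a / b := by ring
  rw [h2, div_rpow ha hb.le] at h1
  have hbp : 0 < b ^ p := rpow_pos_of_pos hb p
  have h3 : b ^ p = b ^ (p - 1) * b := by
    rw [← rpow_add_one hb.ne']; ring_nf
  have h4 : (1 + p * (a / b - 1)) * b ^ p ≤ a ^ p := by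
    have := mul_le_mul_of_nonneg_right h1 hbp.le
    rwa [div_mul_cancel₀ _ hbp.ne'] at this
  have h5 : (1 + p * (a / b - 1)) * b ^ p = b ^ p - p * b ^ (p - 1) * (b - a) := by
    rw [h3]; field_simp; ring
  have h6 : b ^ (p - 1) ≤ M ^ (p - 1) := rpow_le_rpow hb.le hbM (by linarith)
  have h7 : p * b ^ (p - 1) * (b - a) ≤ p * M ^ (p - 1) * (b - a) := by
    apply mul_le_mul_of_nonneg_right _ (by linarith)
    exact mul_le_mul_of_nonneg_left h6 (by linarith)
  linarith

theorem rpow_le_mul {p a M : ℝ} (hp : 1 ≤ p) (ha : 0 ≤ a) (haM : a ≤ M) :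
    a ^ p ≤ M ^ (p - 1) * a := by
  rcases ha.eq_or_lt with h | h
  · subst h; rw [zero_rpow (by linarith)]; simp
  have h3 : a ^ p = a ^ (p - 1) * a := by
    rw [← rpow_add_one h.ne']; ring_nf
  rw [h3]
  exact mul_le_mul_of_nonneg_right (rpow_le_rpow ha haM (by linarith)) ha

/-- The time derivative as function of the solution. -/
noncomputable def Wd (n : ℕ) (p h : ℝ) (u : ℕ → ℝ → ℝ) (i : ℕ) (t : ℝ) : ℝ :=
  u i t ^ p * Lop n h (fun j => u j t) i

namespace DSol
variable {n N : ℕ} {p h M T : ℝ} {u : ℕ → ℝ → ℝ}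

theorem nonneg (H : DSol n N p h M T u) (i : ℕ) {t : ℝ} (ht : t ∈ Icc 0 T) : 0 ≤ u i t := by
  by_cases hi : i ≤ N
  · exact (H.pos i hi t ht).le
  · exact (H.zero i (by omega) t).ge

theorem Lop_le (H : DSol n N p h M T u) {i : ℕ} (hi : i ≤ N) {t : ℝ} (ht : t ∈ Icc 0 T) :
    Lop n h (fun j => u j t) i ≤ (4 * N + n) * M / h := by
  unfold Lop
  have hh := H.hh
  gcongr
  have a1 := H.le (i+1) t ht
  have a2 := H.le (i-1) t ht
  have a3 := H.nonneg i ht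
  have hM := H.hM
  have hiN : (i:ℝ) ≤ N := by exact_mod_cast hi
  have b1 : (2 * (i:ℝ) + n) * (u (i+1) t - u i t) ≤ (2 * i + n) * M :=
    mul_le_mul_of_nonneg_left (by linarith) (by positivity)
  have b2 : 2 * (i:ℝ) * (u (i-1) t - u i t) ≤ 2 * i * M :=
    mul_le_mul_of_nonneg_left (by linarith) (by positivity)
  have b3 : (i:ℝ) * M ≤ N * M := mul_le_mul_of_nonneg_right hiN hM.le
  nlinarith

theorem anti (H : DSol n N p h M T u) (i : ℕ) {t : ℝ} (ht : t ∈ Icc 0 T) :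
    u (i + 1) t ≤ u i t := by
  by_cases hi : i ≤ N
  swap
  · rw [H.zero i (by omega), H.zero (i+1) (by omega)]
  have hh := H.hh
  have hp := H.hp
  have hM := H.hM
  have := finMP (Finset.range (N + 1)) (fun i t => u (i + 1) t - u i t)
    (fun i t => u (i+1) t ^ p * Lop n h (fun j => u j t) (i+1)
      - u i t ^ p * Lop n h (fun j => u j t) i) 0 T
    (p * M ^ (p - 1) * ((4 * N + n) * M / h))
    (fun i _ => (H.cont _).sub (H.cont _)) (fun i _ t ht => (H.der _ t ht).sub (H.der _ t ht))
    (fun i _ => by linarith [H.anti0 i]) ?_ i (Finset.mem_range.2 (by omega)) t ht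
  · linarith
  clear hi ht t i
  intro i hi t ht hZ hmax
  have hi : i ≤ N := by have := Finset.mem_range.1 hi; omega
  have ht' := Ioo_subset_Icc_self ht
  have hall : ∀ j, u (j+1) t - u j t ≤ u (i+1) t - u i t := by
    intro j
    by_cases hj : j ≤ N
    · exact hmax j (Finset.mem_range.2 (by omega))
    · rw [H.zero j (by omega), H.zero (j+1) (by omega)]; linarith
  have e : Lop n h (fun j => u j t) (i+1) = Lop n h (fun j => u j t) i +
      Lop (n + 2) h (fun j => u (j+1) t - u j t) i := by
    have := Dq_Lop n h (fun j => u j t) i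
    have e2 : Lop (n+2) h (Dq h (fun j => u j t)) i =
        Lop (n+2) h (fun j => u (j+1) t - u j t) i / h := by
      simp only [Lop, Dq]; field_simp
    rw [e2, Dq] at this
    field_simp at this
    linarith
  rw [e]
  have hLn := Lop_nonpos_of_max (n + 2) h (by positivity) hh
    (fun j => u (j+1) t - u j t) i (hall _) (hall _)
  have c1 : u (i+1) t ^ p * Lop (n + 2) h (fun j => u (j+1) t - u j t) i ≤ 0 :=
    mul_nonpos_of_nonneg_of_nonpos (rpow_nonneg (H.nonneg _ ht') _) hLn
  have c2 := rpow_sub_le hp (H.nonneg i ht') (by linarith : u i t ≤ u (i+1) t) (H.le _ t ht')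
  have c3 := H.Lop_le hi ht'
  have c4 : 0 ≤ u (i+1) t ^ p - u i t ^ p := by
    have := rpow_le_rpow (H.nonneg i ht') (by linarith : u i t ≤ u (i+1) t) (by linarith : 0 ≤ p)
    linarith
  have c5 : (u (i+1) t ^ p - u i t ^ p) * Lop n h (fun j => u j t) i ≤
      (u (i+1) t ^ p - u i t ^ p) * ((4 * N + n) * M / h) := mul_le_mul_of_nonneg_left c3 c4
  have c6 : (u (i+1) t ^ p - u i t ^ p) * ((4 * N + n) * M / h) ≤
      p * M ^ (p - 1) * (u (i+1) t - u i t) * ((4 * N + n) * M / h) :=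
    mul_le_mul_of_nonneg_right c2 (by positivity)
  nlinarith

theorem antitone (H : DSol n N p h M T u) {t : ℝ} (ht : t ∈ Icc 0 T) :
    Antitone (fun i => u i t) := antitone_nat_of_succ_le (fun i => H.anti i ht)

theorem wzero (H : DSol n N p h M T u) (i : ℕ) (hi : N < i) (t : ℝ) : Wd n p h u i t = 0 := by
  have hp := H.hp
  unfold Wd; rw [H.zero i hi, zero_rpow (by linarith), zero_mul]

theorem contL (H : DSol n N p h M T u) (m : ℝ) (i : ℕ) :
    ContinuousOn (fun t => Lop m h (fun j => u j t) i) (Icc 0 T) := by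
  unfold Lop
  have := H.cont
  fun_prop

theorem contp (H : DSol n N p h M T u) (i : ℕ) :
    ContinuousOn (fun t => u i t ^ p) (Icc 0 T) := by
  have hp := H.hp
  exact (H.cont i).rpow_const (fun t _ => Or.inr (by linarith))

theorem contw (H : DSol n N p h M T u) (i : ℕ) :
    ContinuousOn (Wd n p h u i) (Icc 0 T) := by
  unfold Wd
  exact (H.contp i).mul (H.contL _ i)

theorem derw (H : DSol n N p h M T u) (i : ℕ) {t : ℝ} (ht : t ∈ Ioo 0 T) :
    HasDerivAt (Wd n p h u i) (u i t ^ p * Lop n h (fun j => Wd n p h u j t) i +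
      p * Wd n p h u i t ^ 2 / u i t) t := by
  have hp := H.hp
  by_cases hi : i ≤ N
  swap
  · have e : Wd n p h u i = fun _ => 0 := by
      ext s; exact H.wzero i (by omega) s
    rw [e, H.zero i (by omega), zero_rpow (by linarith)]
    simpa using hasDerivAt_const t (0:ℝ)
  have h1 := (H.der i t ht).rpow_const (p := p) (Or.inr hp)
  have h2 := Lop_hasDerivAt n h u (fun j => Wd n p h u j t) t (fun j => H.der j t ht) i
  have h3 := h1.mul h2
  refine h3.congr_deriv ?_
  have hu := H.pos i hi t (Ioo_subset_Icc_self ht)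
  have e : u i t ^ (p - 1) = u i t ^ p / u i t := by rw [rpow_sub_one hu.ne']
  rw [e]
  simp only [Wd]
  field_simp
  ring

/-- Bénilan–Crandall. -/
theorem BC (H : DSol n N p h M T u) (i : ℕ) {t : ℝ} (ht : t ∈ Icc 0 T) :
    0 ≤ p * t * Wd n p h u i t + u i t := by
  by_cases hi : i ≤ N
  swap
  · rw [H.wzero i (by omega), H.zero i (by omega)]; simp
  have hh := H.hh
  have hp := H.hp
  have hM := H.hM
  have := finMP (Finset.range (N + 1)) (fun i t => -(p * t * Wd n p h u i t + u i t))
    (fun i t => -(p * Wd n p h u i t + p * t * (u i t ^ p * Lop n h (fun j => Wd n p h u j t) i +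
      p * Wd n p h u i t ^ 2 / u i t) + Wd n p h u i t)) 0 T
    (p * (M ^ (p - 1) * ((4 * N + n) * M / h)))
    (fun i _ => ?_) (fun i _ t ht => ?_)
    (fun i _ => by simp; exact H.nonneg i ⟨le_rfl, H.hT.le⟩) ?_ i (Finset.mem_range.2 (by omega))
      t ht
  · linarith
  · have := H.contw i
    have := H.cont i
    fun_prop
  · have h1 : HasDerivAt (fun t : ℝ => p * t) p t := by
      simpa using (hasDerivAt_id t).const_mul p
    exact ((h1.mul (H.derw i ht)).add (H.der i t ht)).neg
  clear hi ht t i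
  intro i hi t ht hZ hmax
  have hi : i ≤ N := by have := Finset.mem_range.1 hi; omega
  have ht' := Ioo_subset_Icc_self ht
  have hu := H.pos i hi t ht'
  have hall : ∀ j, -(p * t * Wd n p h u j t + u j t) ≤ -(p * t * Wd n p h u i t + u i t) := by
    intro j
    by_cases hj : j ≤ N
    · exact hmax j (Finset.mem_range.2 (by omega))
    · rw [H.wzero j (by omega), H.zero j (by omega)]; simp only [mul_zero, add_zero, neg_zero]
      exact hZ.le
  have hLn := Lop_nonpos_of_max n h (by positivity) hh
    (fun j => -(p * t * Wd n p h u j t + u j t)) i (hall _) (hall _)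
  have eL : Lop n h (fun j => -(p * t * Wd n p h u j t + u j t)) i =
      -(p * t * Lop n h (fun j => Wd n p h u j t) i + Lop n h (fun j => u j t) i) := by
    simp only [Lop]; ring
  set Lw := Lop n h (fun j => Wd n p h u j t) i
  set Lu := Lop n h (fun j => u j t) i with hLu
  set w := Wd n p h u i t with hw
  have ew : w = u i t ^ p * Lu := rfl
  rw [eL] at hLn
  have c1 : u i t ^ p * (-(p * t * Lw + Lu)) ≤ 0 :=
    mul_nonpos_of_nonneg_of_nonpos (rpow_nonneg hu.le _) hLn
  have c2 : w / u i t ≤ M ^ (p - 1) * ((4 * N + n) * M / h) := by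
    have e : w / u i t = u i t ^ (p-1) * Lu := by rw [ew, rpow_sub_one hu.ne']; ring
    rw [e]
    have c3 := H.Lop_le hi ht'
    have c4 : u i t ^ (p - 1) ≤ M ^ (p - 1) := rpow_le_rpow hu.le (H.le i t ht') (by linarith)
    calc u i t ^ (p-1) * Lu ≤ u i t ^ (p-1) * ((4 * N + n) * M / h) :=
          mul_le_mul_of_nonneg_left c3 (rpow_nonneg hu.le _)
      _ ≤ _ := mul_le_mul_of_nonneg_right c4 (by positivity)
  have c5 : p * (w / u i t) * -(p * t * w + u i t) ≤
      p * (M ^ (p - 1) * ((4 * N + n) * M / h)) * -(p * t * w + u i t) :=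
    mul_le_mul_of_nonneg_right (mul_le_mul_of_nonneg_left c2 (by linarith)) hZ.le
  refine le_trans (le_of_eq ?_) (le_trans (add_le_add c1 c5) (by simp))
  have : w / u i t * u i t = w := div_mul_cancel₀ _ hu.ne'
  have e2 : p * w ^ 2 / u i t = p * w * (w / u i t) := by ring
  rw [e2]
  linear_combination (-1) * ew + p * this

theorem w_lower (H : DSol n N p h M T u) (i : ℕ) {t : ℝ} (ht : t ∈ Ioc 0 T) :
    -(u i t / (p * t)) ≤ Wd n p h u i t := by
  have := H.BC i ⟨ht.1.le, ht.2⟩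
  have hp := H.hp
  have hpt : 0 < p * t := mul_pos (by linarith) ht.1
  rw [← neg_div, div_le_iff₀ hpt]
  linarith

theorem L_lower (H : DSol n N p h M T u) {i : ℕ} (hi : i ≤ N) {t : ℝ} (ht : t ∈ Ioc 0 T) :
    -(u i t ^ (1 - p) / (p * t)) ≤ Lop n h (fun j => u j t) i := by
  have h1 := H.w_lower i ht
  have hu := H.pos i hi t ⟨ht.1.le, ht.2⟩
  have hup : 0 < u i t ^ p := rpow_pos_of_pos hu p
  have e : u i t ^ (1 - p) = u i t / u i t ^ p := by rw [rpow_sub hu, rpow_one]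
  unfold Wd at h1
  rw [e]
  have : -(u i t / u i t ^ p / (p * t)) = -(u i t / (p * t)) / u i t ^ p := by ring
  rw [this, div_le_iff₀ hup]
  linarith

theorem q_nonpos (H : DSol n N p h M T u) (i : ℕ) {t : ℝ} (ht : t ∈ Icc 0 T) :
    Dq h (fun j => u j t) i ≤ 0 := by
  unfold Dq
  exact div_nonpos_of_nonpos_of_nonneg (by linarith [H.anti i ht]) H.hh.le

theorem q_lower (H : DSol n N p h M T u) {i : ℕ} (hi : i ≤ N) {t : ℝ} (ht : t ∈ Ioc 0 T) :
    -(u i t ^ (1 - p) / (n * (p * t))) ≤ Dq h (fun j => u j t) i := by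
  have hp := H.hp
  have hn : (1:ℝ) ≤ n := by exact_mod_cast H.hn
  have hpt : 0 < p * t := mul_pos (by linarith) ht.1
  induction i with
  | zero =>
    have := H.L_lower hi ht
    rw [Lop_eq] at this
    simp only [Nat.cast_zero, mul_zero, zero_add, zero_mul, sub_zero] at this
    rw [mul_comm (n:ℝ), ← div_div, ← neg_div, div_le_iff₀ (by linarith)]
    linarith
  | succ k ih =>
    have h1 := ih (by omega)
    have h2 := H.L_lower hi ht
    rw [Lop_eq] at h2
    simp only [Nat.add_sub_cancel] at h2
    have hmono : u k t ^ (1 - p) ≤ u (k+1) t ^ (1-p) := by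
      apply rpow_le_rpow_of_nonpos (H.pos _ hi t ⟨ht.1.le, ht.2⟩) (H.anti k ⟨ht.1.le, ht.2⟩)
      linarith
    have h3 : u k t ^ (1 - p) / (n * (p * t)) ≤ u (k+1) t ^ (1-p) / (n * (p*t)) := by
      gcongr
    set c := u (k+1) t ^ (1-p) / (n * (p*t)) with hc
    have h4 : u (k+1) t ^ (1-p) / (p * t) = n * c := by rw [hc]; field_simp
    rw [h4] at h2
    set q0 := Dq h (fun j => u j t) k
    set q1 := Dq h (fun j => u j t) (k+1)
    have hk : (0:ℝ) < 2 * ((k+1:ℕ):ℝ) + n := by positivity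
    have h5 : 2 * ((k+1:ℕ):ℝ) * (-c) ≤ 2 * ((k+1:ℕ):ℝ) * q0 :=
      mul_le_mul_of_nonneg_left (by linarith) (by positivity)
    have h6 : (2 * ((k+1:ℕ):ℝ) + n) * (-c) ≤ (2 * ((k+1:ℕ):ℝ) + n) * q1 := by linarith
    exact le_of_mul_le_mul_left h6 hk

theorem time_mono (H : DSol n N p h M T u) (i : ℕ) {t₁ t₂ : ℝ} (h1 : 0 < t₁) (h12 : t₁ ≤ t₂)
    (h2 : t₂ ≤ T) : t₁ ^ (1/p) * u i t₁ ≤ t₂ ^ (1/p) * u i t₂ := by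
  have hp := H.hp
  have hm : MonotoneOn (fun t => t ^ (1/p) * u i t) (Icc t₁ t₂) := by
    refine monotoneOn_of_hasDerivWithinAt_nonneg (f' := fun t =>
      (1/p * t ^ (1/p - 1)) * u i t + t ^ (1/p) * Wd n p h u i t) (convex_Icc _ _) ?_ ?_ ?_
    · refine ContinuousOn.mul ?_ ((H.cont i).mono (Icc_subset_Icc h1.le h2))
      exact continuousOn_id.rpow_const (fun t ht => Or.inl (by
        have := ht.1; simp only [id]; linarith))
    · intro t ht
      rw [interior_Icc] at ht
      have ht0 : 0 < t := h1.trans ht.1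
      exact ((hasDerivAt_rpow_const (Or.inl ht0.ne')).mul
        (H.der i t ⟨ht0, ht.2.trans_le h2⟩)).hasDerivWithinAt
    · intro t ht
      rw [interior_Icc] at ht
      have ht0 : 0 < t := h1.trans ht.1
      have hb := H.BC i (t := t) ⟨ht0.le, ht.2.le.trans h2⟩
      have e : (1/p * t ^ (1/p - 1)) * u i t + t ^ (1/p) * Wd n p h u i t =
        t ^ (1/p) / (p * t) * (p * t * Wd n p h u i t + u i t) := by
        rw [rpow_sub_one ht0.ne']; field_simp; ring
      rw [e]
      positivity
  exact hm ⟨le_rfl, h12⟩ ⟨h12, le_rfl⟩ h12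

theorem le_two_mul (H : DSol n N p h M T u) (i : ℕ) {t₁ t₂ : ℝ} (h1 : 0 < t₁) (h12 : t₁ ≤ t₂)
    (h2 : t₂ ≤ T) (h3 : t₂ ≤ 2 * t₁) : u i t₁ ≤ 2 * u i t₂ := by
  have hp := H.hp
  have hu := H.nonneg i (t := t₂) ⟨(h1.trans_le h12).le, h2⟩
  have := H.time_mono i h1 h12 h2
  have h4 : t₂ ^ (1/p) ≤ 2 * t₁ ^ (1/p) := by
    calc t₂ ^ (1/p) ≤ (2 * t₁) ^ (1/p) :=
          rpow_le_rpow (h1.le.trans h12) h3 (by positivity)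
      _ = 2 ^ (1/p) * t₁ ^ (1/p) := mul_rpow (by norm_num) h1.le
      _ ≤ 2 * t₁ ^ (1/p) := by
        gcongr
        calc (2:ℝ) ^ (1/p) ≤ 2 ^ (1:ℝ) := by
              apply rpow_le_rpow_of_exponent_le (by norm_num)
              rw [div_le_one (by linarith)]; exact hp
          _ = 2 := rpow_one 2
  have h5 : 0 < t₁ ^ (1/p) := by positivity
  have h6 : t₂ ^ (1/p) * u i t₂ ≤ 2 * t₁ ^ (1/p) * u i t₂ := by gcongr
  have h7 : t₁ ^ (1/p) * u i t₁ ≤ t₁ ^ (1/p) * (2 * u i t₂) := by linarith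
  exact le_of_mul_le_mul_left h7 h5

theorem Lop_lin (n : ℕ) {h : ℝ} (hh : 0 < h) (a b : ℝ) (i : ℕ) :
    Lop n h (fun j => a + b * (j * h)) i = b * n := by
  cases i with
  | zero => simp [Lop]; field_simp
  | succ i => simp [Lop]; field_simp; ring

/-- Local lower bound. -/
theorem lower (H : DSol n N p h M T u) {δ S : ℝ} (hδ : 0 < δ) (hS : 0 < S) (hSN : 2 * S ≤ N * h)
    (hu0 : ∀ j : ℕ, j * h ≤ 2 * S → δ ≤ u j 0) (i : ℕ) (hi : i * h ≤ S) {t : ℝ}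
    (ht : t ∈ Icc 0 T) : δ / 2 * exp (-(M ^ p * n / (2 * S)) * T) ≤ u i t := by
  have hh := H.hh
  have hp := H.hp
  have hM := H.hM
  set lam : ℝ := M ^ p * n / (2 * S) with hlam
  have hlam0 : 0 ≤ lam := by positivity
  have hδM : δ ≤ M := (hu0 0 (by simp; linarith)).trans (H.le 0 0 ⟨le_rfl, H.hT.le⟩)
  let s : Finset ℕ := (Finset.range (N + 1)).filter (fun j => (j:ℝ) * h ≤ 2 * S)
  have hmem : ∀ j : ℕ, j ∈ s ↔ (j:ℝ) * h ≤ 2 * S := by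
    intro j
    simp only [s, Finset.mem_filter, Finset.mem_range]
    refine ⟨fun h => h.2, fun hj => ⟨?_, hj⟩⟩
    have : (j:ℝ) * h ≤ N * h := hj.trans hSN
    have : (j:ℝ) ≤ N := le_of_mul_le_mul_right this hh
    have : j ≤ N := by exact_mod_cast this
    omega
  have key := finMP s (fun i t => δ * exp (-lam * t) * (1 - i * h / (2 * S)) - u i t)
    (fun i t => δ * (-lam * exp (-lam * t)) * (1 - i * h / (2 * S)) -
      u i t ^ p * Lop n h (fun j => u j t) i) 0 T 0
    (fun i _ => ContinuousOn.sub (by fun_prop) (H.cont i)) ?_ ?_ ?_ i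
    ((hmem i).2 (by linarith)) t ht
  · have e1 : exp (-lam * T) ≤ exp (-lam * t) := by
      apply exp_le_exp.2
      have := ht.2
      nlinarith
    have e2 : (1:ℝ)/2 ≤ 1 - i * h / (2 * S) := by
      have : i * h / (2 * S) ≤ 1 / 2 := by
        rw [div_le_iff₀ (by positivity)]; linarith
      linarith
    have e3 : δ * exp (-lam * T) * (1/2) ≤ δ * exp (-lam * t) * (1 - i * h / (2 * S)) := by
      gcongr
    linarith
  · intro i _ t ht
    refine HasDerivAt.sub ?_ (H.der i t ht)
    have h1 : HasDerivAt (fun t : ℝ => -lam * t) (-lam) t := by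
      simpa using (hasDerivAt_id t).const_mul (-lam)
    exact ((h1.exp.const_mul δ).mul_const _).congr_deriv (by ring)
  · intro i hi
    have h1 := hu0 i ((hmem i).1 hi)
    have : 0 ≤ i * h / (2 * S) := by positivity
    simp only [mul_zero, exp_zero, mul_one]
    nlinarith
  · intro i hi t ht hZ hmax
    have ht' := Ioo_subset_Icc_self ht
    have hE : 0 < exp (-lam * t) := exp_pos _
    have hE1 : exp (-lam * t) ≤ 1 := by
      rw [exp_le_one_iff]; have := ht.1; nlinarith
    set E := exp (-lam * t)
    have hall : ∀ j : ℕ, δ * E * (1 - j * h / (2 * S)) - u j t ≤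
        δ * E * (1 - i * h / (2 * S)) - u i t := by
      intro j
      by_cases hj : j ∈ s
      · exact hmax j hj
      · have hj' : 2 * S < j * h := by
          by_contra hc; exact hj ((hmem j).2 (by linarith))
        have h1 : 1 < j * h / (2 * S) := by rw [lt_div_iff₀ (by positivity)]; linarith
        have h2 := H.nonneg j ht'
        have : δ * E * (1 - j * h / (2 * S)) ≤ 0 :=
          mul_nonpos_of_nonneg_of_nonpos (by positivity) (by linarith)
        have hZ' : 0 < δ * E * (1 - i * h / (2 * S)) - u i t := hZ
        linarith
    have hL := Lop_nonpos_of_max n h (by positivity) hh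
      (fun j => δ * E * (1 - j * h / (2 * S)) - u j t) i (hall _) (hall _)
    rw [Lop_sub] at hL
    have e : Lop n h (fun j => δ * E * (1 - j * h / (2 * S))) i = -(δ * E) / (2 * S) * n := by
      rw [← Lop_lin n hh (δ * E) (-(δ * E) / (2 * S)) i]
      congr 1; ext j; ring
    rw [e] at hL
    have hu := H.nonneg i ht'
    set Lu := Lop n h (fun j => u j t) i
    have hZ' : u i t < δ * E * (1 - i * h / (2 * S)) := by
      have : 0 < δ * E * (1 - i * h / (2 * S)) - u i t := hZ
      linarith
    set z := δ * E * (1 - i * h / (2 * S)) with hz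
    have c1 : u i t ^ p * (-(δ * E) / (2 * S) * n) ≤ u i t ^ p * Lu :=
      mul_le_mul_of_nonneg_left (by linarith) (rpow_nonneg hu _)
    have c2 : u i t ^ p ≤ M ^ (p-1) * z :=
      (rpow_le_mul hp hu (H.le i t ht')).trans
        (mul_le_mul_of_nonneg_left hZ'.le (by positivity))
    have c3 : u i t ^ p * (δ * E / (2 * S) * n) ≤ M ^ (p-1) * z * (M / (2 * S) * n) := by
      have : δ * E ≤ M := by nlinarith
      have hz0 : 0 ≤ z := by linarith
      gcongr
    have c4 : M ^ (p-1) * z * (M / (2 * S) * n) = lam * z := by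
      rw [hlam, rpow_sub_one hM.ne']; field_simp
    have c5 : δ * (-lam * E) * (1 - i * h / (2 * S)) = - lam * z := by rw [hz]; ring
    rw [c5]
    have c6 : u i t ^ p * (-(δ * E) / (2 * S) * n) = -(u i t ^ p * (δ * E / (2 * S) * n)) := by ring
    simp only [zero_mul]
    linarith

end DSol


theorem barrier_FD {ρ h : ℝ} (hh : 0 < h) (hρ : 2 * h ≤ ρ) :
    1 / (ρ - h) ^ 2 - 1 / ρ ^ 2 ≤ 8 * h / ρ ^ 3 := by
  have h1 : 0 < ρ := by linarith
  have h2 : 0 < ρ - h := by linarith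
  rw [div_sub_div _ _ (by positivity) (by positivity), div_le_div_iff₀ (by positivity)
    (by positivity)]
  have key : ρ * (2 * ρ - h) ≤ 8 * (ρ - h) ^ 2 := by nlinarith
  have e1 : (1 * ρ ^ 2 - (ρ - h) ^ 2 * 1) * ρ ^ 3 = h * ρ ^ 2 * (ρ * (2 * ρ - h)) := by ring
  have e2 : 8 * h * ((ρ - h) ^ 2 * ρ ^ 2) = h * ρ ^ 2 * (8 * (ρ - h) ^ 2) := by ring
  rw [e1, e2]
  gcongr

theorem barrier_SD {ρ h : ℝ} (hh : 0 < h) (hρ : 2 * h ≤ ρ) :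
    1 / (ρ - h) ^ 2 + 1 / (ρ + h) ^ 2 - 2 / ρ ^ 2 ≤ 11 * h ^ 2 / ρ ^ 4 := by
  have h1 : 0 < ρ := by linarith
  have h2 : 0 < ρ - h := by linarith
  have h3 : 0 < ρ + h := by linarith
  rw [div_add_div _ _ (by positivity) (by positivity), div_sub_div _ _ (by positivity)
    (by positivity), div_le_div_iff₀ (by positivity) (by positivity)]
  have key : (6 * ρ ^ 2 - 2 * h ^ 2) * ρ ^ 2 ≤ 11 * (ρ ^ 2 - h ^ 2) ^ 2 := by
    have : 4 * h ^ 2 ≤ ρ ^ 2 := by nlinarith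
    nlinarith [sq_nonneg (h ^ 2), mul_nonneg (sq_nonneg ρ) (sub_nonneg.2 this)]
  have e1 : ((1 * (ρ + h) ^ 2 + (ρ - h) ^ 2 * 1) * ρ ^ 2 - (ρ - h) ^ 2 * (ρ + h) ^ 2 * 2) * ρ ^ 4
      = h ^ 2 * ρ ^ 2 * ((6 * ρ ^ 2 - 2 * h ^ 2) * ρ ^ 2) := by ring
  have e2 : 11 * h ^ 2 * ((ρ - h) ^ 2 * (ρ + h) ^ 2 * ρ ^ 2)
      = h ^ 2 * ρ ^ 2 * (11 * (ρ ^ 2 - h ^ 2) ^ 2) := by ring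
  rw [e1, e2]
  gcongr

theorem young_aux (c x d : ℝ) (hd : 0 < d) : c * x ≤ d * x ^ 2 / 2 + c ^ 2 / (2 * d) := by
  have : 0 ≤ (d * x - c) ^ 2 / (2 * d) := by positivity
  have e : (d * x - c) ^ 2 / (2 * d) = d * x ^ 2 / 2 + c ^ 2 / (2 * d) - c * x := by
    field_simp; ring
  linarith

theorem bern_X1 {x m h q b α Q B lam S : ℝ} (hx : 1 ≤ x) (hm : 1 ≤ m) (hh : 0 < h)
    (hh1 : h ≤ 1) (hlam : 0 < lam) (hα : lam ≤ α) (hq2 : q ^ 2 ≤ Q ^ 2) (hb2 : b ^ 2 ≤ B ^ 2)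
    (hxS : x * h ≤ S) :
    (-(2 * q * b * (2 * x + m + 2))) ^ 2 / (2 * (α * (2 * x + m) / h)) ≤
      18 * Q ^ 2 * B ^ 2 * (2 * S + m) / lam := by
  have hα0 : 0 < α := by linarith
  have e : (-(2 * q * b * (2 * x + m + 2))) ^ 2 / (2 * (α * (2 * x + m) / h)) =
    2 * (q ^ 2 * b ^ 2) * ((2 * x + m + 2) ^ 2 / (2 * x + m) * h) / α := by field_simp
  rw [e]
  have e1 : (2 * x + m + 2) ^ 2 / (2 * x + m) ≤ 9 * (2 * x + m) := by
    rw [div_le_iff₀ (by positivity)]; nlinarith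
  have e2 : (2 * x + m + 2) ^ 2 / (2 * x + m) * h ≤ 9 * (2 * S + m) := by
    calc _ ≤ 9 * (2 * x + m) * h := mul_le_mul_of_nonneg_right e1 hh.le
      _ ≤ _ := by nlinarith
  have e3 : q ^ 2 * b ^ 2 ≤ Q ^ 2 * B ^ 2 :=
    mul_le_mul hq2 hb2 (sq_nonneg _) (sq_nonneg _)
  have e4 : 2 * (q ^ 2 * b ^ 2) * ((2 * x + m + 2) ^ 2 / (2 * x + m) * h) ≤
      2 * (Q ^ 2 * B ^ 2) * (9 * (2 * S + m)) :=
    mul_le_mul (by linarith) e2 (by positivity) (by positivity)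
  have hS : 0 ≤ S := le_trans (by positivity) hxS
  calc 2 * (q ^ 2 * b ^ 2) * ((2 * x + m + 2) ^ 2 / (2 * x + m) * h) / α
      ≤ 2 * (Q ^ 2 * B ^ 2) * (9 * (2 * S + m)) / lam :=
        div_le_div₀ (by positivity) e4 hlam hα
    _ = _ := by ring

theorem bern_X2 {x m h q α Q : ℝ} (hx : 1 ≤ x) (hm : 1 ≤ m) (hh : 0 < h)
    (hα0 : 0 < α) (hq2 : q ^ 2 ≤ Q ^ 2) :
    (4 * q * α / h) ^ 2 / (2 * (α * (2 * x + m) / h)) ≤ 4 * Q ^ 2 * α / (x * h) := by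
  have e : (4 * q * α / h) ^ 2 / (2 * (α * (2 * x + m) / h)) =
    8 * q ^ 2 * α / ((2 * x + m) * h) := by field_simp; ring
  rw [e]
  calc 8 * q ^ 2 * α / ((2 * x + m) * h) ≤ 8 * Q ^ 2 * α / ((2 * x) * h) := by
        gcongr; linarith
    _ = _ := by field_simp; ring

theorem bern_X4 {x h α f Q S : ℝ} (hxh : 0 < x * h) (hα0 : 0 < α) (hQ : 0 ≤ Q)
    (hxS : x * h ≤ S) (hf : 4 * Q ≤ f) :
    α * f ^ 2 / (4 * S) ≤ α * f ^ 2 / (2 * x * h) - 4 * Q ^ 2 * α / (x * h) := by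
  have e : α * f ^ 2 / (2 * x * h) - 4 * Q ^ 2 * α / (x * h) =
      α * (f ^ 2 / 2 - 4 * Q ^ 2) / (x * h) := by
    rw [show 2 * x * h = 2 * (x * h) by ring]
    field_simp
  rw [e]
  have hS : 0 < S := by linarith
  have : f ^ 2 / 4 ≤ f ^ 2 / 2 - 4 * Q ^ 2 := by nlinarith
  calc α * f ^ 2 / (4 * S) = α * (f ^ 2 / 4) / S := by field_simp
    _ ≤ α * (f ^ 2 / 4) / (x * h) := by gcongr
    _ ≤ _ := by gcongr

theorem bern_id {x m h q0 q q1 α b f : ℝ} (hx : 0 < x) (hh : 0 < h)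
    (hf : f = (2 * x + m) * q - 2 * x * q0) :
    2 * q * (((α - h * b) * ((2 * x + 2 + m) * q1 - 2 * (x + 1) * q) - α * f) / h)
      - α * (((2 * x + m) * (q1 ^ 2 - q ^ 2) - 2 * x * (q ^ 2 - q0 ^ 2)) / h) =
      -(2 * m * q ^ 2 * b) + (-(2 * q * b * (2 * x + m + 2))) * (q1 - q) + (4 * q * α / h) * (q1 - q)
      - (α * (2 * x + m) / h) * (q1 - q) ^ 2 - α * (f - m * q) ^ 2 / (2 * x * h) := by
  have e : f - m * q = 2 * x * (q - q0) := by rw [hf]; ring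
  have e2 : α * (f - m * q) ^ 2 / (2 * x * h) = 2 * x * α * (q - q0) ^ 2 / h := by
    rw [e]; field_simp
  rw [e2, hf]
  field_simp
  ring

/-- The algebraic core of the Bernstein estimate. -/
theorem bern_core {x m h q0 q q1 α a Q B lam S : ℝ} (hx : 1 ≤ x) (hm : 1 ≤ m) (hh : 0 < h)
    (hh1 : h ≤ 1) (hlam : 0 < lam) (hα : lam ≤ α) (hq : q ≤ 0) (hqQ : -Q ≤ q)
    (hb0 : a ≤ α) (hbB : α - a ≤ h * B) (hxS : x * h ≤ S)
    (hf : 4 * Q ≤ (2 * x + m) * q - 2 * x * q0) :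
    2 * q * ((a * ((2 * x + 2 + m) * q1 - 2 * (x + 1) * q)
      - α * ((2 * x + m) * q - 2 * x * q0)) / h)
      - α * (((2 * x + m) * (q1 ^ 2 - q ^ 2) - 2 * x * (q ^ 2 - q0 ^ 2)) / h) ≤
    18 * Q ^ 2 * B ^ 2 * (2 * S + m) / lam -
      α * ((2 * x + m) * q - 2 * x * q0) ^ 2 / (4 * S) := by
  have hα0 : 0 < α := by linarith
  have hQ : 0 ≤ Q := by linarith
  obtain ⟨b, hb⟩ : ∃ b, a = α - h * b := ⟨(α - a) / h, by field_simp; ring⟩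
  subst hb
  have hb0' : 0 ≤ b := by
    have : 0 ≤ h * b := by linarith
    exact nonneg_of_mul_nonneg_right this hh
  have hbB' : b ≤ B := by
    have : h * b ≤ h * B := by linarith
    exact le_of_mul_le_mul_left this hh
  set f := (2 * x + m) * q - 2 * x * q0 with hfdef
  have hxh : 0 < x * h := by positivity
  have hS : 0 < S := by linarith
  have id1 := bern_id (x := x) (m := m) (h := h) (q0 := q0) (q := q) (q1 := q1) (α := α) (b := b) (f := f) (by linarith) hh hfdef
  rw [id1]
  have hd : 0 < α * (2 * x + m) / h := by positivity
  have y1 := young_aux (-(2 * q * b * (2 * x + m + 2))) (q1 - q) _ hd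
  have y2 := young_aux (4 * q * α / h) (q1 - q) _ hd
  have hq2 : q ^ 2 ≤ Q ^ 2 := sq_le_sq' (by linarith) (by linarith)
  have hb2 : b ^ 2 ≤ B ^ 2 := pow_le_pow_left₀ hb0' hbB' 2
  have X1 := bern_X1 hx hm hh hh1 hlam hα hq2 hb2 hxS
  have X2 := bern_X2 hx hm hh hα0 hq2
  have X3 : α * f ^ 2 / (2 * x * h) ≤ α * (f - m * q) ^ 2 / (2 * x * h) := by
    have hmq : m * q ≤ 0 := mul_nonpos_of_nonneg_of_nonpos (by linarith) hq
    have hf0 : 0 ≤ f := by linarith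
    have : f ^ 2 ≤ (f - m * q) ^ 2 := pow_le_pow_left₀ hf0 (by linarith) 2
    gcongr
  have X4 := bern_X4 hxh hα0 hQ hxS hf
  have X5 : 0 ≤ 2 * m * q ^ 2 * b := by positivity
  linarith

namespace DSol
variable {n N : ℕ} {p h M T : ℝ} {u : ℕ → ℝ → ℝ}

theorem idx_le (H : DSol n N p h M T u) {S : ℝ} (hSN : S ≤ N * h) {i : ℕ} (hi : i * h ≤ S) :
    i ≤ N := by
  have : (i:ℝ) ≤ N := le_of_mul_le_mul_right (hi.trans hSN) H.hh
  exact_mod_cast this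

/-- Gradient bound on a region with a lower bound. -/
theorem q_bd (H : DSol n N p h M T u) {lam ta : ℝ} (hlam : 0 < lam) (hta : 0 < ta)
    {i : ℕ} (hi : i ≤ N) {t : ℝ} (ht : ta ≤ t) (htT : t ≤ T) (hl : lam ≤ u i t) :
    -(lam ^ (1 - p) / ta) ≤ Dq h (fun j => u j t) i := by
  have hp := H.hp
  have hn : (1:ℝ) ≤ n := by exact_mod_cast H.hn
  refine le_trans (neg_le_neg ?_) (H.q_lower hi ⟨hta.trans_le ht, htT⟩)
  have h1 : u i t ^ (1-p) ≤ lam ^ (1-p) := rpow_le_rpow_of_nonpos hlam hl (by linarith)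
  have h2 : ta ≤ n * (p * t) := by
    have : ta ≤ p * t := by nlinarith
    nlinarith
  have := rpow_nonneg hlam.le (1-p)
  gcongr

theorem b_bd (H : DSol n N p h M T u) {i : ℕ} {t Q : ℝ} (ht : t ∈ Icc 0 T)
    (hq : -Q ≤ Dq h (fun j => u j t) i) :
    u i t ^ p - u (i+1) t ^ p ≤ h * (p * M ^ (p-1) * Q) := by
  have hp := H.hp
  have hh := H.hh
  have hM := H.hM
  have h1 := rpow_sub_le hp (H.nonneg (i+1) ht) (H.anti i ht) (H.le i t ht)
  have h2 : u i t - u (i+1) t ≤ h * Q := by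
    unfold Dq at hq
    rw [le_div_iff₀ hh] at hq
    linarith
  have h3 : p * M ^ (p-1) * (u i t - u (i+1) t) ≤ p * M ^ (p-1) * (h * Q) := by gcongr
  linarith

end DSol



theorem le_sqrt_aux {h : ℝ} (hh : 0 ≤ h) (h1 : h ≤ 1) : h ≤ √h := by
  have := Real.mul_self_sqrt hh
  have : √h ≤ 1 := Real.sqrt_le_one.2 h1
  nlinarith [Real.sqrt_nonneg h]

theorem quarter_aux {h : ℝ} (hh : 0 < h) (h2 : 1 < √h + h) : 1 / 4 < h := by
  have := Real.mul_self_sqrt hh.le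
  have := Real.sqrt_nonneg h
  nlinarith

theorem sq_aux {h a : ℝ} (hh : 0 ≤ h) (ha : 0 ≤ a) (h2 : a ≤ 2 * √h) : a ^ 2 ≤ 4 * h := by
  have := Real.mul_self_sqrt hh
  nlinarith

theorem sumsq_aux {x y w : ℝ} (hx : 0 ≤ x) (hy : 0 ≤ y) (h : (x + y) / 2 ≤ w) :
    x ^ 2 / 4 + y ^ 2 / 4 ≤ w ^ 2 := by
  have : ((x + y) / 2) ^ 2 ≤ w ^ 2 := pow_le_pow_left₀ (by positivity) h 2
  nlinarith [mul_nonneg hx hy]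

set_option maxHeartbeats 2000000 in
theorem bernsteinW (n : ℕ) (p M T ta t0 S lam : ℝ) (hta : 0 < ta) (hta0 : ta < t0)
    (hS : 0 < S) (hlam : 0 < lam) :
    ∃ C : ℝ, ∃ h0 > 0, ∀ (N : ℕ) (h : ℝ) (u : ℕ → ℝ → ℝ), h < h0 → DSol n N p h M T u →
      S + 1 ≤ N * h → (∀ i : ℕ, i * h ≤ S + 1 → ∀ t ∈ Icc ta T, lam ≤ u i t) →
      ∀ i : ℕ, i * h ≤ S → ∀ t ∈ Icc t0 T, Wd n p h u i t ≤ C := by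
  obtain ⟨Q, hQ⟩ : ∃ y : ℝ, y = lam ^ (1-p) / ta := ⟨_, rfl⟩
  obtain ⟨B, hB⟩ : ∃ y : ℝ, y = p * M ^ (p-1) * Q := ⟨_, rfl⟩
  obtain ⟨X1, hX1⟩ : ∃ y : ℝ, y = 18 * Q ^ 2 * B ^ 2 * (2 * (S+1) + n) / lam ^ p := ⟨_, rfl⟩
  obtain ⟨A, hA⟩ : ∃ y : ℝ, y = (p / lam + 1) * (4 * (S+1) * M ^ p) := ⟨_, rfl⟩
  obtain ⟨C2, hC2⟩ : ∃ y : ℝ, y = M ^ p * (2 * (S+1) * Q) := ⟨_, rfl⟩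
  obtain ⟨Cψ, hCψ⟩ : ∃ y : ℝ, y = (22 + 8 * n) * (S+1) := ⟨_, rfl⟩
  obtain ⟨K, hK⟩ : ∃ y : ℝ, y = 4 * (C2 + A * Q ^ 2) + 2 * (A * Q ^ 2) * (S+1) ^ 2 + 8 * (M ^ p * Cψ)
    + 8 * (S+1) ^ 4 * (A * X1) + 8 * (S+1) ^ 2 * (Q * M ^ p) + 4 := ⟨_, rfl⟩
  refine ⟨K + K / (t0 - ta), min 1 (t0 - ta), by
    apply lt_min one_pos; linarith, ?_⟩
  intro N h u hh0 H hSN hlow i hi t ht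
  have hh := H.hh
  have hp := H.hp
  have hM := H.hM
  have hn : (1:ℝ) ≤ n := by exact_mod_cast H.hn
  have hh1 : h ≤ 1 := hh0.le.trans (min_le_left _ _)
  have hh2 : h < t0 - ta := hh0.trans_le (min_le_right _ _)
  have hQ0 : 0 ≤ Q := by rw [hQ]; positivity
  have hB0 : 0 ≤ B := by rw [hB]; positivity
  have hX10 : 0 ≤ X1 := by rw [hX1]; positivity
  have hA0 : 0 ≤ A := by rw [hA]; positivity
  have hC20 : 0 ≤ C2 := by rw [hC2]; positivity
  have hCψ0 : 0 ≤ Cψ := by rw [hCψ]; positivity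
  have hMp : 0 < M ^ p := by positivity
  have hAQ : 0 ≤ A * Q ^ 2 := by positivity
  have k1 : 0 ≤ 2 * (A * Q ^ 2) * (S+1) ^ 2 := by positivity
  have k2 : 0 ≤ 8 * (M ^ p * Cψ) := by positivity
  have k3 : 0 ≤ 8 * (S+1) ^ 4 * (A * X1) := by positivity
  have k4 : 0 ≤ 8 * (S+1) ^ 2 * (Q * M ^ p) := by positivity
  have hK4 : 4 ≤ K := by linarith
  have hKpos : 0 < K := by linarith
  let q : ℕ → ℝ → ℝ := fun i t => Dq h (fun j => u j t) i
  let σ : ℝ := √h + h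
  have hsqrt : 0 < √h := Real.sqrt_pos.2 hh
  have hhsq : h ≤ √h := le_sqrt_aux hh.le hh1
  let I : Finset ℕ := (Finset.range (N + 1)).filter (fun j => (j:ℝ) * h + σ ≤ S + 1)
  have hmem : ∀ j : ℕ, j ∈ I ↔ (j:ℝ) * h + σ ≤ S + 1 := by
    intro j
    simp only [I, Finset.mem_filter, Finset.mem_range]
    refine ⟨fun h => h.2, fun hj => ⟨?_, hj⟩⟩
    have : (j:ℝ) * h ≤ S + 1 := by have : 0 < σ := by positivity
                                   linarith
    have := H.idx_le hSN this
    omega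
  -- basic bounds
  have hqn : ∀ i : ℕ, ∀ t ∈ Icc ta T, q i t ≤ 0 := fun i t ht =>
    H.q_nonpos i ⟨hta.le.trans ht.1, ht.2⟩
  have hqQ : ∀ i : ℕ, i * h ≤ S + 1 → ∀ t ∈ Icc ta T, -Q ≤ q i t := fun i hi t ht =>
    hQ ▸ H.q_bd hlam hta (H.idx_le hSN hi) ht.1 ht.2 (hlow i hi t ht)
  have hq2 : ∀ i : ℕ, i * h ≤ S + 1 → ∀ t ∈ Icc ta T, q i t ^ 2 ≤ Q ^ 2 := by
    intro i hi t ht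
    have h1 := hqn i t ht
    have h2 := hqQ i hi t ht
    exact sq_le_sq' h2 (h1.trans hQ0)
  have hWeq : ∀ (i : ℕ) (t : ℝ), Wd n p h u i t =
      u i t ^ p * ((2 * i + n) * q i t - 2 * i * q (i-1) t) := by
    intro i t; rw [Wd, Lop_eq]
  have hwC2 : ∀ i : ℕ, i * h ≤ S + 1 → ∀ t ∈ Icc ta T, Wd n p h u i t ≤ C2 / h := by
    intro i hi t ht
    have ht' : t ∈ Icc 0 T := ⟨hta.le.trans ht.1, ht.2⟩
    have a1 := hqn i t ht
    have a2 : -Q ≤ q (i-1) t := by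
      apply hqQ _ _ t ht
      refine le_trans ?_ hi
      gcongr
      omega
    have a3 : (2 * i + n) * q i t - 2 * i * q (i-1) t ≤ 2 * (S+1) * Q / h := by
      rw [le_div_iff₀ hh]
      have b1 : (2 * (i:ℝ) + n) * q i t ≤ 0 :=
        mul_nonpos_of_nonneg_of_nonpos (by positivity) a1
      have b2 : 2 * (i:ℝ) * (-q (i-1) t) ≤ 2 * i * Q :=
        mul_le_mul_of_nonneg_left (by linarith) (by positivity)
      have b3 : 2 * (i:ℝ) * Q * h ≤ 2 * (S+1) * Q := by
        have := mul_le_mul_of_nonneg_left hi (by positivity : 0 ≤ 2 * Q)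
        linarith
      have b4 := mul_le_mul_of_nonneg_right b2 hh.le
      have b5 := mul_nonpos_of_nonpos_of_nonneg b1 hh.le
      linarith
    rw [hWeq]
    calc u i t ^ p * ((2 * i + n) * q i t - 2 * i * q (i-1) t)
        ≤ u i t ^ p * (2 * (S+1) * Q / h) :=
          mul_le_mul_of_nonneg_left a3 (rpow_nonneg (H.nonneg _ ht') _)
      _ ≤ M ^ p * (2 * (S+1) * Q / h) := by
          have := rpow_le_rpow (H.nonneg i ht') (H.le i t ht') (by linarith : 0 ≤ p)
          gcongr
      _ = C2 / h := by rw [hC2]; ring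
  -- barrier bound at coarse places
  have hcoarse : ∀ i : ℕ, i * h ≤ S + 1 → ∀ t ∈ Icc ta T,
      Wd n p h u i t + A * q i t ^ 2 ≤ K / (4 * h) := by
    intro i hi t ht
    have a1 := hwC2 i hi t ht
    have a2 : A * q i t ^ 2 ≤ A * Q ^ 2 := mul_le_mul_of_nonneg_left (hq2 i hi t ht) hA0
    have a3 : A * Q ^ 2 ≤ A * Q ^ 2 / h := by
      rw [le_div_iff₀ hh]; exact mul_le_of_le_one_right hAQ hh1
    calc _ ≤ C2 / h + A * Q ^ 2 / h := by linarith
      _ = (4 * (C2 + A * Q ^ 2)) / (4 * h) := by field_simp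
      _ ≤ K / (4 * h) := by gcongr; linarith
  have main := finMP I (fun i t => Wd n p h u i t + A * q i t ^ 2 - K * (1 / (S + 1 - i * h) ^ 2)
      - K / (t - ta))
    (fun i t => (u i t ^ p * Lop n h (fun j => Wd n p h u j t) i +
      p * Wd n p h u i t ^ 2 / u i t) + A * (2 * q i t * ((Wd n p h u (i+1) t - Wd n p h u i t) / h))
      + K / (t - ta) ^ 2) (ta + h) T 0 ?_ ?_ ?_ ?_
  · have hiI : i ∈ I ∨ i ∉ I := em _
    have htt : t ∈ Icc ta T := ⟨hta0.le.trans ht.1, ht.2⟩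
    have hkt : K / (t - ta) ≤ K / (t0 - ta) := by
      have := ht.1
      have : 0 < t0 - ta := by linarith
      gcongr
    by_cases hiI : i ∈ I
    · have := main i hiI t ⟨by linarith [ht.1], ht.2⟩
      have hρ : 1 ≤ S + 1 - i * h := by linarith
      have : 1 / (S + 1 - i * h) ^ 2 ≤ 1 := by
        rw [div_le_one (by positivity)]; exact one_le_pow₀ hρ
      have : K * (1 / (S + 1 - i * h) ^ 2) ≤ K := mul_le_of_le_one_right hKpos.le this
      have : 0 ≤ A * q i t ^ 2 := by positivity
      linarith
    · -- then σ > 1, so h > 1/4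
      have h1 : S + 1 < i * h + σ := by
        by_contra hc; exact hiI ((hmem i).2 (by linarith))
      have h2 : 1 < √h + h := by
        have : σ = √h + h := rfl
        linarith
      have h3 : 1 / 4 < h := quarter_aux hh h2
      have h4 := hcoarse i (by linarith) t htt
      have : 0 ≤ A * q i t ^ 2 := by positivity
      have : K / (4 * h) ≤ K := by
        rw [div_le_iff₀ (by positivity)]; exact le_mul_of_one_le_right hKpos.le (by linarith)
      have : 0 < K / (t0 - ta) := div_pos hKpos (by linarith)
      linarith
  · intro i hi
    have hsub : Icc (ta + h) T ⊆ Icc 0 T := Icc_subset_Icc (by linarith) le_rfl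
    have c1 := (H.contw i).mono hsub
    have c2 : ContinuousOn (fun t => q i t) (Icc (ta + h) T) := by
      simp only [q, Dq]
      have c2 := (H.cont i).mono hsub
      have c3 := (H.cont (i+1)).mono hsub
      fun_prop
    refine ContinuousOn.sub (by fun_prop) ?_
    refine ContinuousOn.div continuousOn_const (by fun_prop) ?_
    intro t ht
    have := ht.1
    linarith
  · intro i hi t ht
    have ht0 : t ∈ Ioo 0 T := ⟨by linarith [ht.1], ht.2⟩
    have hq : HasDerivAt (fun t => q i t) ((Wd n p h u (i+1) t - Wd n p h u i t) / h) t :=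
      ((H.der (i+1) t ht0).sub (H.der i t ht0)).div_const h
    have d1 := (H.derw i ht0).add ((hq.pow 2).const_mul A)
    have hta' : t - ta ≠ 0 := by linarith [ht.1]
    have d2 : HasDerivAt (fun t => K / (t - ta)) (-(K / (t - ta) ^ 2)) t := by
      have := ((hasDerivAt_id t).sub_const ta).fun_inv hta'
      have := this.const_mul K
      refine (this.congr_deriv ?_)
      simp; ring
    have := (d1.sub_const (K * (1 / (S + 1 - i * h) ^ 2))).sub d2
    refine this.congr_deriv ?_
    simp only [Nat.cast_ofNat]; ring
  · intro i hi
    have hiS : i * h ≤ S + 1 := by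
      have := (hmem i).1 hi
      have : 0 < σ := by positivity
      linarith
    by_cases hTT : ta + h ≤ T
    · have := hcoarse i hiS (ta + h) ⟨by linarith, hTT⟩
      have e : ta + h - ta = h := by ring
      simp only [e]
      have h1 : K / (4 * h) ≤ K / h := by gcongr; linarith
      have : 0 ≤ K * (1 / (S + 1 - i * h) ^ 2) := by positivity
      linarith
    · exfalso
      have := ht.1; have := ht.2; linarith
  · intro i hi t ht hZ hmax
    have htt : t ∈ Icc ta T := ⟨by linarith [ht.1], ht.2.le⟩
    have ht0 : t ∈ Icc 0 T := ⟨by linarith [ht.1], ht.2.le⟩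
    have hiσ := (hmem i).1 hi
    have hσ : σ = √h + h := rfl
    have hρh : 2 * h ≤ S + 1 - i * h := by linarith
    have hiS : i * h ≤ S + 1 := by linarith
    have hiN := H.idx_le hSN hiS
    have hui := H.pos i hiN t ht0
    have hlu := hlow i hiS t htt
    set ρ := S + 1 - i * h with hρ
    clear_value ρ
    have hρ0 : 0 < ρ := by linarith
    have hρS : ρ ≤ S + 1 := by
      have : 0 ≤ i * h := by positivity
      linarith
    have hta' : 0 < t - ta := by linarith [ht.1]
    set y := K / (t - ta) with hy
    clear_value y
    have hy0 : 0 < y := by rw [hy]; positivity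
    set w := Wd n p h u i t with hw
    clear_value w
    set x := K * (1 / ρ ^ 2) with hx
    clear_value x
    have hZ' : 0 < w + A * q i t ^ 2 - x - y := hZ
    have hxS : 2 * (A * Q ^ 2) + 8 * (Q * M ^ p) ≤ x := by
      have : K / (S+1) ^ 2 ≤ x := by
        rw [hx, mul_one_div]; gcongr
      refine le_trans ?_ this
      rw [le_div_iff₀ (by positivity)]
      linarith
    have hAq : A * q i t ^ 2 ≤ A * Q ^ 2 := mul_le_mul_of_nonneg_left (hq2 i hiS t htt) hA0
    have hwx : (x + y) / 2 ≤ w := by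
      have : 0 ≤ Q * M ^ p := by positivity
      linarith
    have hwQ : 4 * (Q * M ^ p) ≤ w := by linarith
    have hx0 : 0 < x := by rw [hx]; positivity
    -- i ≥ 1
    have hi1 : 1 ≤ i := by
      by_contra hc
      have hi0 : i = 0 := by omega
      have : w = u i t ^ p * (n * q i t) := by rw [hw, hWeq, hi0]; simp
      have h2 := hqn i t htt
      have : w ≤ 0 := by
        rw [this]
        exact mul_nonpos_of_nonneg_of_nonpos (rpow_nonneg hui.le _)
          (mul_nonpos_of_nonneg_of_nonpos (by linarith) h2)
      linarith
    have hi1' : (1:ℝ) ≤ i := by exact_mod_cast hi1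
    -- neighbours
    have hnb1 : Wd n p h u (i-1) t + A * q (i-1) t ^ 2 - K * (1 / (ρ + h) ^ 2) ≤
        w + A * q i t ^ 2 - x := by
      have hm : i - 1 ∈ I := by
        rw [hmem]
        have : ((i-1:ℕ):ℝ) = i - 1 := by push_cast [hi1]; ring
        rw [this]
        linarith
      have := hmax (i-1) hm
      have e : S + 1 - ((i-1:ℕ):ℝ) * h = ρ + h := by
        have : ((i-1:ℕ):ℝ) = i - 1 := by push_cast [hi1]; ring
        rw [this, hρ]; ring
      simp only [e] at this
      linarith
    have hnb2 : Wd n p h u (i+1) t + A * q (i+1) t ^ 2 - K * (1 / (ρ - h) ^ 2) ≤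
        w + A * q i t ^ 2 - x := by
      have e : S + 1 - ((i+1:ℕ):ℝ) * h = ρ - h := by
        push_cast; rw [hρ]; ring
      by_cases hm : i + 1 ∈ I
      · have := hmax (i+1) hm
        simp only [e] at this
        linarith
      · have h1 : S + 1 < ((i+1:ℕ):ℝ) * h + σ := by
          by_contra hc; exact hm ((hmem _).2 (by linarith))
        have h2 : ρ - h < 2 * √h := by linarith
        have h3 : 0 < ρ - h := by linarith
        have h4 : (ρ - h) ^ 2 ≤ 4 * h := sq_aux hh.le h3.le h2.le
        have h5 := hcoarse (i+1) (by linarith) t htt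
        have h6 : K / (4 * h) ≤ K * (1 / (ρ - h) ^ 2) := by
          rw [mul_one_div]; gcongr
        linarith
    -- discrete Laplacian at the maximum
    set α := u i t ^ p with hα
    clear_value α
    have hα0 : 0 < α := hα ▸ rpow_pos_of_pos hui p
    have hαM : α ≤ M ^ p := hα ▸ rpow_le_rpow hui.le (H.le i t ht0) (by linarith)
    have hαl : lam ^ p ≤ α := hα ▸ rpow_le_rpow hlam.le hlu (by linarith)
    set LP := ((2 * i + n) * (q (i+1) t ^ 2 - q i t ^ 2) - 2 * i * (q i t ^ 2 - q (i-1) t ^ 2)) / h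
      with hLP
    clear_value LP
    set Lψ := K * (((2 * i + n) * (1 / (ρ - h) ^ 2 - 1 / ρ ^ 2)
      - 2 * i * (1 / ρ ^ 2 - 1 / (ρ + h) ^ 2)) / h) with hLψ
    clear_value Lψ
    have hLw : Lop n h (fun j => Wd n p h u j t) i + A * LP - Lψ ≤ 0 := by
      have e : Lop n h (fun j => Wd n p h u j t) i + A * LP - Lψ =
        ((2 * i + n) * ((Wd n p h u (i+1) t + A * q (i+1) t ^ 2 - K * (1 / (ρ - h) ^ 2)) -
          (w + A * q i t ^ 2 - x)) - 2 * i * ((w + A * q i t ^ 2 - x) -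
          (Wd n p h u (i-1) t + A * q (i-1) t ^ 2 - K * (1 / (ρ + h) ^ 2)))) / h := by
        rw [hLP, hLψ, hx]; simp only [Lop, ← hw]; ring
      rw [e]
      apply div_nonpos_of_nonpos_of_nonneg _ hh.le
      have a1 : (2 * (i:ℝ) + n) * ((Wd n p h u (i+1) t + A * q (i+1) t ^ 2
          - K * (1 / (ρ - h) ^ 2)) - (w + A * q i t ^ 2 - x)) ≤ 0 :=
        mul_nonpos_of_nonneg_of_nonpos (by positivity) (by linarith)
      have a2 : 0 ≤ 2 * (i:ℝ) * ((w + A * q i t ^ 2 - x) -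
          (Wd n p h u (i-1) t + A * q (i-1) t ^ 2 - K * (1 / (ρ + h) ^ 2))) :=
        mul_nonneg (by positivity) (by linarith)
      linarith
    have hLψb : Lψ ≤ K * Cψ / ρ ^ 4 := by
      have f1 := barrier_FD hh hρh
      have f2 := barrier_SD hh hρh
      have e : Lψ = K * (2 * i * (1 / (ρ - h) ^ 2 + 1 / (ρ + h) ^ 2 - 2 / ρ ^ 2) / h
          + n * (1 / (ρ - h) ^ 2 - 1 / ρ ^ 2) / h) := by
        rw [hLψ]; ring
      rw [e, mul_div_assoc K]
      apply mul_le_mul_of_nonneg_left _ hKpos.le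
      have g1 : 2 * i * (1 / (ρ - h) ^ 2 + 1 / (ρ + h) ^ 2 - 2 / ρ ^ 2) / h ≤
          22 * (S+1) / ρ ^ 4 := by
        calc _ ≤ 2 * i * (11 * h ^ 2 / ρ ^ 4) / h := by gcongr
          _ = 22 * (i * h) / ρ ^ 4 := by field_simp; ring
          _ ≤ _ := by gcongr
      have g2 : n * (1 / (ρ - h) ^ 2 - 1 / ρ ^ 2) / h ≤ 8 * n * (S+1) / ρ ^ 4 := by
        calc _ ≤ n * (8 * h / ρ ^ 3) / h := by gcongr
          _ = 8 * n * ρ / ρ ^ 4 := by field_simp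
          _ ≤ _ := by gcongr
      calc _ ≤ 22 * (S+1) / ρ ^ 4 + 8 * n * (S+1) / ρ ^ 4 := add_le_add g1 g2
        _ = Cψ / ρ ^ 4 := by rw [hCψ]; ring
    -- Bernstein core
    set f := (2 * i + n) * q i t - 2 * i * q (i-1) t with hf
    clear_value f
    have hwf : w = α * f := by rw [hw, hα, hf]; exact hWeq i t
    have hf4 : 4 * Q ≤ f := by
      have : 4 * (Q * M ^ p) ≤ M ^ p * f := by
        have hf0 : 0 ≤ f := by
          by_contra hc
          have : α * f < 0 := mul_neg_of_pos_of_neg hα0 (by linarith)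
          have : 0 ≤ Q * M ^ p := by positivity
          linarith
        have : α * f ≤ M ^ p * f := mul_le_mul_of_nonneg_right hαM hf0
        linarith
      have : M ^ p * (4 * Q) ≤ M ^ p * f := by linarith
      exact le_of_mul_le_mul_left this hMp
    have hp0 : 0 ≤ p := by linarith
    have hcore1 : u (i+1) t ^ p ≤ α := by
      rw [hα]; exact rpow_le_rpow (H.nonneg _ ht0) (H.anti i ht0) hp0
    have hcore2 : α - u (i+1) t ^ p ≤ h * B := by
      rw [hα, hB]; exact H.b_bd ht0 (hqQ i hiS t htt)
    have core := bern_core (x := i) (m := n) (h := h) (q0 := q (i-1) t) (q := q i t)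
      (q1 := q (i+1) t) (α := α) (a := u (i+1) t ^ p) (Q := Q) (B := B) (lam := lam ^ p)
      (S := S + 1) hi1' hn hh hh1 (by positivity) hαl (hqn i t htt) (hqQ i hiS t htt)
      hcore1
      hcore2 hiS (hf ▸ hf4)
    have ew1 : Wd n p h u (i+1) t = u (i+1) t ^ p *
        ((2 * i + 2 + n) * q (i+1) t - 2 * (i + 1) * q i t) := by
      rw [hWeq]; simp only [Nat.add_sub_cancel]; push_cast; ring
    rw [← ew1, ← hf, ← hwf, ← hX1, ← hLP] at core
    have core2 : α * f ^ 2 / (4 * (S+1)) ≥ w ^ 2 / (4 * (S+1) * M ^ p) := by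
      have : w ^ 2 / (4 * (S+1) * M ^ p) = α * f ^ 2 / (4 * (S+1)) * (α / M ^ p) := by
        rw [hwf]; field_simp
      rw [this]
      have h1 : α / M ^ p ≤ 1 := by rw [div_le_one hMp]; exact hαM
      exact mul_le_of_le_one_right (by positivity) h1
    have core3 : A * (2 * q i t * ((Wd n p h u (i+1) t - w) / h) - α * LP) ≤
        A * X1 - (p / lam + 1) * w ^ 2 := by
      have : A * (w ^ 2 / (4 * (S+1) * M ^ p)) = (p / lam + 1) * w ^ 2 := by
        rw [hA]; field_simp
      rw [← this, ← mul_sub]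
      apply mul_le_mul_of_nonneg_left _ hA0
      linarith
    have r1 : p * w ^ 2 / u i t ≤ p / lam * w ^ 2 := by
      calc p * w ^ 2 / u i t ≤ p * w ^ 2 / lam := by gcongr
        _ = _ := by ring
    have r2 : α * (Lop n h (fun j => Wd n p h u j t) i + A * LP - Lψ) ≤ 0 :=
      mul_nonpos_of_nonneg_of_nonpos hα0.le hLw
    have r3 : α * Lψ ≤ M ^ p * (K * Cψ / ρ ^ 4) := by
      calc α * Lψ ≤ α * (K * Cψ / ρ ^ 4) := mul_le_mul_of_nonneg_left hLψb hα0.le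
        _ ≤ _ := by gcongr
    -- w² dominates
    have s1 : x ^ 2 / 4 + y ^ 2 / 4 ≤ w ^ 2 := sumsq_aux hx0.le hy0.le hwx
    have s2 : K / (t - ta) ^ 2 ≤ y ^ 2 / 4 := by
      have : y ^ 2 / 4 = K / (t - ta) ^ 2 * (K / 4) := by rw [hy]; field_simp
      rw [this]
      have : 0 < K / (t - ta) ^ 2 := by positivity
      exact le_mul_of_one_le_right this.le (by linarith)
    have s3 : M ^ p * (K * Cψ / ρ ^ 4) ≤ x ^ 2 / 8 := by
      have : x ^ 2 / 8 = K * K / ρ ^ 4 / 8 := by rw [hx]; field_simp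
      rw [this]
      have : M ^ p * (K * Cψ / ρ ^ 4) = K * (8 * (M ^ p * Cψ)) / ρ ^ 4 / 8 := by field_simp
      rw [this]
      gcongr
      linarith
    have s4 : A * X1 ≤ x ^ 2 / 8 := by
      have h1 : x ^ 2 / 8 = K * K / (8 * ρ ^ 4) := by rw [hx]; field_simp
      rw [h1, le_div_iff₀ (by positivity)]
      have h2 : A * X1 * (8 * ρ ^ 4) ≤ A * X1 * (8 * (S+1) ^ 4) := by gcongr
      have h3 : A * X1 * (8 * (S+1) ^ 4) ≤ K := by linarith
      have h4 : K ≤ K * K := le_mul_of_one_le_right hKpos.le (by linarith)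
      linarith
    simp only [zero_mul]
    linarith


theorem Lop_sq (n : ℕ) {h : ℝ} (hh : 0 < h) (y : ℝ) (i : ℕ) :
    Lop n h (fun j => ((j:ℝ) * h - y) ^ 2) i = 2 * n * (i * h - y) + 4 * (i * h) + n * h := by
  cases i with
  | zero => simp [Lop]; field_simp; ring
  | succ i => simp [Lop]; field_simp; ring

/-- Strict concavity of the square root, quantified. -/
theorem sqrt_SD {x h : ℝ} (hh : 0 < h) (hx : 0 < x) (hxh : h ≤ x ^ 2) :
    √(x ^ 2 + h) + √(x ^ 2 - h) - 2 * x ≤ -(h ^ 2 / (4 * x ^ 3)) := by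
  have h1 : √(x ^ 2 + h) * √(x ^ 2 - h) ≤ x ^ 2 - h ^ 2 / (2 * x ^ 2) := by
    rw [← Real.sqrt_mul (by positivity)]
    have h0 : 0 ≤ x ^ 2 - h ^ 2 / (2 * x ^ 2) := by
      rw [sub_nonneg, div_le_iff₀ (by positivity)]
      nlinarith [sq_nonneg x]
    apply Real.sqrt_le_iff.2 ⟨h0, ?_⟩
    have : (x ^ 2 - h ^ 2 / (2 * x ^ 2)) ^ 2 = (x ^ 2 + h) * (x ^ 2 - h) + (h ^ 2 / (2 * x ^ 2)) ^ 2 := by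
      field_simp; ring
    rw [this]
    linarith [sq_nonneg (h ^ 2 / (2 * x ^ 2))]
  have e1 := Real.sq_sqrt (show 0 ≤ x ^ 2 + h by positivity)
  have e2 := Real.sq_sqrt (show 0 ≤ x ^ 2 - h by linarith)
  have h2 : (√(x ^ 2 + h) + √(x ^ 2 - h)) ^ 2 ≤ (2 * x - h ^ 2 / (4 * x ^ 3)) ^ 2 := by
    have : (2 * x - h ^ 2 / (4 * x ^ 3)) ^ 2 = 4 * x ^ 2 - 2 * (h ^ 2 / (2 * x ^ 2))
        + (h ^ 2 / (4 * x ^ 3)) ^ 2 := by field_simp; ring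
    rw [this]
    nlinarith [sq_nonneg (h ^ 2 / (4 * x ^ 3))]
  have h3 : 0 ≤ 2 * x - h ^ 2 / (4 * x ^ 3) := by
    rw [sub_nonneg, div_le_iff₀ (by positivity)]
    have : h ^ 2 ≤ (x ^ 2) ^ 2 := pow_le_pow_left₀ hh.le hxh 2
    nlinarith [sq_nonneg (x ^ 2)]
  have := abs_le_of_sq_le_sq' h2 h3
  linarith [this.2]

/-- One-sided time estimate through a quadratic barrier. -/
theorem time_barrier (n : ℕ) {h : ℝ} (hn : 1 ≤ n) (hh : 0 < h) (hh1 : h ≤ 1)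
    (f a c : ℕ → ℝ → ℝ) (is R : ℕ) (hR : R * h = 1) (hR1 : 1 ≤ R) (t0 t1 W C0 Λ S ε A F : ℝ)
    (hS : (is + R + 1 : ℝ) * h ≤ S)
    (hc : ∀ i ≤ is + R, ContinuousOn (f i) (Icc t0 t1))
    (hd : ∀ i ≤ is + R, ∀ t ∈ Ioo t0 t1, HasDerivAt (f i) (a i t * Lop n h (fun j => f j t) i + c i t) t)
    (hW : ∀ i ≤ is + R, ∀ t ∈ Icc t0 t1, f i t ≤ W)
    (ha : ∀ i ≤ is + R, ∀ t ∈ Icc t0 t1, 0 ≤ a i t ∧ a i t ≤ Λ)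
    (hcc : ∀ i ≤ is + R, ∀ t ∈ Icc t0 t1, c i t ≤ C0)
    (hF : -W ≤ F) (hε : 0 ≤ ε) (hA : 2 * W ≤ A) (hA0 : 0 ≤ A) (hC0 : 0 ≤ C0)
    (hΛ : 0 ≤ Λ)
    (h0 : ∀ i ≤ is + R, |(i:ℝ) * h - is * h| ≤ 1 → f i t0 ≤ F + ε + A * ((i:ℝ) * h - is * h) ^ 2)
    (t : ℝ) (ht : t ∈ Icc t0 t1) :
    f is t ≤ F + ε + (Λ * (A * (3 * n + 4 * S)) + C0) * (t - t0) := by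
  set B := Λ * (A * (3 * n + 4 * S)) + C0 with hB
  have hn' : (1:ℝ) ≤ n := by exact_mod_cast hn
  have hS0 : 0 ≤ S := le_trans (by positivity) hS
  have hB0 : 0 ≤ B := by positivity
  let I : Finset ℕ := (Finset.range (is + R + 1)).filter (fun i => is ≤ i + R)
  have hmem : ∀ i : ℕ, i ∈ I ↔ i ≤ is + R ∧ is ≤ i + R := by
    intro i; simp only [I, Finset.mem_filter, Finset.mem_range]; omega
  have hpos : ∀ i : ℕ, ∀ t ∈ Icc t0 t1, i ≤ is + R → (i = is + R ∨ is = i + R) →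
      f i t - F - ε - A * ((i:ℝ) * h - is * h) ^ 2 - B * (t - t0) ≤ 0 := by
    intro i t ht hi hor
    have : ((i:ℝ) * h - is * h) ^ 2 = 1 := by
      rcases hor with h' | h'
      · rw [h']; push_cast
        have : ((is:ℝ) + R) * h - is * h = R * h := by ring
        rw [this, hR]; norm_num
      · rw [h']; push_cast
        have : (i:ℝ) * h - (i + R) * h = - (R * h) := by ring
        rw [this, hR]; norm_num
    rw [this]
    have := hW i hi t ht
    have : 0 ≤ B * (t - t0) := mul_nonneg hB0 (by linarith [ht.1])
    linarith
  have main := finMP I (fun i t => f i t - F - ε - A * ((i:ℝ) * h - is * h) ^ 2 - B * (t - t0))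
    (fun i t => a i t * Lop n h (fun j => f j t) i + c i t - B) t0 t1 0 ?_ ?_ ?_ ?_
    is ((hmem is).2 ⟨by omega, by omega⟩) t ht
  · simp only [sub_self] at main
    linarith
  · intro i hi
    have := hc i ((hmem i).1 hi).1
    fun_prop
  · intro i hi t ht
    have h1 := hd i ((hmem i).1 hi).1 t ht
    have h2 : HasDerivAt (fun t => B * (t - t0)) B t := by
      simpa using ((hasDerivAt_id t).sub_const t0).const_mul B
    exact (((h1.sub_const F).sub_const ε).sub_const _).sub h2
  · intro i hi
    have him := (hmem i).1 hi
    have h1 : |(i:ℝ) * h - is * h| ≤ 1 := by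
      have a1 : (i:ℝ) ≤ is + R := by exact_mod_cast him.1
      have a2 : (is:ℝ) ≤ i + R := by exact_mod_cast him.2
      rw [abs_le]; constructor <;> nlinarith
    have := h0 i him.1 h1
    simp only [sub_self, mul_zero, sub_zero]
    linarith
  · intro i hi t ht hZ hmax
    have him := (hmem i).1 hi
    have htt : t ∈ Icc t0 t1 := Ioo_subset_Icc_self ht
    have n1 : i ≠ is + R := fun hc => by
      have := hpos i t htt him.1 (Or.inl hc); linarith
    have n2 : is ≠ i + R := fun hc => by
      have := hpos i t htt him.1 (Or.inr hc); linarith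
    have m1 := hmax (i+1) ((hmem _).2 (by omega))
    have m2 : f (i-1) t - F - ε - A * (((i-1:ℕ):ℝ) * h - is * h) ^ 2 - B * (t - t0) ≤
        f i t - F - ε - A * ((i:ℝ) * h - is * h) ^ 2 - B * (t - t0) :=
      hmax (i-1) ((hmem _).2 (by omega))
    have hL := Lop_nonpos_of_max n h (by linarith) hh
      (fun j => f j t - A * ((j:ℝ) * h - is * h) ^ 2) i (by linarith)
      (by linarith)
    have e : Lop n h (fun j => f j t - A * ((j:ℝ) * h - is * h) ^ 2) i =
        Lop n h (fun j => f j t) i - A * (2 * n * (i * h - is * h) + 4 * (i * h) + n * h) := by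
      rw [← Lop_sq n hh]; simp only [Lop]; ring
    rw [e] at hL
    have a1 : (i:ℝ) ≤ is + R := by exact_mod_cast him.1
    have b1 : (i:ℝ) * h - is * h ≤ 1 := by nlinarith
    have b2 : (i:ℝ) * h ≤ S := by nlinarith
    have b3 : 2 * n * ((i:ℝ) * h - is * h) + 4 * (i * h) + n * h ≤ 3 * n + 4 * S := by nlinarith
    have b4 : Lop n h (fun j => f j t) i ≤ A * (3 * n + 4 * S) := by
      have := mul_le_mul_of_nonneg_left b3 hA0
      linarith
    have hai := ha i him.1 t htt
    have b5 : a i t * Lop n h (fun j => f j t) i ≤ Λ * (A * (3 * n + 4 * S)) :=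
      calc a i t * Lop n h (fun j => f j t) i ≤ a i t * (A * (3 * n + 4 * S)) :=
            mul_le_mul_of_nonneg_left b4 hai.1
        _ ≤ _ := mul_le_mul_of_nonneg_right hai.2 (by positivity)
    have := hcc i him.1 t htt
    simp only [zero_mul]
    linarith

/-- Final algebra in the Hölder estimate. -/
theorem holder_fin {h x lam K W Λ C0 n sp sm Li Lj ai aj c1 c2 i j P S T' : ℝ}
    (hh : 0 < h) (hx0 : 0 < x) (hx1 : x ≤ 1) (hlam : 0 < lam) (hK0 : 0 < K) (hW0 : 0 ≤ W)
    (hΛ : 0 ≤ Λ) (hC0 : 0 ≤ C0) (hn : 1 ≤ n)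
    (hE : sp + sm - 2 * x ≤ -(h ^ 2 / (4 * x ^ 3))) (hsm : sm ≤ x)
    (L1 : h * Li ≤ K * ((2 * i + n) * (sp - x) + 2 * i * (sm - x)) + h * (2 * W * P))
    (L2 : -(h * Lj) ≤ K * ((2 * j + n) * (sm - x) + 2 * j * (sp - x)))
    (h1 : lam ≤ ai) (h2 : ai ≤ Λ) (h3 : ai ≤ aj) (h4 : c1 ≤ C0) (h5 : -C0 ≤ c2)
    (hi : x ^ 2 ≤ i * h) (hP : P ≤ 3 * n + 4 * S) (hj : 0 ≤ j)
    (hK : 2 * W + 2 / lam * (Λ * (2 * W * (3 * n + 4 * S)) + 2 * C0 + T') ≤ K) (hS : 0 ≤ S) :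
    (ai * Li + c1) - (aj * Lj + c2) + T' ≤ 0 * 1 := by
  have hE0 : sp + sm - 2 * x ≤ 0 := by
    have : 0 ≤ h ^ 2 / (4 * x ^ 3) := by positivity
    linarith
  have hai : 0 < ai := by linarith
  have haj : 0 < aj := by linarith
  have hi0 : 0 ≤ i := by
    have : 0 ≤ i * h := le_trans (sq_nonneg x) hi
    exact nonneg_of_mul_nonneg_left this hh
  have A1 := mul_le_mul_of_nonneg_left L1 hai.le
  have A2 := mul_le_mul_of_nonneg_left L2 haj.le
  -- the pure second-difference contributions
  have B1 : aj * (2 * j * (sp + sm - 2 * x)) ≤ 0 :=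
    mul_nonpos_of_nonneg_of_nonpos haj.le
      (mul_nonpos_of_nonneg_of_nonpos (by positivity) hE0)
  have B2 : aj * (n * (sm - x)) ≤ ai * (n * (sm - x)) :=
    mul_le_mul_of_nonpos_right h3 (mul_nonpos_of_nonneg_of_nonpos (by linarith) (by linarith))
  have B3 : ai * (n * (sp + sm - 2 * x)) ≤ 0 :=
    mul_nonpos_of_nonneg_of_nonpos hai.le
      (mul_nonpos_of_nonneg_of_nonpos (by linarith) hE0)
  have B4 : 2 * i * (sp + sm - 2 * x) ≤ -(h / 2) := by
    have c1 : 2 * i * (sp + sm - 2 * x) ≤ 2 * i * (-(h ^ 2 / (4 * x ^ 3))) :=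
      mul_le_mul_of_nonneg_left hE (by positivity)
    have c2 : h / 2 ≤ 2 * i * (h ^ 2 / (4 * x ^ 3)) := by
      have e : 2 * i * (h ^ 2 / (4 * x ^ 3)) = (i * h) * (h / (2 * x ^ 3)) := by
        field_simp; ring
      rw [e]
      calc h / 2 ≤ h / 2 / x := by
            rw [le_div_iff₀ hx0]
            exact mul_le_of_le_one_right (by positivity) hx1
        _ = x ^ 2 * (h / (2 * x ^ 3)) := by field_simp
        _ ≤ _ := mul_le_mul_of_nonneg_right hi (by positivity)
    linarith
  have B5 : ai * (2 * i * (sp + sm - 2 * x)) ≤ lam * (-(h / 2)) := by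
    calc ai * (2 * i * (sp + sm - 2 * x)) ≤ ai * (-(h/2)) := mul_le_mul_of_nonneg_left B4 hai.le
      _ ≤ _ := mul_le_mul_of_nonpos_right h1 (by linarith)
  have B6 : ai * ((2 * i + n) * (sp - x) + 2 * i * (sm - x)) +
      aj * ((2 * j + n) * (sm - x) + 2 * j * (sp - x)) ≤ lam * (-(h/2)) := by linarith
  have B7 := mul_le_mul_of_nonneg_left B6 hK0.le
  have B8 : ai * (2 * W * P) ≤ Λ * (2 * W * (3 * n + 4 * S)) := by
    calc ai * (2 * W * P) ≤ ai * (2 * W * (3 * n + 4 * S)) :=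
          mul_le_mul_of_nonneg_left (mul_le_mul_of_nonneg_left hP (by positivity)) hai.le
      _ ≤ _ := mul_le_mul_of_nonneg_right h2 (by positivity)
  have B9 := mul_le_mul_of_nonneg_left B8 hh.le
  have key : h * (ai * Li - aj * Lj) ≤
      h * (-(K * lam / 2) + Λ * (2 * W * (3 * n + 4 * S))) := by linarith
  have key2 := le_of_mul_le_mul_left key hh
  have hK2 : Λ * (2 * W * (3 * n + 4 * S)) + 2 * C0 + T' ≤ K * lam / 2 := by
    have : 2 / lam * (Λ * (2 * W * (3 * n + 4 * S)) + 2 * C0 + T') ≤ K := by linarith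
    rw [div_mul_eq_mul_div, div_le_iff₀ hlam] at this
    linarith
  linarith

set_option maxHeartbeats 1000000 in
/-- One-sided spatial Hölder estimate. -/
theorem holder_core (n : ℕ) {h : ℝ} (hn : 1 ≤ n) (hh : 0 < h) (hh1 : h ≤ 1)
    (f a c : ℕ → ℝ → ℝ) (is R : ℕ) (hR : R * h = 1) (hR1 : 1 ≤ R) (ts τ W C0 lam Λ S K : ℝ)
    (hτ : 0 < τ) (hlam : 0 < lam) (hK0 : 0 < K)
    (hS : (is + R + 1 : ℝ) * h ≤ S)
    (hc : ∀ i ≤ is + R, ContinuousOn (f i) (Icc (ts - τ) ts))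
    (hd : ∀ i ≤ is + R, ∀ t ∈ Ioo (ts - τ) ts,
      HasDerivAt (f i) (a i t * Lop n h (fun j => f j t) i + c i t) t)
    (hW : ∀ i ≤ is + R, ∀ t ∈ Icc (ts - τ) ts, |f i t| ≤ W)
    (ha : ∀ i ≤ is + R, ∀ t ∈ Icc (ts - τ) ts, lam ≤ a i t ∧ a i t ≤ Λ)
    (hanti : ∀ i j, j ≤ i → i ≤ is + R → ∀ t ∈ Icc (ts - τ) ts, a i t ≤ a j t)
    (hcc : ∀ i ≤ is + R, ∀ t ∈ Icc (ts - τ) ts, |c i t| ≤ C0)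
    (hK : 2 * W + 2 / lam * (Λ * (2 * W * (3 * n + 4 * S)) + 2 * C0 + 2 * W / τ) ≤ K)
    (j : ℕ) (hj : j ≤ is) (hjR : is ≤ j + R) :
    f is ts - f j ts ≤ K * √(((is:ℝ) - j) * h) := by
  have hn' : (1:ℝ) ≤ n := by exact_mod_cast hn
  have hS0 : 0 ≤ S := le_trans (by positivity) hS
  have htsm : ts ∈ Icc (ts - τ) ts := ⟨by linarith, le_rfl⟩
  have hW0 : 0 ≤ W := (abs_nonneg _).trans (hW 0 (by omega) ts htsm)
  have hC0 : 0 ≤ C0 := (abs_nonneg _).trans (hcc 0 (by omega) ts htsm)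
  have hΛ : 0 ≤ Λ := by have := ha 0 (by omega) ts htsm; linarith
  let I : Finset (ℕ × ℕ) := (Finset.range (is + R + 1) ×ˢ Finset.range (is + R + 1)).filter
    (fun z => is ≤ z.1 + R ∧ z.2 ≤ z.1 ∧ z.1 ≤ z.2 + R)
  have hmem : ∀ i j : ℕ, (i, j) ∈ I ↔ i ≤ is + R ∧ is ≤ i + R ∧ j ≤ i ∧ i ≤ j + R := by
    intro i j
    simp only [I, Finset.mem_filter, Finset.mem_product, Finset.mem_range]; omega
  have hff : ∀ i j : ℕ, (i, j) ∈ I → ∀ t ∈ Icc (ts - τ) ts, f i t - f j t ≤ 2 * W := by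
    intro i j hij t ht
    have hm := (hmem i j).1 hij
    have h1 := abs_le.1 (hW i hm.1 t ht)
    have h2 := abs_le.1 (hW j (by omega) t ht)
    linarith [h1.2, h2.1]
  have hWτ : 0 ≤ 2 * W / τ := by positivity
  have hpen : ∀ t ∈ Icc (ts - τ) ts, 0 ≤ 2 * W / τ * (ts - t) := fun t ht =>
    mul_nonneg hWτ (by linarith [ht.2])
  have hKW : 2 * W ≤ K := by
    have : 0 ≤ 2 / lam * (Λ * (2 * W * (3 * n + 4 * S)) + 2 * C0 + 2 * W / τ) := by positivity
    linarith
  have hbd : ∀ i j : ℕ, (i, j) ∈ I → ∀ t ∈ Icc (ts - τ) ts,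
      (i = is + R ∨ is = i + R ∨ i = j ∨ i = j + R) →
      f i t - f j t - K * √(((i:ℝ) - j) * h) - 2 * W * ((i:ℝ) * h - is * h) ^ 2
        - 2 * W / τ * (ts - t) ≤ 0 := by
    intro i j hij t ht hor
    have h1 := hff i j hij t ht
    have h2 := hpen t ht
    have h3 : 0 ≤ K * √(((i:ℝ) - j) * h) := by positivity
    have h4 : 0 ≤ 2 * W * ((i:ℝ) * h - is * h) ^ 2 := by positivity
    rcases hor with h' | h' | h' | h'
    · have e : ((i:ℝ) * h - is * h) ^ 2 = 1 := by
        rw [h']; push_cast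
        have : ((is:ℝ) + R) * h - is * h = R * h := by ring
        rw [this, hR]; norm_num
      rw [e]; linarith
    · have e : ((i:ℝ) * h - is * h) ^ 2 = 1 := by
        rw [h']; push_cast
        have : (i:ℝ) * h - (i + R) * h = - (R * h) := by ring
        rw [this, hR]; norm_num
      rw [e]; linarith
    · subst h'; linarith
    · have e : ((i:ℝ) - j) * h = 1 := by
        rw [h', ← hR]; push_cast; ring
      rw [e] at h3 ⊢
      rw [Real.sqrt_one] at h3 ⊢
      linarith
  have main := finMP I (fun z t => f z.1 t - f z.2 t - K * √(((z.1:ℝ) - z.2) * h)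
      - 2 * W * ((z.1:ℝ) * h - is * h) ^ 2 - 2 * W / τ * (ts - t))
    (fun z t => (a z.1 t * Lop n h (fun j => f j t) z.1 + c z.1 t)
      - (a z.2 t * Lop n h (fun j => f j t) z.2 + c z.2 t) + 2 * W / τ) (ts - τ) ts 0 ?_ ?_ ?_ ?_
    (is, j) ((hmem is j).2 ⟨by omega, by omega, hj, hjR⟩) ts htsm
  · simp only [sub_self] at main
    linarith
  · rintro ⟨i, j⟩ hij
    have hm := (hmem i j).1 hij
    have h1 := hc i hm.1
    have h2 := hc j (by omega)
    simp only
    fun_prop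
  · rintro ⟨i, j⟩ hij t ht
    have hm := (hmem i j).1 hij
    have h1 := hd i hm.1 t ht
    have h2 := hd j (by omega) t ht
    have h3 : HasDerivAt (fun t => 2 * W / τ * (ts - t)) (-(2 * W / τ)) t := by
      simpa using ((hasDerivAt_id t).const_sub ts).const_mul (2 * W / τ)
    have := (((h1.sub h2).sub_const (K * √(((i:ℝ) - j) * h))).sub_const
      (2 * W * ((i:ℝ) * h - is * h) ^ 2)).sub h3
    refine this.congr_deriv ?_
    ring
  · rintro ⟨i, j⟩ hij
    have h1 := hff i j hij (ts - τ) ⟨le_rfl, by linarith⟩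
    have h3 : 0 ≤ K * √(((i:ℝ) - j) * h) := by positivity
    have h4 : 0 ≤ 2 * W * ((i:ℝ) * h - is * h) ^ 2 := by positivity
    have e : 2 * W / τ * (ts - (ts - τ)) = 2 * W := by field_simp; ring
    simp only [e]
    linarith
  · rintro ⟨i, j⟩ hij t ht hZ hmax
    simp only at hZ
    have hm := (hmem i j).1 hij
    have htt : t ∈ Icc (ts - τ) ts := Ioo_subset_Icc_self ht
    have nb : ¬ (i = is + R ∨ is = i + R ∨ i = j ∨ i = j + R) := fun hc => by
      have := hbd i j hij t htt hc; linarith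
    push Not at nb
    obtain ⟨n1, n2, n3, n4⟩ := nb
    have m1 := hmax (i+1, j) ((hmem _ _).2 (by omega))
    have m2 := hmax (i-1, j) ((hmem _ _).2 (by omega))
    have m3 := hmax (i, j+1) ((hmem _ _).2 (by omega))
    have m4 : 1 ≤ j → _ := fun h1 => hmax (i, j-1) ((hmem _ _).2 (by omega))
    simp only at m1 m2 m3 m4
    have hi1 : 1 ≤ i := by omega
    have ci : ((i-1:ℕ):ℝ) = i - 1 := by push_cast [hi1]; ring
    have hij1 : (j:ℝ) + 1 ≤ i := by
      have : j + 1 ≤ i := by omega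
      exact_mod_cast this
    have hijR : (i:ℝ) ≤ j + R := by exact_mod_cast hm.2.2.2
    set x := √(((i:ℝ) - j) * h) with hx
    have hdh : h ≤ ((i:ℝ) - j) * h := le_mul_of_one_le_left hh.le (by linarith)
    have hx2 : x ^ 2 = ((i:ℝ) - j) * h := Real.sq_sqrt (by linarith)
    have hx0 : 0 < x := Real.sqrt_pos.2 (by linarith)
    have hx1 : x ≤ 1 := by
      rw [hx]; apply Real.sqrt_le_one.2
      rw [← hR]; exact mul_le_mul_of_nonneg_right (by linarith) hh.le
    have sp : ((i:ℝ) - j) * h + h = x ^ 2 + h := by rw [hx2]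
    have e1 : (((i+1:ℕ):ℝ) - j) * h = x ^ 2 + h := by rw [hx2]; push_cast; ring
    have e2 : (((i-1:ℕ):ℝ) - j) * h = x ^ 2 - h := by rw [hx2, ci]; ring
    have e3 : ((i:ℝ) - ((j+1:ℕ):ℝ)) * h = x ^ 2 - h := by rw [hx2]; push_cast; ring
    have e4 : 1 ≤ j → ((i:ℝ) - ((j-1:ℕ):ℝ)) * h = x ^ 2 + h := fun h1 => by
      have : ((j-1:ℕ):ℝ) = j - 1 := by push_cast [h1]; ring
      rw [hx2, this]; ring
    rw [e1] at m1
    rw [e2, ci] at m2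
    rw [e3] at m3
    push_cast at m1
    obtain ⟨sp, hsp⟩ : ∃ y, y = √(x ^ 2 + h) := ⟨_, rfl⟩
    obtain ⟨sm, hsm⟩ : ∃ y, y = √(x ^ 2 - h) := ⟨_, rfl⟩
    have hE : sp + sm - 2 * x ≤ -(h ^ 2 / (4 * x ^ 3)) := by
      rw [hsp, hsm]; exact sqrt_SD hh hx0 (by rw [hx2]; exact hdh)
    have hsmx : sm ≤ x := by
      rw [hsm]; apply Real.sqrt_le_iff.2 ⟨hx0.le, by linarith⟩
    have m4' : 1 ≤ j → -(f (j-1) t - f j t) ≤ K * (sp - x) := fun h1 => by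
      have := m4 h1
      rw [e4 h1, ← hsp] at this
      linarith
    rw [← hsp] at m1
    rw [← hsm] at m2 m3
    clear_value x
    clear m4 e4 hbd hff hmax hc hd
    -- second differences
    have hi0 : (0:ℝ) ≤ i := by positivity
    set P : ℝ := 2 * n * (i * h - is * h) + 4 * (i * h) + n * h with hP
    clear_value P
    have L1 : h * Lop n h (fun j => f j t) i ≤
        K * ((2 * i + n) * (sp - x) + 2 * i * (sm - x)) + h * (2 * W * P) := by
      have q1 : (2 * (i:ℝ) + n) * (f (i+1) t - f i t) ≤ (2 * (i:ℝ) + n) * (K * (sp - x) +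
          2 * W * (((i + 1 : ℝ) * h - is * h) ^ 2 - (i * h - is * h) ^ 2)) :=
        mul_le_mul_of_nonneg_left (by linarith) (by positivity)
      have q2 : 2 * (i:ℝ) * (f (i-1) t - f i t) ≤ 2 * (i:ℝ) * (K * (sm - x) +
          2 * W * (((i - 1 : ℝ) * h - is * h) ^ 2 - (i * h - is * h) ^ 2)) :=
        mul_le_mul_of_nonneg_left (by linarith) (by positivity)
      have e : h * Lop n h (fun j => f j t) i = (2 * (i:ℝ) + n) * (f (i+1) t - f i t) +
          2 * (i:ℝ) * (f (i-1) t - f i t) := by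
        simp only [Lop]; field_simp; ring
      rw [e]
      refine (add_le_add q1 q2).trans (le_of_eq ?_)
      rw [hP]; ring
    have L2 : -(h * Lop n h (fun j => f j t) j) ≤
        K * ((2 * j + n) * (sm - x) + 2 * j * (sp - x)) := by
      have q1 : (2 * (j:ℝ) + n) * (-(f (j+1) t - f j t)) ≤ (2 * (j:ℝ) + n) * (K * (sm - x)) :=
        mul_le_mul_of_nonneg_left (by linarith) (by positivity)
      have q2 : 2 * (j:ℝ) * (-(f (j-1) t - f j t)) ≤ 2 * (j:ℝ) * (K * (sp - x)) := by
        rcases Nat.eq_zero_or_pos j with h' | h'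
        · rw [h']; simp
        · exact mul_le_mul_of_nonneg_left (m4' h') (by positivity)
      have e : -(h * Lop n h (fun j => f j t) j) = (2 * (j:ℝ) + n) * (-(f (j+1) t - f j t)) +
          2 * (j:ℝ) * (-(f (j-1) t - f j t)) := by
        simp only [Lop]; field_simp; ring
      rw [e]
      refine (add_le_add q1 q2).trans (le_of_eq ?_)
      ring
    have hai := ha i hm.1 t htt
    have haj := hanti i j hm.2.2.1 hm.1 t htt
    have hci := abs_le.1 (hcc i hm.1 t htt)
    have hcj := abs_le.1 (hcc j (by omega) t htt)
    generalize Lop n h (fun j => f j t) i = Li at *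
    generalize Lop n h (fun j => f j t) j = Lj at *
    generalize a i t = ai at *
    generalize a j t = aj at *
    generalize c i t = c1 at *
    generalize c j t = c2 at *
    have hxi : x ^ 2 ≤ i * h := by
      have : 0 ≤ (j:ℝ) * h := by positivity
      rw [hx2]; linarith only [this]
    have hPS : P ≤ 3 * n + 4 * S := by
      have a1 : (i:ℝ) ≤ is + R := by exact_mod_cast hm.1
      have a2 := mul_le_mul_of_nonneg_right a1 hh.le
      have b1 : (i:ℝ) * h - is * h ≤ 1 := by linarith only [a2, hR]
      have b2 : (i:ℝ) * h ≤ S := by linarith only [a2, hS, hh]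
      have b3 := mul_le_mul_of_nonneg_left b1 (by linarith only [hn'] : 0 ≤ (n:ℝ))
      have b4 := mul_le_mul_of_nonneg_left hh1 (by linarith only [hn'] : 0 ≤ (n:ℝ))
      rw [hP]; linarith only [b3, b4, b2]
    rw [zero_mul]
    have := holder_fin (T' := 2 * W / τ) hh hx0 hx1 hlam hK0 hW0 hΛ hC0 hn' hE hsmx L1 L2 hai.1 hai.2 haj
      hci.2 hcj.1 hxi hPS (by positivity) hK hS0
    linarith


/-- mesh size -/
noncomputable def hk (k : ℕ) : ℝ := 1 / ((k:ℝ) + 1)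

theorem hk_pos (k : ℕ) : 0 < hk k := by unfold hk; positivity
theorem hk_le (k : ℕ) : hk k ≤ 1 := by
  unfold hk; rw [div_le_one (by positivity)]; linarith [(Nat.cast_nonneg k : (0:ℝ) ≤ k)]
theorem hk_R (k : ℕ) : ((k+1:ℕ):ℝ) * hk k = 1 := by
  unfold hk; push_cast; field_simp
theorem hk_N (k : ℕ) : (((k+1)^2:ℕ):ℝ) * hk k = k + 1 := by
  unfold hk; push_cast; field_simp
theorem hk_tendsto : Tendsto hk atTop (nhds 0) := tendsto_one_div_add_atTop_nhds_zero_nat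

theorem ev_ge (c : ℝ) : ∀ᶠ k : ℕ in atTop, c ≤ (k:ℝ) + 1 := by
  filter_upwards [tendsto_natCast_atTop_atTop.eventually_ge_atTop c] with k hk
  linarith

/-- The approximating family. -/
structure Fam (n : ℕ) (p M T : ℝ) (g : ℝ → ℝ) (us : ℕ → ℕ → ℝ → ℝ) : Prop where
  hn : 1 ≤ n
  hp : 1 ≤ p
  hM : 0 < M
  hT : 0 < T
  gc : Continuous g
  ga : Antitone g
  gp : ∀ s, 0 < g s
  gM : ∀ s, g s ≤ M
  sol : ∀ k, DSol n ((k+1)^2) p (hk k) M T (us k)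
  ini : ∀ k i, i ≤ (k+1)^2 → us k i 0 = g (i * hk k)

namespace Fam
variable {n : ℕ} {p M T : ℝ} {g : ℝ → ℝ} {us : ℕ → ℕ → ℝ → ℝ}

theorem low (H : Fam n p M T g us) {S : ℝ} (hS : 0 < S) : ∃ lam > 0, ∀ᶠ k in atTop,
    ∀ i : ℕ, i * hk k ≤ S → ∀ t ∈ Icc 0 T, lam ≤ us k i t := by
  refine ⟨g (2 * S) / 2 * exp (-(M ^ p * n / (2 * S)) * T), by have := H.gp (2 * S); positivity, ?_⟩
  filter_upwards [ev_ge (2 * S)] with k hk2 i hi t ht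
  have hSN : 2 * S ≤ (((k+1)^2:ℕ):ℝ) * hk k := by rw [hk_N]; exact hk2
  refine (H.sol k).lower (H.gp _) hS hSN ?_ i hi ht
  intro j hj
  rw [H.ini k j ((H.sol k).idx_le hSN hj)]
  exact H.ga hj

theorem idx (H : Fam n p M T g us) {S : ℝ} {k : ℕ} (hk2 : S ≤ (k:ℝ) + 1) {i : ℕ}
    (hi : i * hk k ≤ S) : i ≤ (k+1)^2 :=
  (H.sol k).idx_le (S := S) (by rw [hk_N]; exact hk2) hi

theorem wbd (H : Fam n p M T g us) {S t0 : ℝ} (hS : 0 < S) (ht0 : 0 < t0) : ∃ W, 0 ≤ W ∧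
    ∀ᶠ k in atTop, ∀ i : ℕ, i * hk k ≤ S → ∀ t ∈ Icc t0 T, |Wd n p (hk k) (us k) i t| ≤ W := by
  obtain ⟨lam, hlam, hl⟩ := H.low (S := S + 1) (by linarith)
  obtain ⟨C, h0, hh0, hC⟩ := bernsteinW n p M T (t0/2) t0 S lam (by linarith) (by linarith) hS hlam
  refine ⟨|C| + M / t0, by have := H.hM; positivity, ?_⟩
  filter_upwards [hl, ev_ge (S+1), hk_tendsto.eventually (gt_mem_nhds hh0)] with k h1 h2 h3 i hi t ht
  have hup := hC _ _ _ h3 (H.sol k) (by rw [hk_N]; exact h2)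
    (fun i hi t ht => h1 i hi t ⟨by linarith [ht.1], ht.2⟩) i hi t ht
  have hlo := (H.sol k).w_lower i (t := t) ⟨by linarith [ht.1], ht.2⟩
  have hM := H.hM
  have hp := H.hp
  have htp : 0 < t := by linarith [ht.1]
  have h4 : us k i t / (p * t) ≤ M / t0 := by
    have a1 := (H.sol k).le i t ⟨htp.le, ht.2⟩
    have a2 : t0 ≤ p * t := by nlinarith [ht.1]
    gcongr
  have := le_abs_self C
  have : 0 ≤ M / t0 := by positivity
  have := abs_nonneg C
  rw [abs_le]; constructor <;> linarith

/-- collected bounds -/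
theorem bds (H : Fam n p M T g us) {S t0 : ℝ} (hS : 0 < S) (ht0 : 0 < t0) :
    ∃ W lam C0 : ℝ, 0 ≤ W ∧ 0 < lam ∧ 0 ≤ C0 ∧ ∀ᶠ k in atTop, ∀ i : ℕ, i * hk k ≤ S →
      ∀ t ∈ Icc t0 T, |Wd n p (hk k) (us k) i t| ≤ W ∧ lam ≤ us k i t ^ p ∧ us k i t ^ p ≤ M ^ p ∧
        |p * Wd n p (hk k) (us k) i t ^ 2 / us k i t| ≤ C0 := by
  obtain ⟨lam, hlam, hl⟩ := H.low (S := S) hS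
  obtain ⟨W, hW, hw⟩ := H.wbd hS ht0
  have hp := H.hp
  refine ⟨W, lam ^ p, p * W ^ 2 / lam, hW, by positivity, by positivity, ?_⟩
  filter_upwards [hl, hw] with k h1 h2 i hi t ht
  have ht' : t ∈ Icc 0 T := ⟨by linarith [ht.1], ht.2⟩
  have a1 := h1 i hi t ht'
  have a2 := h2 i hi t ht
  have a3 := (H.sol k).le i t ht'
  have hpos : 0 < us k i t := by linarith
  refine ⟨a2, rpow_le_rpow hlam.le a1 (by linarith), rpow_le_rpow hpos.le a3 (by linarith), ?_⟩
  rw [abs_of_nonneg (by positivity)]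
  have : Wd n p (hk k) (us k) i t ^ 2 ≤ W ^ 2 := by
    rw [← sq_abs]; exact pow_le_pow_left₀ (abs_nonneg _) a2 2
  gcongr

theorem hold (H : Fam n p M T g us) {S t0 : ℝ} (hS : 0 < S) (ht0 : 0 < t0) : ∃ K > 0,
    ∀ᶠ k in atTop, ∀ i j : ℕ, j ≤ i → i ≤ j + (k + 1) → i * hk k ≤ S → ∀ t ∈ Icc t0 T,
      |Wd n p (hk k) (us k) i t - Wd n p (hk k) (us k) j t| ≤ K * √(((i:ℝ) - j) * hk k) := by
  obtain ⟨W, lam, C0, hW, hlam, hC0, hb⟩ := H.bds (S := S + 2) (t0 := t0 / 2) (by linarith) (by linarith)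
  have hM := H.hM
  set K := 2 * W + 2 / lam * (M ^ p * (2 * W * (3 * n + 4 * (S+2))) + 2 * C0 + 2 * W / (t0/2)) + 1 with hK
  have hK0 : 0 < K := by positivity
  refine ⟨K, hK0, ?_⟩
  filter_upwards [hb] with k hb i j hji hij hi t ht
  have D := H.sol k
  have hh := hk_pos k
  have hR := hk_R k
  have hreg : ∀ l : ℕ, l ≤ i + (k+1) → l * hk k ≤ S + 2 := by
    intro l hl
    have : (l:ℝ) ≤ i + ((k+1:ℕ):ℝ) := by exact_mod_cast hl
    have := mul_le_mul_of_nonneg_right this hh.le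
    linarith
  have hSS : ((i:ℝ) + ((k+1:ℕ):ℝ) + 1) * hk k ≤ S + 2 := by
    have := hk_le k
    linarith
  have hsub : Icc (t - t0/2) t ⊆ Icc (t0/2) T := by
    intro s hs; exact ⟨by linarith [hs.1, ht.1], by linarith [hs.2, ht.2]⟩
  have hsub0 : Icc (t - t0/2) t ⊆ Icc 0 T := by
    intro s hs; exact ⟨by linarith [hs.1, ht.1], by linarith [hs.2, ht.2]⟩
  have hder : ∀ l, ∀ s ∈ Ioo (t - t0/2) t, HasDerivAt (Wd n p (hk k) (us k) l)
      (us k l s ^ p * Lop n (hk k) (fun j => Wd n p (hk k) (us k) j s) l +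
      p * Wd n p (hk k) (us k) l s ^ 2 / us k l s) s := fun l s hs =>
    D.derw l ⟨by linarith [hs.1, ht.1], by linarith [hs.2, ht.2]⟩
  have up := holder_core n H.hn hh (hk_le k) (fun l s => Wd n p (hk k) (us k) l s)
    (fun l s => us k l s ^ p) (fun l s => p * Wd n p (hk k) (us k) l s ^ 2 / us k l s) i (k+1) hR
    (by omega) t (t0/2) W C0 lam (M ^ p) (S+2) K (by linarith) hlam hK0 hSS
    (fun l _ => (D.contw l).mono hsub0) (fun l _ s hs => hder l s hs)
    (fun l hl s hs => (hb l (hreg l hl) s (hsub hs)).1)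
    (fun l hl s hs => ⟨(hb l (hreg l hl) s (hsub hs)).2.1, (hb l (hreg l hl) s (hsub hs)).2.2.1⟩)
    (fun l m hml hl s hs => rpow_le_rpow (D.nonneg _ (hsub0 hs)) (D.antitone (hsub0 hs) hml)
      (by linarith [H.hp]))
    (fun l hl s hs => (hb l (hreg l hl) s (hsub hs)).2.2.2) (by linarith) j hji hij
  have dn := holder_core n H.hn hh (hk_le k) (fun l s => -Wd n p (hk k) (us k) l s)
    (fun l s => us k l s ^ p) (fun l s => -(p * Wd n p (hk k) (us k) l s ^ 2 / us k l s)) i (k+1) hR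
    (by omega) t (t0/2) W C0 lam (M ^ p) (S+2) K (by linarith) hlam hK0 hSS
    (fun l _ => ((D.contw l).mono hsub0).neg) (fun l _ s hs => by
      refine (hder l s hs).neg.congr_deriv ?_
      have := Lop_smul n (hk k) (-1) (fun j => Wd n p (hk k) (us k) j s) l
      simp only [neg_one_mul] at this
      rw [this]; ring)
    (fun l hl s hs => by rw [abs_neg]; exact (hb l (hreg l hl) s (hsub hs)).1)
    (fun l hl s hs => ⟨(hb l (hreg l hl) s (hsub hs)).2.1, (hb l (hreg l hl) s (hsub hs)).2.2.1⟩)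
    (fun l m hml hl s hs => rpow_le_rpow (D.nonneg _ (hsub0 hs)) (D.antitone (hsub0 hs) hml)
      (by linarith [H.hp]))
    (fun l hl s hs => by rw [abs_neg]; exact (hb l (hreg l hl) s (hsub hs)).2.2.2) (by linarith) j hji hij
  rw [abs_le]; constructor <;> linarith

theorem sqrt_quad {K ε x : ℝ} (hε : 0 < ε) (hK : 0 < K) (hx : 0 ≤ x) :
    K * √x ≤ ε + K ^ 4 / ε ^ 3 * x ^ 2 := by
  set y := K * √x with hy
  have hy0 : 0 ≤ y := by positivity
  have e : K ^ 4 / ε ^ 3 * x ^ 2 = y ^ 4 / ε ^ 3 := by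
    have := Real.sq_sqrt hx
    have : x ^ 2 = √x ^ 4 := by rw [show √x ^ 4 = (√x ^ 2) ^ 2 by ring, this]
    rw [hy, this]; ring
  rw [e]
  by_cases h : y ≤ ε
  · have : 0 ≤ y ^ 4 / ε ^ 3 := by positivity
    linarith
  · push Not at h
    have : y ≤ y ^ 4 / ε ^ 3 := by
      rw [le_div_iff₀ (by positivity)]
      have := pow_le_pow_left₀ hε.le h.le 3
      nlinarith
    linarith

theorem wtime (H : Fam n p M T g us) {S t0 ε : ℝ} (hS : 0 < S) (ht0 : 0 < t0) (hε : 0 < ε) :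
    ∃ B, 0 ≤ B ∧ ∀ᶠ k in atTop, ∀ i : ℕ, i * hk k ≤ S → ∀ t ∈ Icc t0 T, ∀ t' ∈ Icc t T,
      |Wd n p (hk k) (us k) i t' - Wd n p (hk k) (us k) i t| ≤ ε + B * (t' - t) := by
  obtain ⟨W, lam, C0, hW, hlam, hC0, hb⟩ := H.bds (S := S + 2) (t0 := t0) (by linarith) ht0
  obtain ⟨K, hK, hHo⟩ := H.hold (S := S + 2) (t0 := t0) (by linarith) ht0
  have hM := H.hM
  set A := K ^ 4 / ε ^ 3 + 2 * W with hA
  have hA0 : 0 ≤ A := by positivity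
  refine ⟨M ^ p * (A * (3 * n + 4 * (S+2))) + C0, by positivity, ?_⟩
  filter_upwards [hb, hHo] with k hb hHo i hi t ht t' ht'
  have D := H.sol k
  have hh := hk_pos k
  have hR := hk_R k
  have hreg : ∀ l : ℕ, l ≤ i + (k+1) → l * hk k ≤ S + 2 := by
    intro l hl
    have : (l:ℝ) ≤ i + ((k+1:ℕ):ℝ) := by exact_mod_cast hl
    have := mul_le_mul_of_nonneg_right this hh.le
    linarith
  have hSS : ((i:ℝ) + ((k+1:ℕ):ℝ) + 1) * hk k ≤ S + 2 := by
    have := hk_le k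
    linarith
  have hsub : Icc t t' ⊆ Icc t0 T := by
    intro s hs; exact ⟨by linarith [hs.1, ht.1], by linarith [hs.2, ht'.2]⟩
  have hsub0 : Icc t t' ⊆ Icc 0 T := by
    intro s hs; exact ⟨by linarith [hs.1, ht.1], by linarith [hs.2, ht'.2]⟩
  have hder : ∀ l, ∀ s ∈ Ioo t t', HasDerivAt (Wd n p (hk k) (us k) l)
      (us k l s ^ p * Lop n (hk k) (fun j => Wd n p (hk k) (us k) j s) l +
      p * Wd n p (hk k) (us k) l s ^ 2 / us k l s) s := fun l s hs =>
    D.derw l ⟨by linarith [hs.1, ht.1], by linarith [hs.2, ht'.2]⟩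
  have hq : ∀ l : ℕ, l ≤ i + (k+1) → |(l:ℝ) * hk k - i * hk k| ≤ 1 →
      |Wd n p (hk k) (us k) l t - Wd n p (hk k) (us k) i t| ≤ ε + A * (l * hk k - i * hk k) ^ 2 := by
    intro l hl hl1
    have e1 : ((l:ℝ) - i) * hk k = l * hk k - i * hk k := by ring
    have key : |Wd n p (hk k) (us k) l t - Wd n p (hk k) (us k) i t| ≤
        K * √|(l:ℝ) * hk k - i * hk k| := by
      rcases le_total i l with hil | hil
      · have := hHo l i hil hl (hreg l hl) t ht
        rwa [e1, ← abs_of_nonneg (a := (l:ℝ) * hk k - i * hk k)] at this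
        rw [← e1]
        have : (i:ℝ) ≤ l := by exact_mod_cast hil
        exact mul_nonneg (by linarith) hh.le
      · have hli : i ≤ l + (k+1) := by
          have h1 : (i:ℝ) * hk k - l * hk k ≤ ((k+1:ℕ):ℝ) * hk k := by
            rw [hR]; linarith [(abs_le.1 hl1).1]
          have h2 : (i:ℝ) * hk k ≤ ((l + (k+1):ℕ):ℝ) * hk k := by
            push_cast at h1 ⊢; linarith
          exact_mod_cast le_of_mul_le_mul_right h2 hh
        have := hHo i l hil hli (by linarith) t ht
        have e2 : ((i:ℝ) - l) * hk k = -(l * hk k - i * hk k) := by ring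
        rw [abs_sub_comm, e2, ← abs_of_nonpos (a := (l:ℝ) * hk k - i * hk k)] at this
        · exact this
        · have h3 : (l:ℝ) ≤ i := by exact_mod_cast hil
          have := mul_le_mul_of_nonneg_right h3 hh.le
          linarith
    have h2 := sqrt_quad (x := |(l:ℝ) * hk k - i * hk k|) hε hK (abs_nonneg _)
    rw [sq_abs] at h2
    have h3 : 0 ≤ 2 * W * ((l:ℝ) * hk k - i * hk k) ^ 2 := by positivity
    rw [hA, add_mul]
    linarith
  have hii := hb i (by linarith) t ht
  have up := time_barrier n H.hn hh (hk_le k) (fun l s => Wd n p (hk k) (us k) l s)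
    (fun l s => us k l s ^ p) (fun l s => p * Wd n p (hk k) (us k) l s ^ 2 / us k l s) i (k+1) hR
    (by omega) t t' W C0 (M ^ p) (S+2) ε A (Wd n p (hk k) (us k) i t) hSS
    (fun l _ => (D.contw l).mono hsub0) (fun l _ s hs => hder l s hs)
    (fun l hl s hs => (abs_le.1 (hb l (hreg l hl) s (hsub hs)).1).2)
    (fun l hl s hs => ⟨hlam.le.trans (hb l (hreg l hl) s (hsub hs)).2.1, (hb l (hreg l hl) s (hsub hs)).2.2.1⟩)
    (fun l hl s hs => (abs_le.1 (hb l (hreg l hl) s (hsub hs)).2.2.2).2)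
    (abs_le.1 hii.1).1 hε.le (by
      have : 0 ≤ K ^ 4 / ε ^ 3 := by positivity
      linarith) hA0 hC0 (by positivity)
    (fun l hl h1 => by have := (abs_le.1 (hq l hl h1)).2; linarith) t' ⟨ht'.1, le_rfl⟩
  have dn := time_barrier n H.hn hh (hk_le k) (fun l s => -Wd n p (hk k) (us k) l s)
    (fun l s => us k l s ^ p) (fun l s => -(p * Wd n p (hk k) (us k) l s ^ 2 / us k l s)) i (k+1) hR
    (by omega) t t' W C0 (M ^ p) (S+2) ε A (-Wd n p (hk k) (us k) i t) hSS
    (fun l _ => ((D.contw l).mono hsub0).neg) (fun l _ s hs => by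
      refine (hder l s hs).neg.congr_deriv ?_
      have := Lop_smul n (hk k) (-1) (fun j => Wd n p (hk k) (us k) j s) l
      simp only [neg_one_mul] at this
      rw [this]; ring)
    (fun l hl s hs => by have := (abs_le.1 (hb l (hreg l hl) s (hsub hs)).1).1; linarith)
    (fun l hl s hs => ⟨hlam.le.trans (hb l (hreg l hl) s (hsub hs)).2.1, (hb l (hreg l hl) s (hsub hs)).2.2.1⟩)
    (fun l hl s hs => by have := (abs_le.1 (hb l (hreg l hl) s (hsub hs)).2.2.2).1; linarith)
    (by have := (abs_le.1 hii.1).2; linarith) hε.le (by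
      have : 0 ≤ K ^ 4 / ε ^ 3 := by positivity
      linarith) hA0 hC0 (by positivity)
    (fun l hl h1 => by have := (abs_le.1 (hq l hl h1)).1; linarith) t' ⟨ht'.1, le_rfl⟩
  rw [abs_le]; constructor <;> linarith

theorem utime0 (H : Fam n p M T g us) {S ε : ℝ} (hS : 0 < S) (hε : 0 < ε) :
    ∃ B, 0 ≤ B ∧ ∀ᶠ k in atTop, ∀ i : ℕ, i * hk k ≤ S → ∀ t ∈ Icc 0 T,
      |us k i t - us k i 0| ≤ ε + B * t := by
  have hM := H.hM
  have huc : UniformContinuousOn g (Icc 0 (S+2)) :=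
    isCompact_Icc.uniformContinuousOn_of_continuous H.gc.continuousOn
  obtain ⟨δ, hδ, hg⟩ := Metric.uniformContinuousOn_iff.1 huc ε hε
  set A := 2 * M + M / δ ^ 2 with hA
  have hA0 : 0 ≤ A := by positivity
  refine ⟨M ^ p * (A * (3 * n + 4 * (S+2))) + 0, by positivity, ?_⟩
  filter_upwards [ev_ge (S+2)] with k hkS i hi t ht
  have D := H.sol k
  have hh := hk_pos k
  have hR := hk_R k
  have hreg : ∀ l : ℕ, l ≤ i + (k+1) → l * hk k ≤ S + 2 := by
    intro l hl
    have : (l:ℝ) ≤ i + ((k+1:ℕ):ℝ) := by exact_mod_cast hl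
    have := mul_le_mul_of_nonneg_right this hh.le
    linarith
  have hSS : ((i:ℝ) + ((k+1:ℕ):ℝ) + 1) * hk k ≤ S + 2 := by
    have := hk_le k
    linarith
  have hsub0 : Icc 0 t ⊆ Icc 0 T := Icc_subset_Icc le_rfl ht.2
  have hder : ∀ l, ∀ s ∈ Ioo 0 t, HasDerivAt (us k l)
      (us k l s ^ p * Lop n (hk k) (fun j => us k j s) l) s := fun l s hs =>
    D.der l s ⟨hs.1, by linarith [hs.2, ht.2]⟩
  have hq : ∀ l : ℕ, l ≤ i + (k+1) → |us k l 0 - us k i 0| ≤ ε + A * (l * hk k - i * hk k) ^ 2 := by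
    intro l hl
    have hl2 := hreg l hl
    rw [H.ini k l (H.idx hkS hl2), H.ini k i (H.idx hkS (by linarith))]
    have m1 : (l:ℝ) * hk k ∈ Icc 0 (S+2) := ⟨by positivity, hl2⟩
    have m2 : (i:ℝ) * hk k ∈ Icc 0 (S+2) := ⟨by positivity, by linarith⟩
    have hA2 : 0 ≤ A * (l * hk k - i * hk k) ^ 2 := by positivity
    by_cases hc : dist ((l:ℝ) * hk k) (i * hk k) < δ
    · have := hg _ m1 _ m2 hc
      rw [Real.dist_eq] at this
      linarith
    · push Not at hc
      rw [Real.dist_eq] at hc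
      have h1 : |g (l * hk k) - g (i * hk k)| ≤ M := by
        have := H.gp (l * hk k); have := H.gp (i * hk k)
        have := H.gM (l * hk k); have := H.gM (i * hk k)
        rw [abs_le]; constructor <;> linarith
      have h2 : M ≤ M / δ ^ 2 * (l * hk k - i * hk k) ^ 2 := by
        have : δ ^ 2 ≤ ((l:ℝ) * hk k - i * hk k) ^ 2 := by
          rw [← sq_abs ((l:ℝ) * hk k - i * hk k)]; exact pow_le_pow_left₀ hδ.le hc 2
        rw [div_mul_eq_mul_div, le_div_iff₀ (by positivity)]
        gcongr
      have : 0 ≤ 2 * M * ((l:ℝ) * hk k - i * hk k) ^ 2 := by positivity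
      rw [hA, add_mul]; linarith
  have ha : ∀ l ≤ i + (k+1), ∀ s ∈ Icc 0 t, 0 ≤ us k l s ^ p ∧ us k l s ^ p ≤ M ^ p :=
    fun l _ s hs => ⟨rpow_nonneg (D.nonneg l (hsub0 hs)) _,
      rpow_le_rpow (D.nonneg l (hsub0 hs)) (D.le l s (hsub0 hs)) (by linarith [H.hp])⟩
  have up := time_barrier n H.hn hh (hk_le k) (us k)
    (fun l s => us k l s ^ p) (fun l s => 0) i (k+1) hR
    (by omega) 0 t M 0 (M ^ p) (S+2) ε A (us k i 0) hSS
    (fun l _ => (D.cont l).mono hsub0) (fun l _ s hs => (hder l s hs).congr_deriv (by ring))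
    (fun l hl s hs => D.le l s (hsub0 hs)) ha
    (fun l hl s hs => le_rfl)
    (by linarith [D.nonneg i (t := 0) ⟨le_rfl, H.hT.le⟩]) hε.le (by
      have : 0 ≤ M / δ ^ 2 := by positivity
      linarith) hA0 le_rfl (by positivity)
    (fun l hl h1 => by have := (abs_le.1 (hq l hl)).2; linarith) t ⟨ht.1, le_rfl⟩
  have dn := time_barrier n H.hn hh (hk_le k) (fun l s => -us k l s)
    (fun l s => us k l s ^ p) (fun l s => 0) i (k+1) hR
    (by omega) 0 t M 0 (M ^ p) (S+2) ε A (-us k i 0) hSS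
    (fun l _ => ((D.cont l).mono hsub0).neg) (fun l _ s hs => by
      refine (hder l s hs).neg.congr_deriv ?_
      have := Lop_smul n (hk k) (-1) (fun j => us k j s) l
      simp only [neg_one_mul] at this
      rw [this]; ring)
    (fun l hl s hs => by linarith [D.nonneg l (hsub0 hs)]) ha
    (fun l hl s hs => le_rfl)
    (by linarith [D.le i 0 ⟨le_rfl, H.hT.le⟩]) hε.le (by
      have : 0 ≤ M / δ ^ 2 := by positivity
      linarith) hA0 le_rfl (by positivity)
    (fun l hl h1 => by have := (abs_le.1 (hq l hl)).1; linarith) t ⟨ht.1, le_rfl⟩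
  rw [abs_le]; constructor <;> linarith

end Fam


/-- grid index -/
noncomputable def gi (s : ℝ) (k : ℕ) : ℕ := ⌊s * ((k:ℝ) + 1)⌋₊

theorem gi_le {s : ℝ} (hs : 0 ≤ s) (k : ℕ) : (gi s k : ℝ) * hk k ≤ s := by
  have h1 : (gi s k : ℝ) ≤ s * ((k:ℝ)+1) := Nat.floor_le (by positivity)
  unfold hk
  rw [mul_one_div, div_le_iff₀ (by positivity)]; exact h1

theorem gi_lt (s : ℝ) (k : ℕ) : s - hk k < (gi s k : ℝ) * hk k := by
  have h1 : s * ((k:ℝ)+1) < gi s k + 1 := Nat.lt_floor_add_one _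
  unfold hk
  rw [mul_one_div, lt_div_iff₀ (by positivity), sub_mul, div_mul_cancel₀ _ (by positivity)]
  linarith

theorem gi_mono {s s' : ℝ} (h : s ≤ s') (k : ℕ) : gi s k ≤ gi s' k := by
  unfold gi; gcongr

theorem gi_zero (k : ℕ) : gi 0 k = 0 := by simp [gi]

/-- nonprincipal ultrafilter -/
noncomputable def uf : Filter ℕ := (hyperfilter ℕ : Filter ℕ)

instance : uf.NeBot := by unfold uf; infer_instance

theorem uf_le : uf ≤ atTop := by
  unfold uf; rw [← Nat.cofinite_eq_atTop]; exact hyperfilter_le_cofinite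

theorem ev_uf {P : ℕ → Prop} (h : ∀ᶠ k in atTop, P k) : ∀ᶠ k in uf, P k := uf_le h

theorem gi_tendsto {s : ℝ} (hs : 0 ≤ s) : Tendsto (fun k => (gi s k : ℝ) * hk k) uf (nhds s) := by
  have h1 : Tendsto (fun k => s - hk k) uf (nhds s) := by
    simpa using (hk_tendsto.mono_left uf_le).const_sub s
  exact tendsto_of_tendsto_of_tendsto_of_le_of_le h1 tendsto_const_nhds
    (fun k => (gi_lt s k).le) (fun k => gi_le hs k)

/-- limit along the ultrafilter -/
noncomputable def ul (a : ℕ → ℝ) : ℝ := limUnder uf a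

theorem ul_spec {a : ℕ → ℝ} {B : ℝ} (h : ∀ᶠ k in atTop, |a k| ≤ B) :
    Tendsto a uf (nhds (ul a)) := by
  have h1 : ∀ᶠ k in uf, a k ∈ Icc (-B) B := (ev_uf h).mono (fun k hk => abs_le.mp hk)
  have h2 : ((hyperfilter ℕ).map a : Filter ℝ) ≤ Filter.principal (Icc (-B) B) := by
    rw [le_principal_iff]; exact h1
  obtain ⟨x, -, hx⟩ := isCompact_Icc.ultrafilter_le_nhds _ h2
  exact tendsto_nhds_limUnder ⟨x, hx⟩

/-- Discrete derivative passes to the limit. -/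
theorem disc_deriv (a : ℕ → ℕ → ℝ) (A B : ℝ → ℝ) (S0 S1 S2 : ℝ) (h1 : 0 ≤ S1)
    (h01 : S0 ≤ 0 ∨ S0 < S1)
    (hA : ∀ s ∈ Icc S1 S2, Tendsto (fun k => a k (gi s k)) uf (nhds (A s)))
    (hB : ∀ s ∈ Icc S1 S2, Tendsto (fun k => Dq (hk k) (a k) (gi s k)) uf (nhds (B s)))
    (hm : ∀ ε > 0, ∃ δ > 0, ∀ᶠ k in atTop, ∀ i j : ℕ, j ≤ i → S0 ≤ j * hk k → i * hk k ≤ S2 →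
      ((i:ℝ) - j) * hk k ≤ δ → |Dq (hk k) (a k) i - Dq (hk k) (a k) j| ≤ ε) :
    ∀ s ∈ Icc S1 S2, HasDerivWithinAt A (B s) (Icc S1 S2) s := by
  have key : ∀ ε > 0, ∃ δ > 0, ∀ s ∈ Icc S1 S2, ∀ s' ∈ Icc S1 S2, s ≤ s' → s' - s ≤ δ →
      |A s' - A s - B s * (s' - s)| ≤ ε * (s' - s) ∧ |A s' - A s - B s' * (s' - s)| ≤ ε * (s' - s) := by
    intro ε hε
    obtain ⟨δ, hδ, hd⟩ := hm (ε/2) (by linarith)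
    refine ⟨δ / 2, by linarith, ?_⟩
    intro s hs s' hs' hss hsd
    have hs0 : 0 ≤ s := h1.trans hs.1
    have hs0' : 0 ≤ s' := h1.trans hs'.1
    have hlow : ∀ᶠ k in uf, S0 ≤ (gi s k : ℝ) * hk k := by
      rcases h01 with h | h
      · exact Eventually.of_forall (fun k => h.trans (mul_nonneg (Nat.cast_nonneg _) (hk_pos k).le))
      · exact ((gi_tendsto hs0).eventually (lt_mem_nhds (h.trans_le hs.1))).mono (fun k hk => hk.le)
    have hsm : ∀ᶠ k in uf, hk k ≤ δ / 2 :=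
      ((hk_tendsto.mono_left uf_le).eventually (gt_mem_nhds (show (0:ℝ) < δ/2 by linarith))).mono
        (fun k hk => hk.le)
    have tl : Tendsto (fun k => ((gi s' k : ℝ) * hk k - (gi s k : ℝ) * hk k)) uf (nhds (s' - s)) :=
      (gi_tendsto hs0').sub (gi_tendsto hs0)
    -- telescoping
    have tel : ∀ᶠ k in uf, ∀ l : ℕ, gi s k ≤ l → l ≤ gi s' k →
        |a k (gi s' k) - a k (gi s k) -
          Dq (hk k) (a k) l * ((gi s' k : ℝ) * hk k - (gi s k : ℝ) * hk k)|
          ≤ ε * ((gi s' k : ℝ) * hk k - (gi s k : ℝ) * hk k) := by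
      filter_upwards [hlow, hsm, ev_uf hd] with k e1 e2 e3 l hl1 hl2
      have hp := hk_pos k
      have hg1 := gi_lt s k
      have hg2 := gi_le hs0' k
      have hlen : ((gi s' k : ℝ) - gi s k) * hk k ≤ δ := by linarith
      have near : ∀ m : ℕ, gi s k ≤ m → m ≤ gi s' k →
          |Dq (hk k) (a k) m - Dq (hk k) (a k) l| ≤ ε := by
        intro m hm1 hm2
        have b1 : |Dq (hk k) (a k) m - Dq (hk k) (a k) (gi s k)| ≤ ε/2 := by
          refine e3 m _ hm1 e1 ?_ ?_
          · exact le_trans (mul_le_mul_of_nonneg_right (by exact_mod_cast hm2) hp.le) (hg2.trans hs'.2)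
          · exact le_trans (mul_le_mul_of_nonneg_right (by
              have : (m:ℝ) ≤ gi s' k := by exact_mod_cast hm2
              linarith) hp.le) hlen
        have b2 : |Dq (hk k) (a k) l - Dq (hk k) (a k) (gi s k)| ≤ ε/2 := by
          refine e3 l _ hl1 e1 ?_ ?_
          · exact le_trans (mul_le_mul_of_nonneg_right (by exact_mod_cast hl2) hp.le) (hg2.trans hs'.2)
          · exact le_trans (mul_le_mul_of_nonneg_right (by
              have : (l:ℝ) ≤ gi s' k := by exact_mod_cast hl2
              linarith) hp.le) hlen
        rw [abs_le] at b1 b2 ⊢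
        constructor <;> linarith [b1.1, b1.2, b2.1, b2.2]
      have ind : ∀ m : ℕ, gi s k + m ≤ gi s' k →
          |a k (gi s k + m) - a k (gi s k) - Dq (hk k) (a k) l * ((m:ℝ) * hk k)|
            ≤ ε * ((m:ℝ) * hk k) := by
        intro m
        induction m with
        | zero => intro _; simp
        | succ m ih =>
          intro hm
          have ih := ih (by omega)
          have hq := near (gi s k + m) (by omega) (by omega)
          have e : a k (gi s k + (m+1)) = a k (gi s k + m) + hk k * Dq (hk k) (a k) (gi s k + m) := by
            unfold Dq; rw [mul_div_cancel₀ _ hp.ne']; rw [← add_assoc]; ring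
          rw [e]
          have : a k (gi s k + m) + hk k * Dq (hk k) (a k) (gi s k + m) - a k (gi s k) -
              Dq (hk k) (a k) l * (((m+1:ℕ):ℝ) * hk k)
              = (a k (gi s k + m) - a k (gi s k) - Dq (hk k) (a k) l * ((m:ℝ) * hk k)) +
                hk k * (Dq (hk k) (a k) (gi s k + m) - Dq (hk k) (a k) l) := by push_cast; ring
          rw [this]
          refine (abs_add_le _ _).trans ?_
          rw [abs_mul, abs_of_pos hp]
          have := mul_le_mul_of_nonneg_left hq hp.le
          push_cast
          linarith
      have hle := gi_mono hss k
      have := ind (gi s' k - gi s k) (by omega)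
      rw [Nat.add_sub_cancel' hle, Nat.cast_sub hle, sub_mul] at this
      exact this
    constructor
    · refine le_of_tendsto_of_tendsto (((hA s' hs').sub (hA s hs)).sub ((hB s hs).mul tl)).abs
        (tl.const_mul ε) ?_
      filter_upwards [tel] with k e
      exact e _ le_rfl (gi_mono hss k)
    · refine le_of_tendsto_of_tendsto (((hA s' hs').sub (hA s hs)).sub ((hB s' hs').mul tl)).abs
        (tl.const_mul ε) ?_
      filter_upwards [tel] with k e
      exact e _ (gi_mono hss k) le_rfl
  intro s hs
  rw [hasDerivWithinAt_iff_isLittleO, Asymptotics.isLittleO_iff]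
  intro ε hε
  obtain ⟨δ, hδ, hd⟩ := key ε hε
  have hb : Metric.closedBall s δ ∩ Icc S1 S2 ∈ nhdsWithin s (Icc S1 S2) :=
    inter_mem (mem_nhdsWithin_of_mem_nhds (Metric.closedBall_mem_nhds s hδ)) self_mem_nhdsWithin
  filter_upwards [hb] with s' hs'
  have hdist := hs'.1
  rw [Metric.mem_closedBall, Real.dist_eq] at hdist
  rw [norm_eq_abs, norm_eq_abs, smul_eq_mul]
  rcases le_total s s' with h | h
  · rw [abs_of_nonneg (sub_nonneg.mpr h)] at hdist ⊢
    have := (hd s hs s' hs'.2 h hdist).1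
    rwa [mul_comm (s' - s)]
  · rw [abs_of_nonpos (sub_nonpos.mpr h)] at hdist ⊢
    have := (hd s' hs'.2 s hs h (by linarith)).2
    rw [show A s' - A s - (s' - s) * B s = -(A s - A s' - B s * (s - s')) by ring, abs_neg]
    linarith

/-- Moduli pass to the limit. -/
theorem disc_cont (a : ℕ → ℕ → ℝ) (A : ℝ → ℝ) (S2 : ℝ)
    (hA : ∀ s ∈ Icc 0 S2, Tendsto (fun k => a k (gi s k)) uf (nhds (A s)))
    (hm : ∀ ε > 0, ∃ δ > 0, ∀ᶠ k in atTop, ∀ i j : ℕ, j ≤ i → i * hk k ≤ S2 →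
      ((i:ℝ) - j) * hk k ≤ δ → |a k i - a k j| ≤ ε) : ContinuousOn A (Icc 0 S2) := by
  have key : ∀ ε > 0, ∃ δ > 0, ∀ s ∈ Icc 0 S2, ∀ s' ∈ Icc 0 S2, s ≤ s' → s' - s ≤ δ →
      |A s' - A s| ≤ ε := by
    intro ε hε
    obtain ⟨δ, hδ, hd⟩ := hm ε hε
    refine ⟨δ / 2, by linarith, ?_⟩
    intro s hs s' hs' hss hsd
    refine le_of_tendsto ((hA s' hs').sub (hA s hs)).abs ?_
    have hsm : ∀ᶠ k in uf, hk k ≤ δ / 2 :=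
      ((hk_tendsto.mono_left uf_le).eventually (gt_mem_nhds (show (0:ℝ) < δ/2 by linarith))).mono
        (fun k hk => hk.le)
    filter_upwards [hsm, ev_uf hd] with k e2 e3
    have hg1 := gi_lt s k
    have hg2 := gi_le hs'.1 k
    exact e3 _ _ (gi_mono hss k) (hg2.trans hs'.2) (by linarith)
  rw [Metric.continuousOn_iff]
  intro s hs ε hε
  obtain ⟨δ, hδ, hd⟩ := key (ε/2) (by linarith)
  refine ⟨δ, hδ, fun s' hs' hdist => ?_⟩
  rw [Real.dist_eq] at hdist ⊢
  refine lt_of_le_of_lt ?_ (show ε/2 < ε by linarith)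
  rcases le_total s s' with h | h
  · exact hd s hs s' hs' h (by linarith [le_abs_self (s' - s)])
  · rw [abs_sub_comm]; exact hd s' hs' s hs h (by linarith [neg_abs_le (s' - s)])


namespace Fam
variable {n : ℕ} {p M T : ℝ} {g : ℝ → ℝ} {us : ℕ → ℕ → ℝ → ℝ}

theorem qbd (H : Fam n p M T g us) {S t0 : ℝ} (hS : 0 < S) (ht0 : 0 < t0) : ∃ Q, 0 ≤ Q ∧
    ∀ᶠ k in atTop, ∀ i : ℕ, i * hk k ≤ S → ∀ t ∈ Icc t0 T,
      |Dq (hk k) (fun j => us k j t) i| ≤ Q := by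
  obtain ⟨lam, hlam, hl⟩ := H.low (S := S) hS
  refine ⟨lam ^ (1-p) / t0, by positivity, ?_⟩
  filter_upwards [hl, ev_ge S] with k h1 h2 i hi t ht
  have a1 := (H.sol k).q_bd hlam ht0 (H.idx h2 hi) ht.1 ht.2 (h1 i hi t ⟨by linarith [ht.1], ht.2⟩)
  have a2 := (H.sol k).q_nonpos i (t := t) ⟨by linarith [ht.1], ht.2⟩
  rw [abs_of_nonpos a2]; linarith

theorem ulip (H : Fam n p M T g us) {S t0 : ℝ} (hS : 0 < S) (ht0 : 0 < t0) : ∃ Q, 0 ≤ Q ∧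
    ∀ᶠ k in atTop, ∀ i j : ℕ, j ≤ i → i * hk k ≤ S → ∀ t ∈ Icc t0 T,
      |us k i t - us k j t| ≤ Q * (((i:ℝ) - j) * hk k) := by
  obtain ⟨Q, hQ, hq⟩ := H.qbd hS ht0
  refine ⟨Q, hQ, ?_⟩
  filter_upwards [hq] with k h1 i j hji
  induction i, hji using Nat.le_induction with
  | base => intro _ t _; simp
  | succ i hji ih =>
    intro hi t ht
    have hp := hk_pos k
    have hi' : (i:ℝ) * hk k ≤ S := by push_cast at hi; linarith
    have a := ih hi' t ht
    have b := h1 i hi' t ht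
    have e : us k (i+1) t = us k i t + hk k * Dq (hk k) (fun j => us k j t) i := by
      unfold Dq; rw [mul_div_cancel₀ _ hp.ne']; ring
    rw [e, show us k i t + hk k * Dq (hk k) (fun j => us k j t) i - us k j t
      = (us k i t - us k j t) + hk k * Dq (hk k) (fun j => us k j t) i by ring]
    refine (abs_add_le _ _).trans ?_
    rw [abs_mul, abs_of_pos hp]
    have := mul_le_mul_of_nonneg_left b hp.le
    push_cast; linarith

theorem Lop_Wd (H : Fam n p M T g us) {k i : ℕ} {t : ℝ} (h : 0 < us k i t) :
    Lop n (hk k) (fun j => us k j t) i = Wd n p (hk k) (us k) i t / us k i t ^ p := by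
  unfold Wd; rw [mul_div_cancel_left₀]; exact (rpow_pos_of_pos h p).ne'

theorem fbd (H : Fam n p M T g us) {S t0 : ℝ} (hS : 0 < S) (ht0 : 0 < t0) : ∃ F, 0 ≤ F ∧
    ∀ᶠ k in atTop, ∀ i : ℕ, i * hk k ≤ S → ∀ t ∈ Icc t0 T,
      |Lop n (hk k) (fun j => us k j t) i| ≤ F := by
  obtain ⟨lam, hlam, hl⟩ := H.low (S := S) hS
  obtain ⟨W, hW, hw⟩ := H.wbd hS ht0
  refine ⟨W / lam ^ p, by positivity, ?_⟩
  filter_upwards [hl, hw] with k h1 h2 i hi t ht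
  have a1 := h1 i hi t ⟨by linarith [ht.1], ht.2⟩
  have hp := H.hp
  rw [H.Lop_Wd (hlam.trans_le a1), abs_div, abs_of_pos (rpow_pos_of_pos (hlam.trans_le a1) p)]
  have a2 : lam ^ p ≤ us k i t ^ p := rpow_le_rpow hlam.le a1 (by linarith)
  have := h2 i hi t ht
  gcongr

theorem quot_aux {a b α β L A W d e : ℝ} (hL : 0 < L) (h1 : L ≤ α) (h2 : L ≤ β)
    (hβ : β ≤ A) (hb : |b| ≤ W) (h3 : |a - b| ≤ d) (h4 : |α - β| ≤ e) :
    |a / α - b / β| ≤ (d * A + W * e) / (L * L) := by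
  have hα : 0 < α := hL.trans_le h1
  have hβ' : 0 < β := hL.trans_le h2
  have : a / α - b / β = ((a - b) * β - b * (α - β)) / (α * β) := by field_simp; ring
  rw [this, abs_div, abs_of_pos (mul_pos hα hβ')]
  have hd : 0 ≤ d := (abs_nonneg _).trans h3
  have he : 0 ≤ e := (abs_nonneg _).trans h4
  have hW : 0 ≤ W := (abs_nonneg _).trans hb
  have n1 : |(a - b) * β - b * (α - β)| ≤ d * A + W * e := by
    refine (abs_sub _ _).trans ?_
    rw [abs_mul, abs_mul, abs_of_pos hβ']
    gcongr
  have n0 : 0 ≤ d * A + W * e := (abs_nonneg _).trans n1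
  gcongr

theorem powlip (H : Fam n p M T g us) {k i j : ℕ} {t : ℝ} (ht : t ∈ Icc 0 T) :
    |us k i t ^ p - us k j t ^ p| ≤ p * M ^ (p-1) * |us k i t - us k j t| := by
  have hp := H.hp
  rcases le_total (us k i t) (us k j t) with h | h
  · have := rpow_sub_le hp ((H.sol k).nonneg i ht) h ((H.sol k).le j t ht)
    have h5 := rpow_le_rpow ((H.sol k).nonneg i ht) h (show 0 ≤ p by linarith)
    rw [abs_of_nonpos (by linarith), abs_of_nonpos (by linarith)]
    linarith
  · have := rpow_sub_le hp ((H.sol k).nonneg j ht) h ((H.sol k).le i t ht)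
    have h5 := rpow_le_rpow ((H.sol k).nonneg j ht) h (show 0 ≤ p by linarith)
    rw [abs_of_nonneg (by linarith), abs_of_nonneg (by linarith)]
    linarith

theorem fmod (H : Fam n p M T g us) {S t0 ε : ℝ} (hS : 0 < S) (ht0 : 0 < t0) (hε : 0 < ε) :
    ∃ δ > 0, ∀ᶠ k in atTop, ∀ i j : ℕ, j ≤ i → i * hk k ≤ S → ((i:ℝ) - j) * hk k ≤ δ →
      ∀ t ∈ Icc t0 T, |Lop n (hk k) (fun j => us k j t) i - Lop n (hk k) (fun j => us k j t) j| ≤ ε := by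
  obtain ⟨lam, hlam, hl⟩ := H.low (S := S) hS
  obtain ⟨W, hW, hw⟩ := H.wbd hS ht0
  obtain ⟨K, hK, hh⟩ := H.hold hS ht0
  obtain ⟨Q, hQ, hq⟩ := H.ulip hS ht0
  have hp := H.hp
  have hM := H.hM
  obtain ⟨L, hL⟩ : ∃ y, y = lam ^ p := ⟨_, rfl⟩
  have hLp : 0 < L := by rw [hL]; positivity
  obtain ⟨A, hA⟩ : ∃ y, y = M ^ p := ⟨_, rfl⟩
  have hAp : 0 < A := by rw [hA]; positivity
  obtain ⟨P, hP⟩ : ∃ y, y = p * M ^ (p-1) * Q := ⟨_, rfl⟩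
  have hPp : 0 ≤ P := by rw [hP]; positivity
  obtain ⟨Y, hY⟩ : ∃ y, y = (K * A + W * P) / (L * L) + 1 := ⟨_, rfl⟩
  have hYp : 0 < Y := by rw [hY]; positivity
  refine ⟨min 1 ((ε / Y)^2), by positivity, ?_⟩
  filter_upwards [hl, hw, hh, hq] with k h1 h2 h3 h4 i j hji hi hd t ht
  have hkp := hk_pos k
  have ht0' : t ∈ Icc 0 T := ⟨by linarith [ht.1], ht.2⟩
  have hji' : (j:ℝ) ≤ i := by exact_mod_cast hji
  have hj : (j:ℝ) * hk k ≤ S := le_trans (mul_le_mul_of_nonneg_right hji' hkp.le) hi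
  have ui := h1 i hi t ht0'
  have uj := h1 j hj t ht0'
  obtain ⟨r, hr⟩ : ∃ y, y = ((i:ℝ) - j) * hk k := ⟨_, rfl⟩
  have hr0 : 0 ≤ r := by rw [hr]; exact mul_nonneg (by linarith) hkp.le
  rw [← hr] at hd
  have hr1 : r ≤ 1 := hd.trans (min_le_left _ _)
  have hij : i ≤ j + (k+1) := by
    have : ((i:ℝ) - j) * hk k ≤ ((k+1:ℕ):ℝ) * hk k := by rw [hk_R, ← hr]; exact hr1
    have := le_of_mul_le_mul_right this hkp
    have : (i:ℝ) ≤ ((j + (k+1) : ℕ):ℝ) := by push_cast at this ⊢; linarith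
    exact_mod_cast this
  have b1 := h3 i j hji hij hi t ht
  have b2 := h4 i j hji hi t ht
  rw [← hr] at b1 b2
  have b3 := H.powlip (k := k) (i := i) (j := j) ht0'
  have b4 : |us k i t ^ p - us k j t ^ p| ≤ P * r := by
    refine b3.trans ?_
    rw [hP, mul_assoc (p * M ^ (p-1))]
    exact mul_le_mul_of_nonneg_left b2 (by positivity)
  have hrs : r ≤ √r := le_sqrt_aux hr0 hr1
  rw [H.Lop_Wd (hlam.trans_le ui), H.Lop_Wd (hlam.trans_le uj)]
  refine (quot_aux hLp (hL ▸ rpow_le_rpow hlam.le ui (by linarith))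
    (hL ▸ rpow_le_rpow hlam.le uj (by linarith))
    (hA ▸ rpow_le_rpow ((H.sol k).nonneg j ht0') ((H.sol k).le j t ht0') (by linarith))
    (h2 j hj t ht) b1 b4).trans ?_
  have hsq : √r ≤ ε / Y := by
    rw [sqrt_le_left (by positivity)]; exact hd.trans (min_le_right _ _)
  have c1 : (K * √r * A + W * (P * r)) / (L * L) ≤ ((K * A + W * P) / (L * L)) * √r := by
    rw [div_mul_eq_mul_div]
    apply div_le_div_of_nonneg_right _ (by positivity)
    have := mul_le_mul_of_nonneg_left hrs (mul_nonneg hW hPp)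
    linarith
  refine c1.trans ?_
  have c2 : ((K * A + W * P) / (L * L)) * √r ≤ Y * (ε / Y) := by
    apply mul_le_mul _ hsq (sqrt_nonneg _) hYp.le
    rw [hY]; linarith
  rwa [mul_div_cancel₀ _ hYp.ne'] at c2

/-- near the origin, `q` is close to `f 0 / n` -/
theorem q_near {m h e : ℝ} (hm : 1 ≤ m) (v : ℕ → ℝ) (N : ℕ)
    (hf : ∀ l ≤ N, |Lop m h v l - Lop m h v 0| ≤ e) : ∀ j ≤ N, |Dq h v j - Lop m h v 0 / m| ≤ e := by
  intro j
  induction j with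
  | zero =>
    intro _
    have h1 := Lop_eq m h v 0
    have he : 0 ≤ e := (abs_nonneg _).trans (hf 0 (Nat.zero_le _))
    have : Dq h v 0 = Lop m h v 0 / m := by
      rw [h1]; field_simp; simp
    rw [this]; simpa using he
  | succ j ih =>
    intro hj
    have ih := ih (by omega)
    have h1 := Lop_eq m h v (j+1)
    have h2 := hf (j+1) hj
    rw [Nat.add_sub_cancel] at h1
    obtain ⟨a, ha⟩ : ∃ y, y = Lop m h v 0 / m := ⟨_, rfl⟩
    have ha2 : Lop m h v 0 = m * a := by rw [ha]; field_simp
    have he : 0 ≤ e := (abs_nonneg _).trans ih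
    rw [← ha] at ih ⊢
    rw [h1, ha2] at h2
    push_cast at h2
    obtain ⟨x, hx⟩ : ∃ y : ℝ, y = 2 * ((j:ℝ)+1) := ⟨_, rfl⟩
    have hx0 : 0 ≤ x := by rw [hx]; positivity
    rw [← hx] at h2
    rw [abs_le] at ih h2 ⊢
    have k1 := mul_le_mul_of_nonneg_left ih.1 hx0
    have k2 := mul_le_mul_of_nonneg_left ih.2 hx0
    have hme : e ≤ m * e := by nlinarith
    have hxm : 0 < x + m := by linarith
    constructor
    · have : (x + m) * (-e) ≤ (x+m) * (Dq h v (j+1) - a) := by linarith [h2.1]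
      exact le_of_mul_le_mul_left this hxm
    · have : (x+m) * (Dq h v (j+1) - a) ≤ (x + m) * e := by linarith [h2.2]
      exact le_of_mul_le_mul_left this hxm

theorem Dq_Dq (m : ℝ) {h : ℝ} (hh : 0 < h) (v : ℕ → ℝ) (j : ℕ) : Dq h (Dq h v) j =
    (Lop m h v (j+1) - m * Dq h v (j+1)) / (2 * (((j:ℝ)+1) * h)) := by
  have h1 := Lop_eq m h v (j+1)
  rw [Nat.add_sub_cancel] at h1
  push_cast at h1
  rw [h1]
  conv_lhs => rw [Dq]
  field_simp
  ring

theorem qmod (H : Fam n p M T g us) {S t0 ε : ℝ} (hS : 0 < S) (ht0 : 0 < t0) (hε : 0 < ε) :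
    ∃ δ > 0, ∀ᶠ k in atTop, ∀ i j : ℕ, j ≤ i → i * hk k ≤ S → ((i:ℝ) - j) * hk k ≤ δ →
      ∀ t ∈ Icc t0 T, |Dq (hk k) (fun j => us k j t) i - Dq (hk k) (fun j => us k j t) j| ≤ ε := by
  obtain ⟨d1, hd1, hf⟩ := H.fmod hS ht0 (show 0 < ε / 2 by linarith)
  obtain ⟨F, hF, hfb⟩ := H.fbd hS ht0
  obtain ⟨Q, hQ, hqb⟩ := H.qbd hS ht0
  have hn : (1:ℝ) ≤ n := by exact_mod_cast H.hn
  obtain ⟨Y, hY⟩ : ∃ y, y = (F + n * Q) / d1 + 1 := ⟨_, rfl⟩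
  have hYp : 0 < Y := by rw [hY]; positivity
  refine ⟨min (d1/2) (ε / Y), by positivity, ?_⟩
  filter_upwards [hf, hfb, hqb] with k h1 h2 h3 i j hji hi hd t ht
  have hkp := hk_pos k
  have hji' : (j:ℝ) ≤ i := by exact_mod_cast hji
  by_cases hc : (i:ℝ) * hk k ≤ d1
  · have hq := q_near hn (h := hk k) (fun j => us k j t) (e := ε/2) i (by
      intro l hl
      have hl' : (l:ℝ) * hk k ≤ i * hk k := mul_le_mul_of_nonneg_right (by exact_mod_cast hl) hkp.le
      exact h1 l 0 (Nat.zero_le _) (hl'.trans hi) (by simp; linarith) t ht)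
    have a1 := hq i le_rfl
    have a2 := hq j hji
    rw [abs_le] at a1 a2 ⊢
    constructor <;> linarith [a1.1, a1.2, a2.1, a2.2]
  · push Not at hc
    have hj : d1/2 ≤ (j:ℝ) * hk k := by
      have := hd.trans (min_le_left _ _); linarith
    have main : |Dq (hk k) (fun j => us k j t) i - Dq (hk k) (fun j => us k j t) j| ≤
        Y * (((i:ℝ) - j) * hk k) := by
      clear hd hc
      induction i, hji using Nat.le_induction with
      | base => simp
      | succ i hji ih =>
        have hi' : (i:ℝ) * hk k ≤ S := by push_cast at hi; linarith
        have hji2 : (j:ℝ) ≤ i := by exact_mod_cast hji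
        have ih := ih hi' hji2
        have e := Dq_Dq n hkp (fun j => us k j t) i
        obtain ⟨z, hz⟩ : ∃ z, z = Dq (hk k) (fun j => us k j t) := ⟨_, rfl⟩
        have b1 := h2 (i+1) hi t ht
        have b2 := h3 (i+1) hi t ht
        rw [← hz] at ih e b2 ⊢
        have e2 : z (i+1) = z i + hk k * Dq (hk k) z i := by
          unfold Dq; rw [mul_div_cancel₀ _ hkp.ne']; ring
        have hbb : |Dq (hk k) z i| ≤ Y := by
          rw [e, abs_div]
          have hs : d1 ≤ 2 * (((i:ℝ)+1) * hk k) := by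
            have := mul_le_mul_of_nonneg_right hji2 hkp.le
            linarith
          rw [abs_of_pos (hd1.trans_le hs)]
          have hnum : |Lop n (hk k) (fun j => us k j t) (i+1) - n * z (i+1)| ≤ F + n * Q := by
            refine (abs_sub _ _).trans ?_
            rw [abs_mul, abs_of_pos (show (0:ℝ) < n by linarith)]
            have := mul_le_mul_of_nonneg_left b2 (show (0:ℝ) ≤ n by linarith)
            linarith
          refine (div_le_div₀ (by positivity) hnum hd1 hs).trans ?_
          rw [hY]; linarith
        rw [e2, show z i + hk k * Dq (hk k) z i - z j = (z i - z j) + hk k * Dq (hk k) z i by ring]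
        refine (abs_add_le _ _).trans ?_
        rw [abs_mul, abs_of_pos hkp]
        have := mul_le_mul_of_nonneg_left hbb hkp.le
        push_cast; linarith
    refine main.trans ?_
    have := mul_le_mul_of_nonneg_left (hd.trans (min_le_right _ _)) hYp.le
    rwa [mul_div_cancel₀ _ hYp.ne'] at this

theorem bmod (H : Fam n p M T g us) {S0 S t0 ε : ℝ} (hS0 : 0 < S0) (hS : 0 < S) (ht0 : 0 < t0)
    (hε : 0 < ε) :
    ∃ δ > 0, ∀ᶠ k in atTop, ∀ i j : ℕ, j ≤ i → S0 ≤ j * hk k → i * hk k ≤ S → ((i:ℝ) - j) * hk k ≤ δ →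
      ∀ t ∈ Icc t0 T, |Dq (hk k) (Dq (hk k) (fun j => us k j t)) i
        - Dq (hk k) (Dq (hk k) (fun j => us k j t)) j| ≤ ε := by
  have hS1 : 0 < S + 1 := by linarith
  have hn : (1:ℝ) ≤ n := by exact_mod_cast H.hn
  obtain ⟨F, hF, hfb⟩ := H.fbd hS1 ht0
  obtain ⟨Q, hQ, hqb⟩ := H.qbd hS1 ht0
  obtain ⟨X, hX⟩ : ∃ y, y = F + n * Q := ⟨_, rfl⟩
  have hXp : 0 ≤ X := by rw [hX]; positivity
  obtain ⟨η, hη⟩ : ∃ y, y = ε * (2*S0*(2*S0)) / (2*(S+1) * 2 + X * 2 + 1) := ⟨_, rfl⟩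
  have hηp : 0 < η := by rw [hη]; positivity
  obtain ⟨d1, hd1, hf⟩ := H.fmod hS1 ht0 hηp
  obtain ⟨d2, hd2, hq⟩ := H.qmod hS1 ht0 (show 0 < η / n by positivity)
  refine ⟨min η (min d1 d2), by positivity, ?_⟩
  filter_upwards [hf, hfb, hq, hqb] with k h1 h2 h3 h4 i j hji hj hi hd t ht
  have hkp := hk_pos k
  have hk1 := hk_le k
  have hji' : (j:ℝ) ≤ i := by exact_mod_cast hji
  have hji2 : (j:ℝ) * hk k ≤ i * hk k := mul_le_mul_of_nonneg_right hji' hkp.le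
  rw [Dq_Dq n hkp, Dq_Dq n hkp]
  have i1 : ((i+1:ℕ):ℝ) * hk k ≤ S + 1 := by push_cast; linarith
  have j1 : ((j+1:ℕ):ℝ) * hk k ≤ S + 1 := by push_cast; linarith
  have hd' : (((i+1:ℕ):ℝ) - ((j+1:ℕ):ℝ)) * hk k = ((i:ℝ) - j) * hk k := by push_cast; ring
  have c1 := h1 (i+1) (j+1) (by omega) i1 (by
    rw [hd']; exact hd.trans ((min_le_right _ _).trans (min_le_left _ _))) t ht
  have c2 := h3 (i+1) (j+1) (by omega) i1 (by
    rw [hd']; exact hd.trans ((min_le_right _ _).trans (min_le_right _ _))) t ht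
  have c3 := h2 (j+1) j1 t ht
  have c4 := h4 (j+1) j1 t ht
  have hd1' := hd.trans (min_le_left _ _)
  generalize Lop n (hk k) (fun j => us k j t) (i+1) = f1 at *
  generalize Lop n (hk k) (fun j => us k j t) (j+1) = f2 at *
  generalize Dq (hk k) (fun j => us k j t) (i+1) = q1 at *
  generalize Dq (hk k) (fun j => us k j t) (j+1) = q2 at *
  have n0 : (0:ℝ) < n := by linarith
  have r1 : |(f1 - n * q1) - (f2 - n * q2)| ≤ 2 * η := by
    rw [show (f1 - n * q1) - (f2 - n * q2) = (f1 - f2) - n * (q1 - q2) by ring]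
    refine (abs_sub _ _).trans ?_
    rw [abs_mul, abs_of_pos n0]
    have := mul_le_mul_of_nonneg_left c2 n0.le
    rw [mul_div_cancel₀ _ n0.ne'] at this
    linarith
  have r2 : |f2 - n * q2| ≤ X := by
    refine (abs_sub _ _).trans ?_
    rw [abs_mul, abs_of_pos n0]
    have := mul_le_mul_of_nonneg_left c4 n0.le
    linarith
  have r3 : |2 * (((i:ℝ)+1) * hk k) - 2 * (((j:ℝ)+1) * hk k)| ≤ 2 * η := by
    rw [abs_of_nonneg (by linarith)]; linarith
  refine (quot_aux (L := 2 * S0) (A := 2 * (S+1)) (by linarith) (by linarith) (by linarith)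
    (by push_cast at j1; linarith) r2 r1 r3).trans ?_
  rw [div_le_iff₀ (by positivity)]
  have hD : 0 < 2*(S+1) * 2 + X * 2 + 1 := by positivity
  have : η * (2*(S+1) * 2 + X * 2 + 1) = ε * (2*S0*(2*S0)) := by
    rw [hη]; field_simp
  linarith
end Fam


noncomputable def UU (us : ℕ → ℕ → ℝ → ℝ) (s t : ℝ) : ℝ := ul (fun k => us k (gi s k) t)
noncomputable def QQ (us : ℕ → ℕ → ℝ → ℝ) (s t : ℝ) : ℝ :=
  ul (fun k => Dq (hk k) (fun j => us k j t) (gi s k))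
noncomputable def WW (n : ℕ) (p : ℝ) (us : ℕ → ℕ → ℝ → ℝ) (s t : ℝ) : ℝ :=
  ul (fun k => Wd n p (hk k) (us k) (gi s k) t)
noncomputable def FF (n : ℕ) (p : ℝ) (us : ℕ → ℕ → ℝ → ℝ) (s t : ℝ) : ℝ :=
  WW n p us s t / UU us s t ^ p

namespace Fam
variable {n : ℕ} {p M T : ℝ} {g : ℝ → ℝ} {us : ℕ → ℕ → ℝ → ℝ}

theorem tU (H : Fam n p M T g us) (s : ℝ) {t : ℝ} (ht : t ∈ Icc 0 T) :
    Tendsto (fun k => us k (gi s k) t) uf (nhds (UU us s t)) :=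
  ul_spec (B := M) (Eventually.of_forall (fun k => by
    rw [abs_of_nonneg ((H.sol k).nonneg _ ht)]; exact (H.sol k).le _ t ht))

theorem tQ (H : Fam n p M T g us) {s : ℝ} (hs : 0 ≤ s) {t : ℝ} (ht : t ∈ Ioc 0 T) :
    Tendsto (fun k => Dq (hk k) (fun j => us k j t) (gi s k)) uf (nhds (QQ us s t)) := by
  obtain ⟨Q, hQ, hq⟩ := H.qbd (show 0 < s + 1 by linarith) ht.1
  refine ul_spec (B := Q) ?_
  filter_upwards [hq] with k h1
  exact h1 _ (by linarith [gi_le hs k]) t ⟨le_rfl, ht.2⟩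

theorem tW (H : Fam n p M T g us) {s : ℝ} (hs : 0 ≤ s) {t : ℝ} (ht : t ∈ Ioc 0 T) :
    Tendsto (fun k => Wd n p (hk k) (us k) (gi s k) t) uf (nhds (WW n p us s t)) := by
  obtain ⟨Q, hQ, hq⟩ := H.wbd (show 0 < s + 1 by linarith) ht.1
  refine ul_spec (B := Q) ?_
  filter_upwards [hq] with k h1
  exact h1 _ (by linarith [gi_le hs k]) t ⟨le_rfl, ht.2⟩

theorem Upos (H : Fam n p M T g us) {s : ℝ} (hs : 0 ≤ s) {t : ℝ} (ht : t ∈ Icc 0 T) :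
    0 < UU us s t := by
  obtain ⟨lam, hlam, hl⟩ := H.low (S := s + 1) (by linarith)
  refine hlam.trans_le (ge_of_tendsto (H.tU s ht) ?_)
  filter_upwards [ev_uf hl] with k h1
  exact h1 _ (by linarith [gi_le hs k]) t ht

theorem tF (H : Fam n p M T g us) {s : ℝ} (hs : 0 ≤ s) {t : ℝ} (ht : t ∈ Ioc 0 T) :
    Tendsto (fun k => Lop n (hk k) (fun j => us k j t) (gi s k)) uf (nhds (FF n p us s t)) := by
  have ht' : t ∈ Icc 0 T := ⟨ht.1.le, ht.2⟩
  have hU := H.Upos hs ht'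
  have h1 := (H.tW hs ht).div ((H.tU s ht').rpow_const (p := p) (Or.inl hU.ne'))
    (rpow_pos_of_pos hU p).ne'
  refine h1.congr' ?_
  obtain ⟨lam, hlam, hl⟩ := H.low (S := s + 1) (by linarith)
  filter_upwards [ev_uf hl] with k h1
  rw [H.Lop_Wd (hlam.trans_le (h1 _ (by linarith [gi_le hs k]) t ht'))]; rfl

theorem U_le (H : Fam n p M T g us) {s : ℝ} {t : ℝ} (ht : t ∈ Icc 0 T) :
    UU us s t ≤ UU us 0 t := by
  refine le_of_tendsto_of_tendsto (H.tU s ht) (H.tU 0 ht) (Eventually.of_forall (fun k => ?_))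
  simp only [gi_zero]
  exact (H.sol k).antitone ht (Nat.zero_le _)

theorem U_zero (H : Fam n p M T g us) {s : ℝ} (hs : 0 ≤ s) : UU us s 0 = g s := by
  refine tendsto_nhds_unique (H.tU s ⟨le_rfl, H.hT.le⟩) ?_
  refine ((H.gc.tendsto s).comp (gi_tendsto hs)).congr' ?_
  filter_upwards [ev_uf (ev_ge s)] with k hk2
  exact (H.ini k _ (H.idx hk2 (gi_le hs k))).symm

theorem Ux (H : Fam n p M T g us) {s : ℝ} (hs : 0 ≤ s) {t : ℝ} (ht : t ∈ Ioc 0 T) :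
    HasDerivWithinAt (fun s => UU us s t) (QQ us s t) (Ici 0) s := by
  have := disc_deriv (fun k j => us k j t) (fun s => UU us s t) (fun s => QQ us s t) 0 0 (s+1)
    le_rfl (Or.inl le_rfl) (fun s _ => H.tU s ⟨ht.1.le, ht.2⟩) (fun s hs => H.tQ hs.1 ht) (by
      intro ε hε
      obtain ⟨δ, hδ, hd⟩ := H.qmod (show 0 < s + 1 by linarith) ht.1 hε
      refine ⟨δ, hδ, ?_⟩
      filter_upwards [hd] with k h i j hji _ hi hij
      exact h i j hji hi hij t ⟨le_rfl, ht.2⟩) s ⟨hs, by linarith⟩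
  refine this.mono_of_mem_nhdsWithin ?_
  have : Iic (s+1) ∈ nhdsWithin s (Ici 0) := mem_nhdsWithin_of_mem_nhds (Iic_mem_nhds (by linarith))
  filter_upwards [this, self_mem_nhdsWithin] with x h1 h2
  exact ⟨h2, h1⟩

theorem contIci {A : ℝ → ℝ} (h : ∀ S > 0, ContinuousOn A (Icc 0 S)) : ContinuousOn A (Ici 0) := by
  intro s hs
  have hs0 : (0:ℝ) ≤ s := hs
  refine (h (s+1) (by linarith) s ⟨hs, by linarith⟩).mono_of_mem_nhdsWithin ?_
  have : Iic (s+1) ∈ nhdsWithin s (Ici 0) := mem_nhdsWithin_of_mem_nhds (Iic_mem_nhds (by linarith))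
  filter_upwards [this, self_mem_nhdsWithin] with x h1 h2
  exact ⟨h2, h1⟩

theorem Qc (H : Fam n p M T g us) {t : ℝ} (ht : t ∈ Ioc 0 T) :
    ContinuousOn (fun s => QQ us s t) (Ici 0) := by
  refine contIci (fun S hS => disc_cont _ _ S (fun s hs => H.tQ hs.1 ht) ?_)
  intro ε hε
  obtain ⟨δ, hδ, hd⟩ := H.qmod hS ht.1 hε
  refine ⟨δ, hδ, ?_⟩
  filter_upwards [hd] with k h i j hji hi hij
  exact h i j hji hi hij t ⟨le_rfl, ht.2⟩

theorem Fc (H : Fam n p M T g us) {t : ℝ} (ht : t ∈ Ioc 0 T) :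
    ContinuousOn (fun s => FF n p us s t) (Ici 0) := by
  refine contIci (fun S hS => disc_cont _ _ S (fun s hs => H.tF hs.1 ht) ?_)
  intro ε hε
  obtain ⟨δ, hδ, hd⟩ := H.fmod hS ht.1 hε
  refine ⟨δ, hδ, ?_⟩
  filter_upwards [hd] with k h i j hji hi hij
  exact h i j hji hi hij t ⟨le_rfl, ht.2⟩

theorem Q0 (H : Fam n p M T g us) {t : ℝ} (ht : t ∈ Ioc 0 T) :
    FF n p us 0 t = n * QQ us 0 t := by
  refine tendsto_nhds_unique (H.tF le_rfl ht) (((H.tQ le_rfl ht).const_mul (n:ℝ)).congr (fun k => ?_))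
  rw [gi_zero, Lop_eq]; simp

theorem tsucc {a : ℕ → ℕ → ℝ} {s A : ℝ} (hs : 0 ≤ s) (h : Tendsto (fun k => a k (gi s k)) uf (nhds A))
    (hm : ∀ ε > 0, ∃ δ > 0, ∀ᶠ k in atTop, ∀ i j : ℕ, j ≤ i → i * hk k ≤ s + 1 →
      ((i:ℝ) - j) * hk k ≤ δ → |a k i - a k j| ≤ ε) :
    Tendsto (fun k => a k (gi s k + 1)) uf (nhds A) := by
  have : Tendsto (fun k => a k (gi s k + 1) - a k (gi s k)) uf (nhds 0) := by
    rw [Metric.tendsto_nhds]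
    intro ε hε
    obtain ⟨δ, hδ, hd⟩ := hm (ε/2) (by linarith)
    filter_upwards [ev_uf hd, (hk_tendsto.mono_left uf_le).eventually (gt_mem_nhds hδ)] with k h1 h2
    have := h1 (gi s k + 1) (gi s k) (by omega)
      (by push_cast; linarith [gi_le hs k, hk_le k]) (by push_cast; linarith)
    rw [Real.dist_eq, sub_zero]; linarith
  simpa using this.add h

theorem Qx (H : Fam n p M T g us) {s : ℝ} (hs : 0 < s) {t : ℝ} (ht : t ∈ Ioc 0 T) :
    HasDerivAt (fun s => QQ us s t) ((FF n p us s t - n * QQ us s t) / (2 * s)) s := by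
  have := disc_deriv (fun k => Dq (hk k) (fun j => us k j t)) (fun s => QQ us s t)
    (fun s => (FF n p us s t - n * QQ us s t) / (2 * s)) (s/4) (s/2) (s+1)
    (by linarith) (Or.inr (by linarith)) (fun s' hs' => H.tQ (by linarith [hs'.1]) ht) ?_ (by
      intro ε hε
      obtain ⟨δ, hδ, hd⟩ := H.bmod (show 0 < s / 4 by linarith) (show 0 < s + 1 by linarith) ht.1 hε
      refine ⟨δ, hδ, ?_⟩
      filter_upwards [hd] with k h i j hji hj hi hij
      exact h i j hji hj hi hij t ⟨le_rfl, ht.2⟩) s ⟨by linarith, by linarith⟩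
  · exact this.hasDerivAt (Icc_mem_nhds (by linarith) (by linarith))
  · intro r hr
    have hr0 : 0 < r := by linarith [hr.1]
    have t1 : Tendsto (fun k => Lop n (hk k) (fun j => us k j t) (gi r k + 1)) uf
        (nhds (FF n p us r t)) := by
      refine tsucc (a := fun k i => Lop n (hk k) (fun j => us k j t) i) hr0.le (H.tF hr0.le ht) ?_
      intro ε hε
      obtain ⟨δ, hδ, hd⟩ := H.fmod (show 0 < r + 1 by linarith) ht.1 hε
      refine ⟨δ, hδ, ?_⟩
      filter_upwards [hd] with k h i j hji hi hij
      exact h i j hji hi hij t ⟨le_rfl, ht.2⟩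
    have t2 : Tendsto (fun k => Dq (hk k) (fun j => us k j t) (gi r k + 1)) uf
        (nhds (QQ us r t)) := by
      refine tsucc (a := fun k i => Dq (hk k) (fun j => us k j t) i) hr0.le (H.tQ hr0.le ht) ?_
      intro ε hε
      obtain ⟨δ, hδ, hd⟩ := H.qmod (show 0 < r + 1 by linarith) ht.1 hε
      refine ⟨δ, hδ, ?_⟩
      filter_upwards [hd] with k h i j hji hi hij
      exact h i j hji hi hij t ⟨le_rfl, ht.2⟩
    have t3 : Tendsto (fun k => 2 * (((gi r k : ℝ) + 1) * hk k)) uf (nhds (2 * r)) := by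
      have := ((gi_tendsto hr0.le).add (hk_tendsto.mono_left uf_le)).const_mul 2
      rw [add_zero] at this
      refine this.congr (fun k => by ring)
    refine ((t1.sub (t2.const_mul (n:ℝ))).div t3 (by positivity)).congr (fun k => ?_)
    rw [Dq_Dq n (hk_pos k)]; rfl

theorem Ut (H : Fam n p M T g us) {s : ℝ} (hs : 0 ≤ s) {t : ℝ} (ht : t ∈ Ioo 0 T) :
    HasDerivAt (fun t => UU us s t) (WW n p us s t) t := by
  have key : ∀ ε > 0, ∃ B, 0 ≤ B ∧ ∀ t1 ∈ Icc (t/2) T, ∀ t2 ∈ Icc (t/2) T, t1 ≤ t2 →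
      |UU us s t2 - UU us s t1 - WW n p us s t1 * (t2 - t1)| ≤ (ε + B * (t2 - t1)) * (t2 - t1) ∧
      |UU us s t2 - UU us s t1 - WW n p us s t2 * (t2 - t1)| ≤ (ε + B * (t2 - t1)) * (t2 - t1) := by
    intro ε hε
    obtain ⟨B, hB, hw⟩ := H.wtime (show 0 < s + 1 by linarith) (show 0 < t/2 by linarith [ht.1]) hε
    refine ⟨B, hB, ?_⟩
    intro t1 h1 t2 h2 h12
    have p1 : t1 ∈ Ioc 0 T := ⟨by linarith [h1.1, ht.1], h1.2⟩
    have p2 : t2 ∈ Ioc 0 T := ⟨by linarith [h2.1, ht.1], h2.2⟩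
    rcases h12.eq_or_lt with rfl | hlt
    · simp
    have hex : ∀ᶠ k in uf, ∃ ξ ∈ Ioo t1 t2, us k (gi s k) t2 - us k (gi s k) t1 =
        Wd n p (hk k) (us k) (gi s k) ξ * (t2 - t1) := by
      refine Eventually.of_forall (fun k => ?_)
      obtain ⟨ξ, hξ, e⟩ := exists_hasDerivAt_eq_slope (us k (gi s k))
        (fun t => Wd n p (hk k) (us k) (gi s k) t) hlt
        (((H.sol k).cont _).mono (Icc_subset_Icc p1.1.le p2.2))
        (fun x hx => (H.sol k).der _ x ⟨p1.1.trans hx.1, hx.2.trans_le p2.2⟩)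
      refine ⟨ξ, hξ, ?_⟩
      rw [e, div_mul_cancel₀ _ (by linarith)]
    have d0 : 0 < t2 - t1 := by linarith
    constructor
    · refine le_of_tendsto (((H.tU s ⟨p2.1.le, p2.2⟩).sub (H.tU s ⟨p1.1.le, p1.2⟩)).sub
        ((H.tW hs p1).mul_const _)).abs ?_
      filter_upwards [hex, ev_uf hw] with k ⟨ξ, hξ, e⟩ hw
      rw [e, ← sub_mul, abs_mul, abs_of_pos d0]
      apply mul_le_mul_of_nonneg_right _ d0.le
      refine (hw _ (by linarith [gi_le hs k]) t1 h1 ξ ⟨hξ.1.le, hξ.2.le.trans h2.2⟩).trans ?_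
      have := mul_le_mul_of_nonneg_left (show ξ - t1 ≤ t2 - t1 by linarith [hξ.2]) hB
      linarith
    · refine le_of_tendsto (((H.tU s ⟨p2.1.le, p2.2⟩).sub (H.tU s ⟨p1.1.le, p1.2⟩)).sub
        ((H.tW hs p2).mul_const _)).abs ?_
      filter_upwards [hex, ev_uf hw] with k ⟨ξ, hξ, e⟩ hw
      rw [e, ← sub_mul, abs_mul, abs_of_pos d0]
      apply mul_le_mul_of_nonneg_right _ d0.le
      rw [abs_sub_comm]
      refine (hw _ (by linarith [gi_le hs k]) ξ ⟨h1.1.trans hξ.1.le, hξ.2.le.trans h2.2⟩ t2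
        ⟨hξ.2.le, h2.2⟩).trans ?_
      have := mul_le_mul_of_nonneg_left (show t2 - ξ ≤ t2 - t1 by linarith [hξ.1]) hB
      linarith
  rw [hasDerivAt_iff_isLittleO, Asymptotics.isLittleO_iff]
  intro ε hε
  obtain ⟨B, hB, hk⟩ := key (ε/2) (by linarith)
  have hδ : 0 < ε / (2 * (B + 1)) := by positivity
  have htt : t ∈ Icc (t/2) T := ⟨by linarith [ht.1], ht.2.le⟩
  filter_upwards [Metric.closedBall_mem_nhds t hδ, Icc_mem_nhds (show t/2 < t by linarith [ht.1]) ht.2]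
    with t' h1 h2
  rw [Metric.mem_closedBall, Real.dist_eq] at h1
  have fin : ∀ x : ℝ, 0 ≤ x → x ≤ ε / (2 * (B+1)) → (ε/2 + B * x) * x ≤ ε * x := by
    intro x hx hx2
    apply mul_le_mul_of_nonneg_right _ hx
    rw [le_div_iff₀ (by positivity)] at hx2
    nlinarith
  rw [norm_eq_abs, norm_eq_abs, smul_eq_mul]
  rcases le_total t t' with h | h
  · rw [abs_of_nonneg (sub_nonneg.mpr h)] at h1 ⊢
    rw [mul_comm (t' - t)]
    exact (hk t htt t' h2 h).1.trans (fin _ (by linarith) h1)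
  · rw [abs_of_nonpos (sub_nonpos.mpr h)] at h1 ⊢
    rw [show UU us s t' - UU us s t - (t' - t) * WW n p us s t
      = -(UU us s t - UU us s t' - WW n p us s t * (t - t')) by ring, abs_neg]
    refine (hk t' h2 t htt h).2.trans ?_
    have := fin (t - t') (by linarith) (by linarith)
    linarith

theorem Uc0 (H : Fam n p M T g us) {S ε : ℝ} (hS : 0 < S) (hε : 0 < ε) : ∃ B, 0 ≤ B ∧
    ∀ s ∈ Icc 0 S, ∀ t ∈ Icc 0 T, |UU us s t - g s| ≤ ε + B * t := by
  obtain ⟨B, hB, h⟩ := H.utime0 hS hε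
  refine ⟨B, hB, fun s hs t ht => ?_⟩
  rw [← H.U_zero hs.1]
  refine le_of_tendsto ((H.tU s ht).sub (H.tU s ⟨le_rfl, H.hT.le⟩)).abs ?_
  filter_upwards [ev_uf h] with k h1
  exact h1 _ ((gi_le hs.1 k).trans hs.2) t ht

theorem Ulip (H : Fam n p M T g us) {S t0 : ℝ} (hS : 0 < S) (ht0 : 0 < t0) : ∃ C, 0 ≤ C ∧
    ∀ s ∈ Icc 0 S, ∀ s' ∈ Icc 0 S, ∀ t ∈ Icc t0 T, |UU us s t - UU us s' t| ≤ C * |s - s'| := by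
  obtain ⟨Q, hQ, hq⟩ := H.ulip hS ht0
  refine ⟨Q, hQ, ?_⟩
  have main : ∀ s ∈ Icc 0 S, ∀ s' ∈ Icc 0 S, s' ≤ s → ∀ t ∈ Icc t0 T,
      |UU us s t - UU us s' t| ≤ Q * (s - s') := by
    intro s hs s' hs' h t ht
    have ht' : t ∈ Icc 0 T := ⟨by linarith [ht.1], ht.2⟩
    refine le_of_tendsto_of_tendsto ((H.tU s ht').sub (H.tU s' ht')).abs
      (((gi_tendsto hs.1).sub (gi_tendsto hs'.1)).const_mul Q) ?_
    filter_upwards [ev_uf hq] with k h1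
    rw [← sub_mul]
    exact h1 _ _ (gi_mono h k) ((gi_le hs.1 k).trans hs.2) t ht
  intro s hs s' hs' t ht
  rcases le_total s' s with h | h
  · rw [abs_of_nonneg (sub_nonneg.mpr h)]; exact main s hs s' hs' h t ht
  · rw [abs_sub_comm, abs_sub_comm s s', abs_of_nonneg (sub_nonneg.mpr h)]; exact main s' hs' s hs h t ht

theorem Ucont (H : Fam n p M T g us) :
    ContinuousOn (fun z : ℝ × ℝ => UU us z.1 z.2) {z | 0 ≤ z.1 ∧ 0 ≤ z.2 ∧ z.2 < T} := by
  rintro ⟨s, t⟩ ⟨hs, ht, htT⟩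
  simp only at hs ht htT
  have hSn : ∀ᶠ z : ℝ × ℝ in nhds (s,t), z.1 < s + 1 :=
    continuous_fst.continuousAt.eventually (gt_mem_nhds (show s < s + 1 by linarith))
  have hS1 : 0 < s + 1 := by linarith
  rcases ht.eq_or_lt with rfl | ht0
  · -- at time zero
    rw [ContinuousWithinAt, Metric.tendsto_nhds]
    intro ε hε
    obtain ⟨B, hB, hb⟩ := H.Uc0 hS1 (show 0 < ε/4 by linarith)
    have e1 : ∀ᶠ z : ℝ × ℝ in nhds (s,0), |g z.1 - g s| < ε/4 := by
      have : ContinuousAt (fun z : ℝ × ℝ => |g z.1 - g s|) (s,0) := by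
        have := H.gc; fun_prop
      exact this.eventually (gt_mem_nhds (by simp; linarith))
    have e2 : ∀ᶠ z : ℝ × ℝ in nhds (s,0), B * z.2 < ε/4 := by
      have : ContinuousAt (fun z : ℝ × ℝ => B * z.2) (s,0) := by fun_prop
      exact this.eventually (gt_mem_nhds (by simp; linarith))
    filter_upwards [mem_nhdsWithin_of_mem_nhds e1, mem_nhdsWithin_of_mem_nhds e2,
      mem_nhdsWithin_of_mem_nhds hSn, self_mem_nhdsWithin] with z z1 z2 z3 z4
    have a := hb z.1 ⟨z4.1, le_of_lt z3⟩ z.2 ⟨z4.2.1, z4.2.2.le⟩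
    have z1' : |g z.1 - g s| < ε/4 := z1
    have z2' : B * z.2 < ε/4 := z2
    rw [Real.dist_eq, H.U_zero hs, show UU us z.1 z.2 - g s = (UU us z.1 z.2 - g z.1) + (g z.1 - g s)
      by ring]
    refine (abs_add_le _ _).trans_lt ?_
    linarith
  · rw [ContinuousWithinAt, Metric.tendsto_nhds]
    intro ε hε
    obtain ⟨C, hC, hc⟩ := H.Ulip hS1 (show 0 < t/2 by linarith)
    have e1 : ∀ᶠ z : ℝ × ℝ in nhds (s,t), C * |z.1 - s| < ε/2 := by
      have : ContinuousAt (fun z : ℝ × ℝ => C * |z.1 - s|) (s,t) := by fun_prop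
      exact this.eventually (gt_mem_nhds (by simp; linarith))
    have e2 : ∀ᶠ z : ℝ × ℝ in nhds (s,t), |UU us s z.2 - UU us s t| < ε/2 := by
      have c1 : ContinuousAt (fun t => UU us s t) t := (H.Ut hs ⟨ht0, htT⟩).continuousAt
      have : ContinuousAt (fun z : ℝ × ℝ => |UU us s z.2 - UU us s t|) (s,t) :=
        ((ContinuousAt.comp (f := fun z : ℝ × ℝ => z.2) (g := fun t => UU us s t) (x := (s,t)) c1
          continuous_snd.continuousAt).sub continuousAt_const).abs
      exact this.eventually (gt_mem_nhds (by simp; linarith))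
    have e3 : ∀ᶠ z : ℝ × ℝ in nhds (s,t), t/2 < z.2 :=
      continuous_snd.continuousAt.eventually (lt_mem_nhds (show t/2 < t by linarith))
    filter_upwards [mem_nhdsWithin_of_mem_nhds e1, mem_nhdsWithin_of_mem_nhds e2,
      mem_nhdsWithin_of_mem_nhds e3,
      mem_nhdsWithin_of_mem_nhds hSn, self_mem_nhdsWithin] with z z1 z2 z5 z3 z4
    have a := hc z.1 ⟨z4.1, le_of_lt z3⟩ s ⟨hs, by linarith⟩ z.2 ⟨le_of_lt z5, z4.2.2.le⟩
    have z1' : C * |z.1 - s| < ε/2 := z1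
    have z2' : |UU us s z.2 - UU us s t| < ε/2 := z2
    rw [Real.dist_eq, show UU us z.1 z.2 - UU us s t = (UU us z.1 z.2 - UU us s z.2) +
      (UU us s z.2 - UU us s t) by ring]
    refine (abs_add_le _ _).trans_lt ?_
    linarith
end Fam


theorem cadd_aux {X V : Type*} [TopologicalSpace X] [NormedAddCommGroup V] {f g : X → V}
    (hf : Continuous f) (hg : Continuous g) : Continuous (fun x => f x + g x) := hf.add hg

theorem csing_aux {E V : Type*} [NormedAddCommGroup E] [NormedAddCommGroup V] [NormedSpace ℝ V]
    (B : E → V) (hB : Continuous B) (hBn : ∀ y, ‖B y‖ = ‖y‖^2) (Z : E → ℝ) (hZ : Continuous Z)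
    (hZ0 : Z 0 = 0) (P : E → ℝ) (hP : ∀ x, P x = Z x / ‖x‖^2) : Continuous (fun x => P x • B x) := by
  rw [continuous_iff_continuousAt]
  intro x
  by_cases hx : x = 0
  · subst hx
    rw [ContinuousAt]
    have e0 : B 0 = 0 := by rw [← norm_eq_zero, hBn]; simp
    rw [e0, smul_zero]
    have hz : Tendsto (fun x => |Z x|) (nhds 0) (nhds 0) := by
      have := hZ.abs.tendsto 0
      simpa [hZ0] using this
    refine squeeze_zero_norm (fun y => ?_) hz
    rw [norm_smul, hBn, norm_eq_abs, hP, abs_div]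
    by_cases hy : y = 0
    · subst hy; simp
    · have : 0 < ‖y‖ := norm_pos_iff.mpr hy
      rw [abs_of_pos (show 0 < ‖y‖^2 by positivity)]
      apply le_of_eq; field_simp
  · have hx0 : 0 < ‖x‖ := norm_pos_iff.mpr hx
    have hPc : ContinuousAt P x := by
      rw [show P = fun x => Z x / ‖x‖^2 from funext hP]
      exact hZ.continuousAt.div (by fun_prop) (by positivity)
    exact hPc.smul hB.continuousAt

/-- the real inner product as a bilinear map -/
noncomputable def innR (n : ℕ) : EuclideanSpace ℝ (Fin n) →L[ℝ] (EuclideanSpace ℝ (Fin n) →L[ℝ] ℝ) :=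
  innerSL ℝ

theorem innR_apply {n : ℕ} (x y : EuclideanSpace ℝ (Fin n)) : innR n x y = inner ℝ x y := rfl
theorem innR_norm {n : ℕ} (x : EuclideanSpace ℝ (Fin n)) : ‖innR n x‖ = ‖x‖ := innerSL_apply_norm ℝ x

theorem hnorm {n : ℕ} (x : EuclideanSpace ℝ (Fin n)) :
    HasFDerivAt (fun y : EuclideanSpace ℝ (Fin n) => ‖y‖^2/2) (innR n x) x := by
  have h := (hasStrictFDerivAt_norm_sq x).hasFDerivAt
  have h2 := h.const_mul (1/2 : ℝ)
  refine (h2.congr_fderiv ?_).congr_of_eventuallyEq (Eventually.of_forall fun y => by ring)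
  ext y; simp [innR_apply]

set_option synthInstance.maxHeartbeats 400000 in
set_option maxHeartbeats 1000000 in
theorem radial_C2 (n : ℕ) (φ Q F : ℝ → ℝ)
    (hφ : ∀ s, 0 ≤ s → HasDerivWithinAt φ (Q s) (Ici 0) s)
    (hQc : ContinuousOn Q (Ici 0)) (hFc : ContinuousOn F (Ici 0))
    (hQ : ∀ s, 0 < s → HasDerivAt Q ((F s - n * Q s) / (2 * s)) s) (h0 : F 0 = n * Q 0) :
    ContDiff ℝ 2 (fun x : EuclideanSpace ℝ (Fin n) => φ (‖x‖^2/2)) ∧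
    ∀ x, lap (fun x : EuclideanSpace ℝ (Fin n) => φ (‖x‖^2/2)) x = F (‖x‖^2/2) := by
  have hs0 : ∀ x : EuclideanSpace ℝ (Fin n), 0 ≤ ‖x‖^2/2 := fun x => by positivity
  have hcn : Continuous (fun x : EuclideanSpace ℝ (Fin n) => ‖x‖^2/2) := by fun_prop
  have hQcc : Continuous (fun x : EuclideanSpace ℝ (Fin n) => Q (‖x‖^2/2)) :=
    hQc.comp_continuous hcn hs0
  have hFcc : Continuous (fun x : EuclideanSpace ℝ (Fin n) => F (‖x‖^2/2)) :=
    hFc.comp_continuous hcn hs0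
  have d1 : ∀ x : EuclideanSpace ℝ (Fin n), HasFDerivAt (fun x => φ (‖x‖^2/2))
      (Q (‖x‖^2/2) • innR n x) x := by
    intro x
    have := (hφ _ (hs0 x)).comp_hasFDerivWithinAt x ((hnorm x).hasFDerivWithinAt (s := univ))
      (fun y _ => hs0 y)
    exact hasFDerivWithinAt_univ.mp this
  obtain ⟨P, hP⟩ : ∃ P : ℝ → ℝ, P = fun s => (F s - n * Q s) / (2 * s) := ⟨_, rfl⟩
  obtain ⟨D2, hD2⟩ : ∃ D2 : EuclideanSpace ℝ (Fin n) → (EuclideanSpace ℝ (Fin n) →L[ℝ]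
      (EuclideanSpace ℝ (Fin n) →L[ℝ] ℝ)), D2 = fun x => Q (‖x‖^2/2) • (innR n) +
      (P (‖x‖^2/2)) • ((innR n x).smulRight (innR n x)) := ⟨_, rfl⟩
  have d2 : ∀ x : EuclideanSpace ℝ (Fin n), HasFDerivAt
      (fun x : EuclideanSpace ℝ (Fin n) => Q (‖x‖^2/2) • innR n x) (D2 x) x := by
    intro x
    by_cases hx : x = 0
    · subst hx
      rw [hD2, hasFDerivAt_iff_isLittleO, Asymptotics.isLittleO_iff]
      intro ε hε
      have : ∀ᶠ y in nhds (0 : EuclideanSpace ℝ (Fin n)), |Q (‖y‖^2/2) - Q (‖(0 : EuclideanSpace ℝ (Fin n))‖^2/2)| < ε := by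
        have h := Metric.tendsto_nhds.mp (hQcc.tendsto 0) ε hε
        simpa only [Real.dist_eq] using h
      filter_upwards [this] with y hy
      have e : Q (‖y‖^2/2) • innR n y - Q (‖(0 : EuclideanSpace ℝ (Fin n))‖^2/2) • innR n (0 : EuclideanSpace ℝ (Fin n)) -
          (Q (‖(0 : EuclideanSpace ℝ (Fin n))‖^2/2) • (innR n) +
          (P (‖(0 : EuclideanSpace ℝ (Fin n))‖^2/2)) • ((innR n 0).smulRight (innR n 0))) (y - 0)
          = (Q (‖y‖^2/2) - Q (‖(0 : EuclideanSpace ℝ (Fin n))‖^2/2)) • innR n y := by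
        ext z; simp [innR_apply]; ring
      rw [e, norm_smul, innR_norm, norm_eq_abs, sub_zero]
      exact mul_le_mul_of_nonneg_right hy.le (norm_nonneg _)
    · have hx0 : 0 < ‖x‖^2/2 := by have := norm_pos_iff.mpr hx; positivity
      have h1 := (hQ _ hx0).comp_hasFDerivAt x (hnorm x)
      have h2 := h1.smul ((innR n).hasFDerivAt (x := x))
      refine h2.congr_fderiv ?_
      rw [hD2, hP]
      ext y z
      simp [innR_apply, EuclideanSpace.inner_single_right]
      ring
  have c2 : Continuous D2 := by
    rw [hD2]
    have hq1 : Continuous (fun x : EuclideanSpace ℝ (Fin n) => Q (‖x‖^2/2) • innR n) :=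
      hQcc.smul continuous_const
    refine cadd_aux (V := EuclideanSpace ℝ (Fin n) →L[ℝ] EuclideanSpace ℝ (Fin n) →L[ℝ] ℝ) hq1 ?_
    refine csing_aux (V := EuclideanSpace ℝ (Fin n) →L[ℝ] EuclideanSpace ℝ (Fin n) →L[ℝ] ℝ)
      (fun x => (innR n x).smulRight (innR n x)) ?_ ?_ (fun x => F (‖x‖^2/2) - n * Q (‖x‖^2/2))
      (hFcc.sub (continuous_const.mul hQcc)) (by simp [h0]) (fun x => P (‖x‖^2/2)) ?_
    · fun_prop
    · intro y
      rw [ContinuousLinearMap.norm_smulRight_apply, innR_norm]; ring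
    · intro x; rw [hP]; simp only; congr 1; ring
  have hfd : fderiv ℝ (fun x : EuclideanSpace ℝ (Fin n) => φ (‖x‖^2/2)) =
      fun x => Q (‖x‖^2/2) • innR n x := funext fun x => (d1 x).fderiv
  have hfd2 : fderiv ℝ (fun x : EuclideanSpace ℝ (Fin n) => Q (‖x‖^2/2) • innR n x) = D2 :=
    funext fun x => (d2 x).fderiv
  constructor
  · rw [show (2 : WithTop ℕ∞) = 1 + 1 by norm_num, contDiff_succ_iff_fderiv]
    refine ⟨fun x => (d1 x).differentiableAt, by simp, ?_⟩
    rw [hfd, contDiff_one_iff_fderiv]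
    refine ⟨fun x => (d2 x).differentiableAt, ?_⟩
    rw [hfd2]; exact c2
  · intro x
    unfold lap
    rw [hfd]
    have e : ∀ i : Fin n, fderiv ℝ (fun y : EuclideanSpace ℝ (Fin n) =>
        (Q (‖y‖^2/2) • innR n y) (EuclideanSpace.single i 1)) x (EuclideanSpace.single i 1)
        = Q (‖x‖^2/2) + P (‖x‖^2/2) * (x i)^2 := by
      intro i
      have := ((d2 x).clm_apply (hasFDerivAt_const (EuclideanSpace.single i (1:ℝ)) x)).fderiv
      rw [this, hD2]
      simp [innR_apply, EuclideanSpace.inner_single_right]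
      ring_nf
      simp
    rw [Finset.sum_congr rfl (fun i _ => e i), Finset.sum_add_distrib, ← Finset.mul_sum,
      ← EuclideanSpace.real_norm_sq_eq]
    simp only [Finset.sum_const, Finset.card_univ, Fintype.card_fin, nsmul_eq_mul]
    by_cases hx : x = 0
    · subst hx; simp [h0]
    · have hx0 : 0 < ‖x‖ := norm_pos_iff.mpr hx
      rw [hP]; simp only; field_simp; ring

theorem Fam.isSolOn {n : ℕ} {p M T : ℝ} {g : ℝ → ℝ} {us : ℕ → ℕ → ℝ → ℝ} (H : Fam n p M T g us)
    (u₀ : EuclideanSpace ℝ (Fin n) → ℝ) (hg : ∀ x, u₀ x = g (‖x‖^2/2)) :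
    IsSolOn n p u₀ (fun x t => UU us (‖x‖^2/2) t) T := by
  have hs0 : ∀ x : EuclideanSpace ℝ (Fin n), 0 ≤ ‖x‖^2/2 := fun x => by positivity
  have hr : ∀ t, 0 < t → t < T → _ := fun t h1 h2 =>
    radial_C2 n (fun s => UU us s t) (fun s => QQ us s t) (fun s => FF n p us s t)
      (fun s hs => H.Ux hs ⟨h1, h2.le⟩) (H.Qc ⟨h1, h2.le⟩) (H.Fc ⟨h1, h2.le⟩)
      (fun s hs => H.Qx hs ⟨h1, h2.le⟩) (H.Q0 ⟨h1, h2.le⟩)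
  refine ⟨?_, ?_, ?_, ?_, ?_⟩
  · refine H.Ucont.comp (f := fun z : EuclideanSpace ℝ (Fin n) × ℝ => (‖z.1‖^2/2, z.2))
      (by fun_prop) ?_
    rintro z ⟨h1, h2⟩
    exact ⟨hs0 _, h1, h2⟩
  · intro x; rw [hg]; exact H.U_zero (hs0 x)
  · intro x t h1 h2; exact H.Upos (hs0 x) ⟨h1.le, h2.le⟩
  · intro t h1 h2; exact (hr t h1 h2).1
  · intro x t h1 h2
    rw [(hr t h1 h2).2 x]
    refine (H.Ut (hs0 x) ⟨h1, h2⟩).congr_deriv ?_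
    have := rpow_pos_of_pos (H.Upos (hs0 x) (t := t) ⟨h1.le, h2.le⟩) p
    rw [FF, mul_div_cancel₀ _ this.ne']


theorem exists_Phi (p : ℝ) (hp : 1 ≤ p) : ∃ Φ : ℝ → ℝ, (∀ x, 0 < x → HasDerivAt Φ (x ^ (-p)) x) ∧
    ∀ c a, 0 < c → 0 < a → c ^ (1-p) * Real.log (c / a) ≤ Φ c - Φ a := by
  rcases hp.eq_or_lt with rfl | hp
  · refine ⟨Real.log, ?_, ?_⟩
    · intro x hx
      rw [rpow_neg_one]; exact hasDerivAt_log hx.ne'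
    · intro c a hc ha
      simp [log_div hc.ne' ha.ne']
  · have hq : 0 < p - 1 := by linarith
    refine ⟨fun x => x ^ (1-p) / (1-p), ?_, ?_⟩
    · intro x hx
      have := (hasDerivAt_rpow_const (p := 1-p) (Or.inl hx.ne')).div_const (1-p)
      refine this.congr_deriv ?_
      rw [mul_div_cancel_left₀ _ (by linarith)]; congr 1; ring
    · intro c a hc ha
      have h1 : a ^ (1-p) = c ^ (1-p) * exp ((p-1) * Real.log (c/a)) := by
        rw [rpow_def_of_pos ha, rpow_def_of_pos hc, ← exp_add, log_div hc.ne' ha.ne']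
        congr 1; ring
      have h2 := add_one_le_exp ((p-1) * Real.log (c/a))
      have hcp := rpow_pos_of_pos hc (1-p)
      simp only
      rw [h1]
      have h3 : c ^ (1-p) / (1-p) - c ^ (1-p) * exp ((p-1) * Real.log (c/a)) / (1-p) =
          c ^ (1-p) * ((exp ((p-1) * Real.log (c/a)) - 1) / (p-1)) := by
        have : (1-p) ≠ 0 := by linarith
        have : (p-1) ≠ 0 := by linarith
        rw [show 1 - p = -(p-1) by ring, div_neg, div_neg]; ring
      rw [h3]
      apply mul_le_mul_of_nonneg_left _ hcp.le
      rw [le_div_iff₀ hq]; linarith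

namespace DSol
variable {n N : ℕ} {p h M T : ℝ} {u : ℕ → ℝ → ℝ}

theorem ii (H : DSol n N p h M T u) (i : ℕ) {α β : ℝ} (hα : 0 ≤ α) (hαβ : α ≤ β) (hβ : β ≤ T) :
    IntervalIntegrable (u i) volume α β :=
  ((H.cont i).mono (Icc_subset_Icc hα hβ)).intervalIntegrable_of_Icc hαβ

theorem Lint (H : DSol n N p h M T u) {Φ : ℝ → ℝ} (hΦ : ∀ x, 0 < x → HasDerivAt Φ (x ^ (-p)) x)
    {i : ℕ} (hi : i ≤ N) {α β : ℝ} (hα : 0 ≤ α) (hαβ : α ≤ β) (hβ : β ≤ T) :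
    Lop n h (fun j => ∫ t in α..β, u j t) i = Φ (u i β) - Φ (u i α) := by
  have hsub : Icc α β ⊆ Icc 0 T := Icc_subset_Icc hα hβ
  have e1 : ∫ t in α..β, Lop n h (fun j => u j t) i = Φ (u i β) - Φ (u i α) := by
    have hc : ContinuousOn (fun t => Φ (u i t)) (Icc α β) := by
      intro t ht
      exact (hΦ _ (H.pos i hi t (hsub ht))).continuousAt.comp_continuousWithinAt
        ((H.cont i).mono hsub t ht)
    refine intervalIntegral.integral_eq_sub_of_hasDerivAt_of_le hαβ hc ?_
      (((H.contL n i).mono hsub).intervalIntegrable_of_Icc hαβ)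
    intro t ht
    have hu := H.pos i hi t (hsub ⟨ht.1.le, ht.2.le⟩)
    have := (hΦ _ hu).comp t (H.der i t ⟨hα.trans_lt ht.1, ht.2.trans_le hβ⟩)
    refine this.congr_deriv ?_
    rw [← mul_assoc, ← rpow_add hu]; simp
  rw [← e1]
  unfold Lop
  have i1 := H.ii (i+1) hα hαβ hβ
  have i2 := H.ii i hα hαβ hβ
  have i3 := H.ii (i-1) hα hαβ hβ
  rw [intervalIntegral.integral_div, intervalIntegral.integral_sub
    ((i1.sub i2).const_mul _) ((i2.sub i3).const_mul _),
    intervalIntegral.integral_const_mul, intervalIntegral.integral_const_mul,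
    intervalIntegral.integral_sub i1 i2, intervalIntegral.integral_sub i2 i3]

theorem Int_anti (H : DSol n N p h M T u) (i : ℕ) {α β : ℝ} (hα : 0 ≤ α) (hαβ : α ≤ β) (hβ : β ≤ T) :
    ∫ t in α..β, u (i+1) t ≤ ∫ t in α..β, u i t :=
  intervalIntegral.integral_mono_on hαβ (H.ii _ hα hαβ hβ) (H.ii _ hα hαβ hβ)
    (fun t ht => H.anti i ⟨hα.trans ht.1, ht.2.trans hβ⟩)

/-- the value at the origin decreases in time -/
theorem u0_anti (H : DSol n N p h M T u) : AntitoneOn (u 0) (Icc 0 T) := by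
  refine antitoneOn_of_deriv_nonpos (convex_Icc _ _) (H.cont 0) ?_ ?_
  · rw [interior_Icc]
    intro t ht; exact (H.der 0 t ht).differentiableAt.differentiableWithinAt
  · rw [interior_Icc]
    intro t ht
    rw [(H.der 0 t ht).deriv]
    have ht' : t ∈ Icc 0 T := ⟨ht.1.le, ht.2.le⟩
    refine mul_nonpos_of_nonneg_of_nonpos (rpow_nonneg (H.nonneg 0 ht') _) ?_
    rw [Lop_eq]
    have := H.q_nonpos 0 ht'
    have hn : (0:ℝ) ≤ n := Nat.cast_nonneg _
    simp
    exact mul_nonpos_of_nonneg_of_nonpos hn this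

/-- discrete gradient lower bound from a lower bound on `L` -/
theorem D_lower {h B : ℝ} (hh : 0 < h) {n : ℕ} (hn : 1 ≤ n) (hB : 0 ≤ B) (f : ℕ → ℝ) (J : ℕ)
    (hL : ∀ i < J, -B ≤ Lop n h f i) : ∀ i < J, -(B * h / n) ≤ f (i+1) - f i := by
  have hn' : (1:ℝ) ≤ n := by exact_mod_cast hn
  have hn0 : (0:ℝ) < n := by linarith
  intro i
  obtain ⟨X, hX⟩ : ∃ y, y = B * h / n := ⟨_, rfl⟩
  have hXn : B * h = n * X := by rw [hX]; field_simp
  have key : ∀ i < J, -(n * X) ≤ (2*i+n) * (f (i+1) - f i) - 2*i*(f i - f (i-1)) := by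
    intro i hi
    have := hL i hi
    unfold Lop at this
    rw [le_div_iff₀ hh] at this
    linarith
  rw [← hX]
  induction i with
  | zero =>
    intro hi
    have := key 0 hi
    simp only [Nat.cast_zero, mul_zero, zero_mul, zero_add, sub_zero] at this
    have : n * (-X) ≤ n * (f (0+1) - f 0) := by simpa using this
    exact le_of_mul_le_mul_left this hn0
  | succ i ih =>
    intro hi
    have a := ih (by omega)
    have b := key (i+1) hi
    rw [Nat.add_sub_cancel] at b
    have hx : (0:ℝ) ≤ 2 * ((i+1:ℕ):ℝ) := by positivity
    have c := mul_le_mul_of_nonneg_left a hx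
    have : (2 * ((i+1:ℕ):ℝ) + n) * (-X) ≤ (2 * ((i+1:ℕ):ℝ) + n) * (f (i+1+1) - f (i+1)) := by linarith
    exact le_of_mul_le_mul_left this (by linarith)

theorem exists_small (H : DSol n N p h M T u) {T1 a c : ℝ} (hT1 : 0 < T1) (hT : T1 ≤ T) {iR : ℕ}
    (hiR : 1 ≤ iR) (hN : 2 * iR ≤ N) (ha : 0 < a) (hc : 0 < c) (hcM : c ≤ M)
    (hini : ∀ i, iR ≤ i → i ≤ N → u i 0 ≤ a)
    (hΛ : Real.log (M / c) / n < Real.log (c / a) / 4) :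
    ∃ J < 2 * iR, u J T1 < c := by
  by_contra hcon
  push Not at hcon
  obtain ⟨Φ, hΦ1, hΦ2⟩ := exists_Phi p H.hp
  have hn' : (1:ℝ) ≤ n := by exact_mod_cast H.hn
  have hn0 : (0:ℝ) < n := by linarith
  obtain ⟨A, hA⟩ : ∃ y, y = c ^ (1-p) := ⟨_, rfl⟩
  have hAp : 0 < A := by rw [hA]; positivity
  have hh := H.hh
  have hM := H.hM
  obtain ⟨L1, hL1⟩ : ∃ y, y = Real.log (M / c) := ⟨_, rfl⟩
  obtain ⟨L2, hL2⟩ : ∃ y, y = Real.log (c / a) := ⟨_, rfl⟩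
  have hL1p : 0 ≤ L1 := by rw [hL1]; exact log_nonneg (by rw [le_div_iff₀ hc]; linarith)
  rw [← hL1, ← hL2] at hΛ
  have hL2p : 0 ≤ L2 := by have : 0 ≤ L1 / n := by positivity
                           linarith
  obtain ⟨f, hf⟩ : ∃ f : ℕ → ℝ, f = fun j => ∫ t in (0:ℝ)..T1, u j t := ⟨_, rfl⟩
  have hLf : ∀ i < 2 * iR, A * Real.log (c / u i 0) ≤ Lop n h f i := by
    intro i hi
    have hiN : i ≤ N := by omega
    have hb := hcon i hi
    have hu0 := H.pos i hiN 0 ⟨le_rfl, H.hT.le⟩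
    rw [hf, H.Lint hΦ1 hiN le_rfl hT1.le hT]
    have e1 := hΦ2 c (u i 0) hc hu0
    have e2 := hΦ2 (u i T1) c (by linarith) hc
    have e3 : 0 ≤ u i T1 ^ (1-p) * Real.log (u i T1 / c) := by
      refine mul_nonneg (rpow_nonneg (by linarith) _) (log_nonneg ?_)
      rw [le_div_iff₀ hc]; linarith
    rw [hA]; linarith
  have hDn : ∀ i, f (i+1) - f i ≤ 0 := by
    intro i; rw [hf]; simpa using H.Int_anti i le_rfl hT1.le hT
  have hDl := D_lower hh H.hn (show 0 ≤ A * L1 by positivity) f (2*iR) (by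
    intro i hi
    refine le_trans ?_ (hLf i hi)
    have hu0 := H.pos i (by omega) 0 ⟨le_rfl, H.hT.le⟩
    have hle := H.le i 0 ⟨le_rfl, H.hT.le⟩
    rw [neg_mul_eq_mul_neg]
    apply mul_le_mul_of_nonneg_left _ hAp.le
    rw [hL1, ← log_inv, inv_div]
    apply log_le_log (by positivity)
    gcongr)
  have step : ∀ m : ℕ, m ≤ iR → -(A * L1 * h / n) + m * (h * A * L2 / (4 * iR)) ≤
      f (iR - 1 + m + 1) - f (iR - 1 + m) := by
    intro m
    induction m with
    | zero => intro _; simpa using hDl (iR - 1) (by omega)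
    | succ m ih =>
      intro hm
      have ih := ih (by omega)
      have hi : iR + m < 2 * iR := by omega
      have e : iR - 1 + (m+1) = iR + m := by omega
      have e' : iR - 1 + m + 1 = iR + m := by omega
      rw [e]
      rw [e'] at ih
      have l1 := hLf (iR + m) hi
      have hu0 := H.pos (iR+m) (by omega) 0 ⟨le_rfl, H.hT.le⟩
      have l2 : L2 ≤ Real.log (c / u (iR+m) 0) := by
        rw [hL2]
        apply log_le_log (by positivity)
        have := hini (iR+m) (by omega) (by omega)
        gcongr
      have l3 := (mul_le_mul_of_nonneg_left l2 hAp.le).trans l1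
      unfold Lop at l3
      rw [le_div_iff₀ hh, show iR + m - 1 = iR - 1 + m by omega] at l3
      have d0 := hDn (iR + m)
      obtain ⟨D1, hD1⟩ : ∃ y, y = f (iR + m + 1) - f (iR + m) := ⟨_, rfl⟩
      obtain ⟨D0, hD0⟩ : ∃ y, y = f (iR + m) - f (iR - 1 + m) := ⟨_, rfl⟩
      rw [← hD1] at l3 d0 ⊢
      rw [← hD0] at l3 ih
      obtain ⟨x, hx⟩ : ∃ y : ℝ, y = ((iR + m : ℕ):ℝ) := ⟨_, rfl⟩
      rw [← hx] at l3
      have hx1 : x ≤ 2 * iR := by rw [hx]; exact_mod_cast hi.le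
      have hR1 : (1:ℝ) ≤ iR := by exact_mod_cast hiR
      have hx0 : 0 < x := by
        rw [hx]; push_cast; have : (0:ℝ) ≤ m := Nat.cast_nonneg _
        linarith
      have l4 : A * L2 * h ≤ 2 * x * (D1 - D0) := by
        have := mul_nonpos_of_nonneg_of_nonpos hn0.le d0
        linarith
      have l5 : h * A * L2 / (4 * iR) ≤ D1 - D0 := by
        rw [div_le_iff₀ (by positivity)]
        have hDD : 0 ≤ D1 - D0 := by
          by_contra hneg
          push Not at hneg
          have h6 := mul_neg_of_pos_of_neg (show 0 < 2 * x by linarith) hneg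
          have : 0 ≤ A * L2 * h := by positivity
          linarith
        have := mul_le_mul_of_nonneg_right hx1 hDD
        linarith
      push_cast
      linarith
  have fin := step iR le_rfl
  have hR1 : (1:ℝ) ≤ iR := by exact_mod_cast hiR
  have fin2 := hDn (iR - 1 + iR)
  have e : (iR:ℝ) * (h * A * L2 / (4 * iR)) = h * A * (L2 / 4) := by field_simp
  have e2 : A * L1 * h / n = h * A * (L1 / n) := by ring
  rw [e, e2] at fin
  have := mul_lt_mul_of_pos_left hΛ (mul_pos hh hAp)
  linarith

theorem decay (H : DSol n N p h M T u) {T1 a : ℝ} (hT1 : 0 < T1) (hT : T1 ≤ T) {iR : ℕ}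
    (hiR : 1 ≤ iR) (hN : 2 * iR ≤ N) (ha : 0 < a)
    (hini : ∀ i, iR ≤ i → i ≤ N → u i 0 ≤ a)
    (hΛ : Real.log (M / (u 0 T1 / 8)) / n < Real.log ((u 0 T1 / 8) / a) / 4) :
    3 * T1 * (u 0 T1 / 8) ^ p ≤ 2 * iR * h := by
  have hm := H.pos 0 (Nat.zero_le _) T1 ⟨hT1.le, hT⟩
  have hmM := H.le 0 T1 ⟨hT1.le, hT⟩
  have hn' : (1:ℝ) ≤ n := by exact_mod_cast H.hn
  have hn0 : (0:ℝ) < n := by linarith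
  have hh := H.hh
  have hp := H.hp
  obtain ⟨c, hc⟩ : ∃ y, y = u 0 T1 / 8 := ⟨_, rfl⟩
  have hm8 : u 0 T1 = 8 * c := by rw [hc]; ring
  rw [← hc] at hΛ ⊢
  have hcp : 0 < c := by linarith
  have hex := H.exists_small hT1 hT hiR hN ha hcp (by linarith) hini hΛ
  classical
  obtain ⟨J, hJ⟩ : ∃ J, J = Nat.find hex := ⟨_, rfl⟩
  have hJ1 : J < 2 * iR ∧ u J T1 < c := by rw [hJ]; exact Nat.find_spec hex
  have hJ2 : ∀ i < J, c ≤ u i T1 := by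
    intro i hi
    have := Nat.find_min hex (by rw [← hJ]; exact hi)
    by_contra hcon
    push Not at hcon
    exact this ⟨by omega, hcon⟩
  obtain ⟨Φ, hΦ1, hΦ2⟩ := exists_Phi p hp
  obtain ⟨A, hA⟩ : ∃ y, y = c ^ (1-p) := ⟨_, rfl⟩
  have hAp : 0 < A := by rw [hA]; positivity
  have h20 : 0 ≤ T1 / 2 := by linarith
  have h21 : T1 / 2 ≤ T1 := by linarith
  obtain ⟨f, hf⟩ : ∃ f : ℕ → ℝ, f = fun j => ∫ t in (T1/2)..T1, u j t := ⟨_, rfl⟩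
  have hDl := D_lower hh H.hn hAp.le f J (by
    intro i hi
    have hiN : i ≤ N := by omega
    rw [hf, H.Lint hΦ1 hiN h20 h21 hT]
    have hb := hJ2 i hi
    have hb0 : 0 < u i T1 := by linarith
    have hu := H.pos i hiN (T1/2) ⟨h20, by linarith⟩
    have e1 := hΦ2 (u i T1) (u i (T1/2)) hb0 hu
    have e2 := H.le_two_mul i (show 0 < T1/2 by linarith) h21 hT (by linarith)
    refine le_trans ?_ e1
    have e3 : -1 ≤ Real.log (u i T1 / u i (T1/2)) := by
      have : (1/2 : ℝ) ≤ u i T1 / u i (T1/2) := by rw [le_div_iff₀ hu]; linarith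
      have h4 := log_le_log (by norm_num) this
      rw [one_div, log_inv] at h4
      have := log_two_lt_d9
      linarith
    have e4 : u i T1 ^ (1-p) ≤ A := by
      rw [hA]; exact rpow_le_rpow_of_nonpos hcp hb (by linarith)
    have e5 := rpow_nonneg hb0.le (1-p)
    have := mul_le_mul_of_nonneg_left e3 e5
    linarith)
  have hsum : ∀ i ≤ J, f 0 - i * (A * h / n) ≤ f i := by
    intro i
    induction i with
    | zero => intro _; simp
    | succ i ih =>
      intro hi
      have a1 := ih (by omega)
      have a2 := hDl i (by omega)
      push_cast; linarith
  have g0 : T1 / 2 * (8 * c) ≤ f 0 := by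
    have : ∫ t in (T1/2)..T1, (8 * c) ≤ f 0 := by
      rw [hf]
      refine intervalIntegral.integral_mono_on h21 (by simp) (H.ii _ h20 h21 hT) ?_
      intro t ht
      rw [← hm8]
      exact H.u0_anti ⟨by linarith [ht.1], ht.2.trans hT⟩ ⟨hT1.le, hT⟩ ht.2
    rw [intervalIntegral.integral_const, smul_eq_mul] at this
    linarith
  have gJ : f J ≤ T1 / 2 * (2 * c) := by
    have : f J ≤ ∫ t in (T1/2)..T1, (2 * c) := by
      rw [hf]
      refine intervalIntegral.integral_mono_on h21 (H.ii _ h20 h21 hT) (by simp) ?_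
      intro t ht
      have := H.le_two_mul J (show 0 < t by linarith [ht.1]) ht.2 hT (by linarith [ht.1])
      linarith [hJ1.2]
    rw [intervalIntegral.integral_const, smul_eq_mul] at this
    linarith
  have hs := hsum J le_rfl
  have hJR : (J:ℝ) ≤ 2 * iR := by exact_mod_cast hJ1.1.le
  have hAn : A * h / n ≤ A * h := div_le_self (by positivity) hn'
  have k1 : (J:ℝ) * (A * h / n) ≤ 2 * iR * (A * h) :=
    mul_le_mul hJR hAn (by positivity) (by positivity)
  have k2 : 3 * T1 * c ≤ 2 * iR * h * A := by linarith
  have k3 : c = c ^ p * A := by rw [hA, ← rpow_add hcp]; simp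
  rw [k3] at k2
  have k4 : 3 * T1 * c ^ p * A ≤ 2 * iR * h * A := by linarith
  exact le_of_mul_le_mul_right k4 hAp
end DSol


theorem u0_decay (n : ℕ) (hn : 1 ≤ n) (κ : ℝ) (hκ : 0 < κ)
    (u₀ : EuclideanSpace ℝ (Fin n) → ℝ)
    (hc : Continuous u₀) (hpos : ∀ x, 0 < u₀ x)
    (w : ℝ → ℝ) (hw : AntitoneOn w (Set.Ici 0)) (hr : ∀ x, u₀ x = w ‖x‖)
    (e : EuclideanSpace ℝ (Fin n)) (he : ‖e‖ = 1)
    (hlim : Filter.Tendsto u₀ (Filter.cocompact _) (nhds 0))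
    (hintg : IntegrableOn (fun x => Real.log (1 / u₀ x) ^ (-κ)) {x | u₀ x < 1/2} volume) :
    ∃ c > (0:ℝ), ∃ r1 > (0:ℝ), ∀ r ≥ r1, w r < 1/2 ∧ c * r ^ n ≤ Real.log (1 / w r) ^ κ := by
  have hwr : ∀ r, 0 ≤ r → w r = u₀ (r • e) := fun r h0 => by
    rw [hr, norm_smul, he, mul_one, Real.norm_of_nonneg h0]
  have hwp : ∀ r, 0 ≤ r → 0 < w r := fun r h0 => by rw [hwr r h0]; exact hpos _
  obtain ⟨r0, hr0, hr0w⟩ : ∃ r0 > (0:ℝ), ∀ r ≥ r0, w r < 1/2 := by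
    have h1 : ∀ᶠ x in Filter.cocompact (EuclideanSpace ℝ (Fin n)), u₀ x < 1/2 :=
      hlim.eventually (gt_mem_nhds (by norm_num))
    obtain ⟨K, hK2⟩ := Metric.closedBall_compl_subset_of_mem_cocompact h1 (0 : EuclideanSpace ℝ (Fin n))
    refine ⟨max K 0 + 1, by positivity, fun r hr' => ?_⟩
    have hr1 : K < r := by linarith [le_max_left K 0]
    have hr2 : 0 ≤ r := by linarith [le_max_right K 0]
    rw [hwr r hr2]
    refine hK2 ?_
    simp only [mem_compl_iff, mem_closedBall, dist_zero_right, norm_smul, he, mul_one,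
      Real.norm_of_nonneg hr2, not_le]
    exact hr1
  obtain ⟨I, hI⟩ : ∃ I, I = ∫ x in {x | u₀ x < 1/2}, Real.log (1 / u₀ x) ^ (-κ) := ⟨_, rfl⟩
  obtain ⟨ω, hω⟩ : ∃ ω, ω = (volume : Measure (EuclideanSpace ℝ (Fin n))).real (ball 0 1) := ⟨_, rfl⟩
  have hSm : MeasurableSet {x | u₀ x < 1/2} := (isOpen_lt hc continuous_const).measurableSet
  have hlogp : ∀ y, 0 < y → y < 1/2 → 0 < Real.log (1 / y) := fun y h1 h2 =>
    Real.log_pos (by rw [lt_div_iff₀ h1]; linarith)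
  have hI0 : 0 ≤ I := by
    rw [hI]
    refine setIntegral_nonneg hSm (fun x hx => (Real.rpow_pos_of_pos (hlogp _ (hpos x) hx) _).le)
  have hω0 : 0 < ω := by
    rw [hω]
    exact ENNReal.toReal_pos (measure_ball_pos _ _ one_pos).ne' measure_ball_lt_top.ne
  have hfr : Module.finrank ℝ (EuclideanSpace ℝ (Fin n)) = n := by simp
  refine ⟨ω / (2 * (I + 1)), by positivity, 2 * r0, by positivity, fun r hr' => ?_⟩
  have hrr : r0 ≤ r := by linarith
  have hr00 : 0 ≤ r := by linarith
  refine ⟨hr0w r hrr, ?_⟩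
  obtain ⟨l, hl⟩ : ∃ l, l = Real.log (1 / w r) := ⟨_, rfl⟩
  have hl0 : 0 < l := by rw [hl]; exact hlogp _ (hwp r hr00) (hr0w r hrr)
  rw [← hl]
  have hAS : closedBall (0 : EuclideanSpace ℝ (Fin n)) r \ ball 0 r0 ⊆ {x | u₀ x < 1/2} := by
    intro x hx
    have : r0 ≤ ‖x‖ := by simpa using hx.2
    show u₀ x < 1/2
    rw [hr]; exact hr0w _ this
  have hAm : MeasurableSet (closedBall (0 : EuclideanSpace ℝ (Fin n)) r \ ball 0 r0) :=
    measurableSet_closedBall.diff measurableSet_ball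
  have : Nontrivial (EuclideanSpace ℝ (Fin n)) := ⟨⟨e, 0, fun h => by simp [h] at he⟩⟩
  have hvol : (volume : Measure (EuclideanSpace ℝ (Fin n))).real (closedBall 0 r \ ball 0 r0) = r ^ n * ω - r0 ^ n * ω := by
    rw [measureReal_sdiff (ball_subset_closedBall.trans (closedBall_subset_closedBall hrr)) measurableSet_ball
      measure_closedBall_lt_top.ne,
      Measure.addHaar_real_closedBall _ _ hr00, ← Measure.addHaar_real_closedBall_eq_addHaar_real_ball _ _ r0,
      Measure.addHaar_real_closedBall _ _ hr0.le, hfr, hω]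
  have hvf : volume (closedBall (0 : EuclideanSpace ℝ (Fin n)) r \ ball 0 r0) ≠ ⊤ :=
    (lt_of_le_of_lt (measure_mono sdiff_subset) measure_closedBall_lt_top).ne
  have h1 : l ^ (-κ) * (r ^ n * ω - r0 ^ n * ω) ≤ I := by
    have e1 : ∫ x in closedBall (0 : EuclideanSpace ℝ (Fin n)) r \ ball 0 r0, l ^ (-κ) = l ^ (-κ) * (r ^ n * ω - r0 ^ n * ω) := by
      rw [setIntegral_const, hvol, smul_eq_mul, mul_comm]
    rw [← e1, hI]
    refine (setIntegral_mono_on (integrableOn_const hvf) (hintg.mono_set hAS) hAm ?_).trans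
      (setIntegral_mono_set hintg ?_ (LE.le.eventuallyLE hAS))
    · intro x hx
      have hx1 : ‖x‖ ≤ r := by simpa using hx.1
      have hx2 : u₀ x < 1/2 := hAS hx
      refine Real.rpow_le_rpow_of_nonpos (hlogp _ (hpos x) hx2) ?_ (by linarith)
      rw [hl]
      refine Real.log_le_log (by have := hpos x; positivity) ?_
      refine one_div_le_one_div_of_le (hwp r hr00) ?_
      rw [hr]; exact hw (norm_nonneg x) hr00 hx1
    · refine (ae_restrict_iff' hSm).2 (Eventually.of_forall fun x hx => ?_)
      exact (Real.rpow_pos_of_pos (hlogp _ (hpos x) hx) _).le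
  have h2 : r0 ^ n ≤ r ^ n / 2 := by
    have : r0 ≤ r / 2 := by linarith
    refine (pow_le_pow_left₀ hr0.le this n).trans ?_
    rw [div_pow]
    refine div_le_div_of_nonneg_left (by positivity) (by norm_num) ?_
    calc (2:ℝ) = 2 ^ 1 := by norm_num
      _ ≤ 2 ^ n := pow_le_pow_right₀ (by norm_num) hn
  have hlk : 0 < l ^ κ := Real.rpow_pos_of_pos hl0 _
  rw [Real.rpow_neg hl0.le, inv_mul_le_iff₀ hlk] at h1
  have h3 : r0 ^ n * ω ≤ r ^ n / 2 * ω := mul_le_mul_of_nonneg_right h2 hω0.le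
  rw [div_mul_eq_mul_div, div_le_iff₀ (by positivity)]
  nlinarith

theorem exists_Fam (n : ℕ) (hn : 1 ≤ n) (p : ℝ) (hp : 1 ≤ p) {M T : ℝ} (hM : 0 < M) (hT : 0 < T)
    (g : ℝ → ℝ) (gc : Continuous g) (ga : Antitone g) (gp : ∀ s, 0 < g s) (gM : ∀ s, g s ≤ M) :
    ∃ us, Fam n p M T g us := by
  have h : ∀ k : ℕ, ∃ u, DSol n ((k+1)^2) p (hk k) M T u ∧ ∀ i ≤ (k+1)^2, u i 0 = g (i * hk k) := by
    intro k
    refine exists_DSol n ((k+1)^2) p (hk k) M T hn hp (hk_pos k) hM hT (fun i => g (i * hk k))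
      (fun i => gp _) (fun i => gM _) (fun i => ga ?_)
    refine mul_le_mul_of_nonneg_right ?_ (hk_pos k).le
    push_cast; linarith
  choose us h1 h2 using h
  exact ⟨us, ⟨hn, hp, hM, hT, gc, ga, gp, gM, h1, h2⟩⟩

theorem dbound {n k : ℕ} {p M T t s : ℝ} {us : ℕ → ℝ → ℝ} (D : DSol n ((k+1)^2) p (hk k) M T us)
    (htT : t ≤ T) (hs : 0 < s) (hL1 : 1 ≤ Real.log t) (ht : 0 < t)
    (hini : ∀ i : ℕ, i ≤ (k+1)^2 → s ≤ i * hk k → us i 0 ≤ t ^ (-10:ℝ))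
    (hk2 : 2 * (s + 1) ≤ (k:ℝ) + 1) (hLL : 4 * Real.log (8 * M) + Real.log 8 < 5 * Real.log t) :
    us 0 t ≤ t ^ (-(1:ℝ)/p) ∨ 3 * t * (us 0 t / 8) ^ p ≤ 2 * (s + 1) := by
  rcases le_or_gt (us 0 t) (t ^ (-(1:ℝ)/p)) with h | h
  · exact Or.inl h
  right
  have hh := hk_pos k
  have hh1 := hk_le k
  have hp := D.hp
  obtain ⟨iR, hiR⟩ : ∃ i, i = ⌈s / hk k⌉₊ := ⟨_, rfl⟩
  have i1 : 1 ≤ iR := by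
    rw [hiR]; exact Nat.one_le_iff_ne_zero.2 (Nat.ceil_pos.2 (by positivity)).ne'
  have i2 : s ≤ iR * hk k := by
    rw [← div_le_iff₀ hh, hiR]; exact Nat.le_ceil _
  have i3 : iR * hk k ≤ s + 1 := by
    have : (iR:ℝ) < s / hk k + 1 := by rw [hiR]; exact Nat.ceil_lt_add_one (by positivity)
    have h5 := mul_le_mul_of_nonneg_right this.le hh.le
    rw [add_mul, div_mul_cancel₀ _ hh.ne'] at h5
    linarith
  have i4 : 2 * iR ≤ (k+1)^2 := by
    have h5 : ((2 * iR : ℕ) : ℝ) * hk k ≤ (((k+1)^2:ℕ):ℝ) * hk k := by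
      rw [hk_N]; push_cast; linarith
    exact_mod_cast le_of_mul_le_mul_right h5 hh
  have hm0 : 0 < us 0 t := lt_of_le_of_lt (by positivity) h
  have hM := D.hM
  have hmM : us 0 t ≤ M := D.le 0 t ⟨ht.le, htT⟩
  have ha : 0 < t ^ (-10:ℝ) := Real.rpow_pos_of_pos ht _
  have hlm : -Real.log t ≤ Real.log (us 0 t) := by
    have := Real.log_le_log (Real.rpow_pos_of_pos ht _) h.le
    rw [Real.log_rpow ht] at this
    have h6 : 1 / p ≤ 1 := by rw [div_le_one (by linarith)]; exact hp
    have h7 : 1 / p * Real.log t ≤ 1 * Real.log t := mul_le_mul_of_nonneg_right h6 (by linarith)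
    have h8 : -(1:ℝ)/p * Real.log t = -(1 / p * Real.log t) := by ring
    linarith
  have key := D.decay ht htT i1 i4 ha (fun i hi hiN => hini i hiN (i2.trans
    (mul_le_mul_of_nonneg_right (by exact_mod_cast hi) hh.le))) ?_
  · refine key.trans ?_
    rw [mul_assoc]; linarith
  · have e1 : Real.log (M / (us 0 t / 8)) = Real.log (8 * M) - Real.log (us 0 t) := by
      rw [← Real.log_div (by positivity) hm0.ne']; congr 1; field_simp
    have e2 : Real.log (us 0 t / 8 / t ^ (-10:ℝ)) = Real.log (us 0 t) - Real.log 8 + 10 * Real.log t := by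
      rw [Real.log_div (by positivity) ha.ne', Real.log_div hm0.ne' (by norm_num), Real.log_rpow ht]; ring
    have e3 : 0 ≤ Real.log (M / (us 0 t / 8)) :=
      Real.log_nonneg (by rw [le_div_iff₀ (by positivity)]; linarith)
    have hn : (1:ℝ) ≤ n := by exact_mod_cast D.hn
    have e4 := div_le_self e3 hn
    rw [e2]
    rw [e1] at e4 ⊢
    linarith

theorem final_alg {p L q t m C3 : ℝ} (hp : 1 ≤ p) (hL : 1 ≤ L) (hq : 0 ≤ q) (ht : 0 < t) (hm : 0 ≤ m)
    (hC3 : 0 ≤ C3) (h : m ≤ t ^ (-(1:ℝ)/p) ∨ 3 * t * (m / 8) ^ p ≤ 2 * (C3 * L ^ q)) :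
    m ≤ (8 * C3 ^ (1/p) + 1) * t ^ (-(1:ℝ)/p) * L ^ (q / p) := by
  have hp0 : 0 < p := by linarith
  have h1 : 1 ≤ L ^ (q/p) := Real.one_le_rpow hL (by positivity)
  have ht0 : 0 < t ^ (-(1:ℝ)/p) := Real.rpow_pos_of_pos ht _
  have hc0 : 0 ≤ C3 ^ (1/p) := Real.rpow_nonneg hC3 _
  have hsplit : (8 * C3 ^ (1/p) + 1) * t ^ (-(1:ℝ)/p) * L ^ (q / p) =
      8 * (C3 ^ (1/p) * t ^ (-(1:ℝ)/p) * L ^ (q / p)) + t ^ (-(1:ℝ)/p) * L ^ (q / p) := by ring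
  have hA : 0 ≤ C3 ^ (1/p) * t ^ (-(1:ℝ)/p) * L ^ (q / p) := by positivity
  have hB : t ^ (-(1:ℝ)/p) ≤ t ^ (-(1:ℝ)/p) * L ^ (q / p) := le_mul_of_one_le_right ht0.le h1
  rw [hsplit]
  rcases h with h | h
  · linarith
  · have h2 : (m / 8) ^ p ≤ C3 * t ^ (-1:ℝ) * L ^ q := by
      have h3 : 0 ≤ C3 * L ^ q := by positivity
      rw [Real.rpow_neg_one]
      have : C3 * t⁻¹ * L ^ q = (C3 * L ^ q) / t := by field_simp
      rw [this, le_div_iff₀ ht]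
      linarith
    have h4 := Real.rpow_le_rpow (by positivity) h2 (by positivity : 0 ≤ 1/p)
    rw [← Real.rpow_mul (by positivity), mul_one_div_cancel hp0.ne', Real.rpow_one,
      Real.mul_rpow (by positivity) (by positivity), Real.mul_rpow (by positivity) (by positivity),
      ← Real.rpow_mul ht.le, ← Real.rpow_mul (by linarith)] at h4
    have e1 : (-1:ℝ) * (1/p) = -(1:ℝ)/p := by ring
    have e2 : q * (1/p) = q / p := by ring
    rw [e1, e2] at h4
    linarith

/-- Corollary 3.9 of Fila–Winkler.
If `p ≥ 1` and the positive, radially symmetric, radially nonincreasing continuous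
initial data satisfy `u₀(x) → 0` as `|x| → ∞` and
`∫_{u₀ < 1/2} (ln(1/u₀))^{-κ} < ∞` for some `κ > 0`, then there are `t₀ > 1` and
`C > 0` such that the minimal solution satisfies
`‖u(·,t)‖_{L^∞} ≤ C t^{-1/p} (ln t)^{2κ/(np)}` for all `t ≥ t₀`
(stated pointwise, which is equivalent for a continuous function). -/
theorem stmt_16 (n : ℕ) (hn : 1 ≤ n)
    (p κ : ℝ) (hp : 1 ≤ p) (hκ : 0 < κ)
    (u₀ : EuclideanSpace ℝ (Fin n) → ℝ)
    (hu₀cont : Continuous u₀) (hu₀pos : ∀ x, 0 < u₀ x)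
    (hu₀rad : ∃ w : ℝ → ℝ, AntitoneOn w (Set.Ici 0) ∧ ∀ x, u₀ x = w ‖x‖)
    (hu₀lim : Filter.Tendsto u₀ (Filter.cocompact _) (nhds 0))
    (hu₀int : IntegrableOn (fun x => Real.log (1 / u₀ x) ^ (-κ))
      {x | u₀ x < 1/2} volume)
    (u : EuclideanSpace ℝ (Fin n) → ℝ → ℝ)
    (hu : IsMinimalSol n p u₀ u) :
    ∃ t₀ > (1:ℝ), ∃ C > (0:ℝ), ∀ t ≥ t₀, ∀ x,
      u x t ≤ C * t ^ (-(1:ℝ)/p) * Real.log t ^ (2*κ/((n:ℝ)*p)) := by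
  obtain ⟨w, hw, hr⟩ := hu₀rad
  obtain ⟨e, he⟩ : ∃ e : EuclideanSpace ℝ (Fin n), ‖e‖ = 1 :=
    ⟨EuclideanSpace.single ⟨0, hn⟩ 1, by simp⟩
  obtain ⟨c, hc, r1, hr1, hdec⟩ := u0_decay n hn κ hκ u₀ hu₀cont hu₀pos w hw hr e he hu₀lim hu₀int
  have hwr : ∀ r, 0 ≤ r → u₀ (r • e) = w r := fun r h0 => by
    rw [hr, norm_smul, he, mul_one, Real.norm_of_nonneg h0]
  obtain ⟨g, hg⟩ : ∃ g : ℝ → ℝ, g = fun s => u₀ (√(2*s) • e) := ⟨_, rfl⟩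
  have hgw : ∀ s, g s = w (√(2*s)) := fun s => by rw [hg]; exact hwr _ (Real.sqrt_nonneg _)
  have gc : Continuous g := by
    rw [hg]
    exact hu₀cont.comp ((Real.continuous_sqrt.comp (continuous_const.mul continuous_id)).smul continuous_const)
  have ga : Antitone g := by
    intro a b hab
    rw [hgw, hgw]
    exact hw (Real.sqrt_nonneg _) (Real.sqrt_nonneg _) (Real.sqrt_le_sqrt (by linarith))
  have gp : ∀ s, 0 < g s := fun s => by rw [hg]; exact hu₀pos _
  obtain ⟨M, hM⟩ : ∃ M, M = w 0 := ⟨_, rfl⟩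
  have gM : ∀ s, g s ≤ M := fun s => by
    rw [hgw, hM]; exact hw self_mem_Ici (Real.sqrt_nonneg _) (Real.sqrt_nonneg _)
  have hM0 : 0 < M := (gp 0).trans_le (gM 0)
  have hgu : ∀ x, u₀ x = g (‖x‖^2/2) := fun x => by
    rw [hgw, hr]; congr 1
    rw [mul_div_cancel₀ _ (by norm_num : (2:ℝ) ≠ 0), Real.sqrt_sq (norm_nonneg x)]
  have hn0 : (0:ℝ) < n := by exact_mod_cast hn
  obtain ⟨B, hB⟩ : ∃ B : ℝ, B = ((10:ℝ) ^ κ / c) ^ (2 / (n:ℝ)) := ⟨_, rfl⟩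
  have hB0 : 0 < B := by rw [hB]; positivity
  obtain ⟨L0, hL0⟩ : ∃ L0, L0 = max 1 (max ((c * r1 ^ n) ^ (1/κ)) (4 * Real.log (8 * M) + Real.log 8)) := ⟨_, rfl⟩
  have hLa : 1 ≤ L0 := by rw [hL0]; exact le_max_left _ _
  have hLb : (c * r1 ^ n) ^ (1/κ) ≤ L0 := by
    rw [hL0]; exact (le_max_left _ _).trans (le_max_right _ _)
  have hLc : 4 * Real.log (8 * M) + Real.log 8 ≤ L0 := by
    rw [hL0]; exact (le_max_right _ _).trans (le_max_right _ _)
  refine ⟨Real.exp L0, Real.one_lt_exp_iff.2 (by linarith), 8 * (B/2 + 1) ^ (1/p) + 1, by positivity, ?_⟩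
  intro t ht x
  have ht0 : 0 < t := (Real.exp_pos _).trans_le ht
  obtain ⟨L, hL⟩ : ∃ L, L = Real.log t := ⟨_, rfl⟩
  have hLL0 : L0 ≤ L := by rw [hL, Real.le_log_iff_exp_le ht0]; exact ht
  have hL1 : 1 ≤ L := hLa.trans hLL0
  obtain ⟨R, hR⟩ : ∃ R, R = ((10 * L) ^ κ / c) ^ (1/(n:ℝ)) := ⟨_, rfl⟩
  have hR0 : 0 < R := by rw [hR]; positivity
  have hRn : R ^ n = (10 * L) ^ κ / c := by
    rw [hR, ← Real.rpow_natCast, ← Real.rpow_mul (by positivity), one_div_mul_cancel hn0.ne', Real.rpow_one]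
  have hR2 : R ^ 2 = B * L ^ (2 * κ / n) := by
    rw [hR, hB, ← Real.rpow_natCast, ← Real.rpow_mul (by positivity),
      Real.mul_rpow (by norm_num) (by linarith), mul_div_right_comm,
      Real.mul_rpow (by positivity) (by positivity), ← Real.rpow_mul (by linarith)]
    congr 2
    · push_cast; ring
    · push_cast; ring
  have hRr1 : r1 ≤ R := by
    refine le_of_pow_le_pow_left₀ (n := n) (by omega) hR0.le ?_
    rw [hRn, le_div_iff₀ hc]
    have h1 := Real.rpow_le_rpow (by positivity) (hLb.trans hLL0) hκ.le
    rw [← Real.rpow_mul (by positivity), one_div_mul_cancel hκ.ne', Real.rpow_one] at h1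
    have h2 : L ^ κ ≤ (10 * L) ^ κ := Real.rpow_le_rpow (by linarith) (by linarith) hκ.le
    linarith
  have hsm : ∀ s, R ^ 2 / 2 ≤ s → g s ≤ t ^ (-10:ℝ) := by
    intro s hs
    have hRs : R ≤ √(2 * s) := Real.le_sqrt_of_sq_le (by linarith)
    have hr0 : 0 ≤ √(2 * s) := Real.sqrt_nonneg _
    obtain ⟨d1, d2⟩ := hdec _ (hRr1.trans hRs)
    have hwp : 0 < w (√(2 * s)) := by rw [← hgw]; exact gp s
    have hlp : 0 ≤ Real.log (1 / w (√(2 * s))) :=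
      Real.log_nonneg (by rw [le_div_iff₀ hwp]; linarith)
    have h3 : c * R ^ n ≤ c * √(2 * s) ^ n :=
      mul_le_mul_of_nonneg_left (pow_le_pow_left₀ hR0.le hRs n) hc.le
    rw [hRn, mul_div_cancel₀ _ hc.ne'] at h3
    have h4 : 10 * L ≤ Real.log (1 / w (√(2 * s))) :=
      (Real.rpow_le_rpow_iff (by linarith) hlp hκ).1 (h3.trans d2)
    rw [hgw, ← Real.log_le_log_iff hwp (Real.rpow_pos_of_pos ht0 _), Real.log_rpow ht0, ← hL]
    rw [one_div, Real.log_inv] at h4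
    linarith
  obtain ⟨us, H⟩ := exists_Fam n hn p hp hM0 (T := t + 1) (by linarith) g gc ga gp gM
  have htT : t ∈ Icc 0 (t + 1) := ⟨ht0.le, by linarith⟩
  have hle1 : u x t ≤ UU us (‖x‖^2/2) t :=
    hu.2 (t + 1) (by linarith) _ (H.isSolOn u₀ hgu) x t ht0.le (by linarith)
  refine hle1.trans ((H.U_le htT).trans ?_)
  refine le_of_tendsto (H.tU 0 htT) ?_
  filter_upwards [ev_uf (ev_ge (2 * (R ^ 2 / 2 + 1)))] with k hk2
  rw [gi_zero]
  have hb := dbound (H.sol k) (t := t) (s := R ^ 2 / 2) (by linarith) (by positivity)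
    (by rw [← hL]; exact hL1) ht0
    (fun i hi his => by rw [H.ini k i hi]; exact hsm _ his) hk2 (by rw [← hL]; linarith)
  have hq : 0 ≤ 2 * κ / (n:ℝ) := by positivity
  have hm0 : 0 ≤ us k 0 t := ((H.sol k).pos 0 (Nat.zero_le _) t htT).le
  have hLq : 1 ≤ L ^ (2 * κ / (n:ℝ)) := Real.one_le_rpow hL1 hq
  have := final_alg (C3 := B / 2 + 1) (L := L) (q := 2 * κ / (n:ℝ)) hp hL1 hq ht0 hm0 (by positivity)
    (hb.imp id (fun h => h.trans (by rw [hR2]; linarith)))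
  rw [← hL]
  rwa [div_div] at this
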